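/- Let p > 3 be a prime. Then for every integer i ≥ 2: H^{2i-1}(SL₂(ℤ[1/p]), ℤ) ≅ ℤ/6 if p ≡ 1 (mod 12), ℤ/2 if p ≡ 5 (mod 12), ℤ/3 if p ≡ 7 (mod 12), and 0 if p ≡ 11 (mod 12). -/

import Mathlib

set_option linter.all false

section
open CategoryTheory

namespace SL2coh

open groupCohomology

section les

variable {k : Type} [CommRing k] {G : Type} [Group G]

theorem shortExact_of {X : ShortComplex (Rep.{0} k G)}
    (hf : Function.Injective X.f.hom)
    (hg : Function.Surjective X.g.hom)
    (hex : ∀ y, X.g.hom y = 0 → ∃ x, X.f.hom x = y) : X.ShortExact where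
  exact := by
    have h : (X.map (forget₂ (Rep.{0} k G) (ModuleCat.{0} k))).Exact := by
      rw [ShortComplex.moduleCat_exact_iff]
      intro y hy
      exact hex y hy
    exact (ShortComplex.exact_map_iff_of_faithful X (forget₂ (Rep.{0} k G) (ModuleCat.{0} k))).1 h
  mono_f := (Rep.mono_iff_injective _).2 hf
  epi_g := (Rep.epi_iff_surjective _).2 hg

variable {X : ShortComplex (Rep.{0} k G)}

theorem les2 (hX : X.ShortExact) (n : ℕ) (y : groupCohomology X.X₂ n)
    (h : (groupCohomology.map (MonoidHom.id G) X.g n).hom y = 0) :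
    ∃ x, (groupCohomology.map (MonoidHom.id G) X.f n).hom x = y := by
  have := (ShortComplex.moduleCat_exact_iff _).1 (mapShortComplex₂_exact hX n) y h
  exact this

theorem les3 (hX : X.ShortExact) (n : ℕ) (z : groupCohomology X.X₃ n)
    (h : (groupCohomology.δ hX n (n+1) rfl).hom z = 0) :
    ∃ y, (groupCohomology.map (MonoidHom.id G) X.g n).hom y = z := by
  have := (ShortComplex.moduleCat_exact_iff _).1
    (mapShortComplex₃_exact hX (i := n) (j := n+1) rfl) z h
  exact this

theorem les1 (hX : X.ShortExact) (n : ℕ) (x : groupCohomology X.X₁ (n+1))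
    (h : (groupCohomology.map (MonoidHom.id G) X.f (n+1)).hom x = 0) :
    ∃ z, (groupCohomology.δ hX n (n+1) rfl).hom z = x := by
  have := (ShortComplex.moduleCat_exact_iff _).1
    (mapShortComplex₁_exact hX (i := n) (j := n+1) rfl) x h
  exact this

theorem les_fg (n : ℕ) (x : groupCohomology X.X₁ n) :
    (groupCohomology.map (MonoidHom.id G) X.g n).hom
      ((groupCohomology.map (MonoidHom.id G) X.f n).hom x) = 0 := by
  have := congr($((mapShortComplex₂ X n).zero).hom x)
  exact this

theorem les_gδ (hX : X.ShortExact) (n : ℕ) (y : groupCohomology X.X₂ n) :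
    (groupCohomology.δ hX n (n+1) rfl).hom
      ((groupCohomology.map (MonoidHom.id G) X.g n).hom y) = 0 := by
  have := congr($((mapShortComplex₃ hX (i := n) (j := n+1) rfl).zero).hom y)
  exact this

theorem les_δf (hX : X.ShortExact) (n : ℕ) (z : groupCohomology X.X₃ n) :
    (groupCohomology.map (MonoidHom.id G) X.f (n+1)).hom
      ((groupCohomology.δ hX n (n+1) rfl).hom z) = 0 := by
  have := congr($((mapShortComplex₁ hX (i := n) (j := n+1) rfl).zero).hom z)
  exact this

end les

section functoriality

variable {k : Type} [CommRing k] {G H K : Type} [Group G] [Group H] [Group K]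

/-- restriction in cohomology along a homomorphism -/
noncomputable abbrev rs (f : G →* H) (A : Rep.{0} k H) (n : ℕ) :
    groupCohomology A n ⟶ groupCohomology (Rep.res f A) n :=
  groupCohomology.map f (𝟙 _) n

/-- change of coefficients in cohomology -/
noncomputable abbrev cf {A B : Rep.{0} k G} (φ : A ⟶ B) (n : ℕ) :
    groupCohomology A n ⟶ groupCohomology B n :=
  groupCohomology.map (MonoidHom.id G) φ n

theorem cf_add {A B : Rep.{0} k G} (φ ψ : A ⟶ B) (n : ℕ) :
    cf (φ + ψ) n = cf φ n + cf ψ n := by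
  have h : cochainsMap (MonoidHom.id G) (φ + ψ)
      = cochainsMap (MonoidHom.id G) φ + cochainsMap (MonoidHom.id G) ψ := by
    rfl
  unfold cf groupCohomology.map
  rw [h, HomologicalComplex.homologyMap_add]
  rfl

theorem cf_id (A : Rep.{0} k G) (n : ℕ) (x : groupCohomology A n) : (cf (𝟙 A) n).hom x = x := by
  simp [cf, groupCohomology.map_id]

theorem cf_zero {A B : Rep.{0} k G} (n : ℕ) : cf (0 : A ⟶ B) n = 0 := by
  have := cf_add (0 : A ⟶ B) 0 n
  simpa using this

theorem cf_comp {A B C : Rep.{0} k G} (φ : A ⟶ B) (ψ : B ⟶ C) (n : ℕ)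
    (x : groupCohomology A n) : (cf ψ n).hom ((cf φ n).hom x) = (cf (φ ≫ ψ) n).hom x := by
  rw [cf, cf, cf, groupCohomology.map_id_comp]; rfl

theorem cf_sum {ι : Type} {A B : Rep.{0} k G} (s : Finset ι) (φ : ι → (A ⟶ B)) (n : ℕ)
    (x : groupCohomology A n) :
    (cf (∑ i ∈ s, φ i) n).hom x = ∑ i ∈ s, (cf (φ i) n).hom x := by
  classical
  induction s using Finset.induction with
  | empty => simp [cf_zero]
  | insert a s ha ih => rw [Finset.sum_insert ha, Finset.sum_insert ha, cf_add, ← ih]; rfl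

theorem cf_neg {A B : Rep.{0} k G} (φ : A ⟶ B) (n : ℕ) (x : groupCohomology A n) :
    (cf (-φ) n).hom x = - (cf φ n).hom x := by
  have h := cf_add φ (-φ) n
  rw [add_neg_cancel, cf_zero] at h
  have h2 := congr(($h).hom x)
  simp only [ModuleCat.hom_add, LinearMap.add_apply, ModuleCat.hom_zero, LinearMap.zero_apply] at h2
  exact (neg_eq_of_add_eq_zero_right h2.symm).symm

theorem cf_sub {A B : Rep.{0} k G} (φ ψ : A ⟶ B) (n : ℕ) (x : groupCohomology A n) :
    (cf (φ - ψ) n).hom x = (cf φ n).hom x - (cf ψ n).hom x := by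
  rw [sub_eq_add_neg, cf_add, sub_eq_add_neg, ← cf_neg]; rfl

/-- composition formula, elementwise, in a flexible form -/
theorem map_map {A : Rep.{0} k K} {B : Rep.{0} k H} {C : Rep.{0} k G} (f : H →* K) (g : G →* H)
    (φ : Rep.res f A ⟶ B) (ψ : Rep.res g B ⟶ C) (h : G →* K) (χ : Rep.res h A ⟶ C)
    (hh : h = f.comp g) (hχ : ∀ v : A.V, χ.hom v = ψ.hom (φ.hom v)) (n : ℕ)
    (x : groupCohomology A n) :
    (groupCohomology.map g ψ n).hom ((groupCohomology.map f φ n).hom x)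
      = (groupCohomology.map h χ n).hom x := by
  subst hh
  have h1 := groupCohomology.map_comp f g φ ψ n
  have h2 : groupCohomology.map (f.comp g) χ n = groupCohomology.map f φ n ≫ groupCohomology.map g ψ n := by
    rw [← h1]
    exact groupCohomology.map_congr rfl (LinearMap.ext fun v => hχ v) n
  rw [h2]; rfl

theorem map_ext {A : Rep.{0} k H} {B : Rep.{0} k G} (f g : G →* H)
    (φ : Rep.res f A ⟶ B) (ψ : Rep.res g A ⟶ B) (h : f = g)
    (hφ : ∀ v : A.V, φ.hom v = ψ.hom v) (n : ℕ) (x : groupCohomology A n) :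
    (groupCohomology.map f φ n).hom x = (groupCohomology.map g ψ n).hom x := by
  have : groupCohomology.map f φ n = groupCohomology.map g ψ n := by
    exact groupCohomology.map_congr h (LinearMap.ext fun v => hφ v) n
  rw [this]

theorem subsingleton_H_of_subsingleton [Subsingleton G] (A : Rep.{0} k G) (n : ℕ) :
    Subsingleton (groupCohomology A (n+1)) := by
  apply ModuleCat.subsingleton_of_isZero
  exact isZero_groupCohomology_succ_of_subsingleton A n

theorem map_one_zero {A : Rep.{0} k H} {B : Rep.{0} k G} (φ : Rep.res (1 : G →* H) A ⟶ B) (n : ℕ)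
    (x : groupCohomology A (n+1)) : (groupCohomology.map (1 : G →* H) φ (n+1)).hom x = 0 := by
  have := map_map (A := A) (B := Rep.res (1 : PUnit →* H) A) (C := B) (1 : PUnit →* H)
    (1 : G →* PUnit) (𝟙 _) φ 1 φ rfl (fun v => rfl) (n+1) x
  rw [← this]
  have hs := subsingleton_H_of_subsingleton (Rep.res (1 : PUnit →* H) A) n
  rw [Subsingleton.elim ((groupCohomology.map (1 : PUnit →* H) (𝟙 _) (n+1)).hom x) 0, map_zero]

end functoriality

end SL2coh

end

section
open CategoryTheory
namespace SL2coh
open groupCohomology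

section dnat
variable {k : Type} [CommRing k] {G H : Type} [Group G] [Group H]

theorem hom_ext' {A B : Rep.{0} k G} {φ ψ : A ⟶ B} (h : ∀ v : A.V, φ.hom v = ψ.hom v) : φ = ψ :=
  Rep.hom_ext (Representation.IntertwiningMap.ext (LinearMap.ext h))

/-- naturality of the connecting map for change of groups -/
theorem delta_nat (f : G →* H) {X : ShortComplex (Rep.{0} k H)} {Y : ShortComplex (Rep.{0} k G)}
    (hX : X.ShortExact) (hY : Y.ShortExact)
    (φ₁ : Rep.res f X.X₁ ⟶ Y.X₁) (φ₂ : Rep.res f X.X₂ ⟶ Y.X₂) (φ₃ : Rep.res f X.X₃ ⟶ Y.X₃)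
    (h₁ : ∀ v : X.X₁.V, φ₂.hom (X.f.hom v) = Y.f.hom (φ₁.hom v))
    (h₂ : ∀ v : X.X₂.V, φ₃.hom (X.g.hom v) = Y.g.hom (φ₂.hom v)) (n : ℕ)
    (z : groupCohomology X.X₃ n) :
    (groupCohomology.map f φ₁ (n+1)).hom ((groupCohomology.δ hX n (n+1) rfl).hom z)
      = (groupCohomology.δ hY n (n+1) rfl).hom ((groupCohomology.map f φ₃ n).hom z) := by
  let F : X.map (cochainsFunctor k H) ⟶ Y.map (cochainsFunctor k G) :=
    { τ₁ := cochainsMap f φ₁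
      τ₂ := cochainsMap f φ₂
      τ₃ := cochainsMap f φ₃
      comm₁₂ := by
        refine HomologicalComplex.hom_ext _ _ fun i => ModuleCat.hom_ext (LinearMap.ext fun x => funext fun v => ?_)
        exact (h₁ _).symm
      comm₂₃ := by
        refine HomologicalComplex.hom_ext _ _ fun i => ModuleCat.hom_ext (LinearMap.ext fun x => funext fun v => ?_)
        exact (h₂ _).symm }
  have := HomologicalComplex.HomologySequence.δ_naturality F
    (map_cochainsFunctor_shortExact hX) (map_cochainsFunctor_shortExact hY) n (n+1) rfl
  exact congr(($this).hom z)

end dnat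

section shapiro
variable {k : Type} [CommRing k] {A G : Type} [Group A] [Group G]

/-- evaluation at `1` -/
noncomputable def coindEv (α : A →* G) (M : Rep.{0} k A) : Rep.res α (Rep.coind α M) ⟶ M :=
  Rep.ofHom ⟨LinearMap.proj (1 : G) ∘ₗ Submodule.subtype _, fun a => by
    refine LinearMap.ext fun f => ?_
    change f.1 (1 * α a) = M.ρ a (f.1 1)
    rw [← f.2, one_mul, mul_one]⟩

theorem coindEv_apply (α : A →* G) (M : Rep.{0} k A) (f : (Rep.coind α M).V) :
    (coindEv α M).hom f = f.1 1 := rfl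

/-- the Shapiro map -/
noncomputable abbrev sh (α : A →* G) (M : Rep.{0} k A) (n : ℕ) :
    groupCohomology (Rep.coind α M) n ⟶ groupCohomology M n :=
  groupCohomology.map α (coindEv α M) n

theorem vanish_bot (W : Rep.{0} k (⊥ : Subgroup A)) (n : ℕ) :
    Subsingleton (groupCohomology (Rep.coind (⊥ : Subgroup A).subtype W) (n+1)) := by
  have := subsingleton_H_of_subsingleton W n
  exact (groupCohomology.coindIso W (n+1)).toLinearEquiv.toEquiv.subsingleton

theorem bot_act (W : Rep.{0} k (⊥ : Subgroup A)) (x : (⊥ : Subgroup A)) (w : W.V) : W.ρ x w = w := by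
  rw [Subsingleton.elim x 1]; simp

theorem vanish_coind_bot (α : A →* G) (W : Rep.{0} k (⊥ : Subgroup A)) (n : ℕ) :
    Subsingleton (groupCohomology (Rep.coind α (Rep.coind (⊥ : Subgroup A).subtype W)) (n+1)) := by
  let W' : Rep.{0} k (⊥ : Subgroup G) := Rep.res (1 : (⊥ : Subgroup G) →* (⊥ : Subgroup A)) W
  let r : Rep.coind α (Rep.coind (⊥ : Subgroup A).subtype W) ⟶ Rep.coind (⊥ : Subgroup G).subtype W' :=
    Rep.ofHom ⟨{ toFun := fun f => ⟨fun g => (f.1 g).1 1, fun x h => by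
                    rw [bot_act W', Subsingleton.elim x 1]; simp⟩
                 map_add' := fun _ _ => rfl
                 map_smul' := fun _ _ => rfl }, fun g => rfl⟩
  let s : Rep.coind (⊥ : Subgroup G).subtype W' ⟶ Rep.coind α (Rep.coind (⊥ : Subgroup A).subtype W) :=
    Rep.ofHom ⟨{ toFun := fun F => ⟨fun g => ⟨fun a => F.1 (α a * g), fun x h => by
                    rw [bot_act W, Subsingleton.elim x 1]; simp⟩, fun a g => by
                      refine Subtype.ext (funext fun b => ?_)
                      change F.1 (α b * (α a * g)) = F.1 (α (b * a) * g)
                      rw [map_mul, mul_assoc]⟩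
                 map_add' := fun _ _ => rfl
                 map_smul' := fun _ _ => rfl }, fun g => by
                      refine LinearMap.ext fun F => Subtype.ext (funext fun h => Subtype.ext (funext fun b => ?_))
                      change F.1 (α b * h * g) = F.1 (α b * (h * g))
                      rw [mul_assoc]⟩
  have hrs : r ≫ s = 𝟙 _ := by
    refine hom_ext' fun f => Subtype.ext (funext fun g => Subtype.ext (funext fun a => ?_))
    change (f.1 (α a * g)).1 1 = (f.1 g).1 a
    rw [f.2]
    change (f.1 g).1 (1 * a) = _
    rw [one_mul]
  have hv := vanish_bot W' n
  refine ⟨fun x y => ?_⟩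
  rw [← cf_id _ _ x, ← cf_id _ _ y, ← hrs, ← cf_comp, ← cf_comp, Subsingleton.elim ((cf r (n+1)).hom x)]

theorem coindMap_surj (α : A →* G) (hα : Function.Injective α) {X Y : Rep.{0} k A} (f : X ⟶ Y)
    (hf : Function.Surjective f.hom) : Function.Surjective (Rep.coindMap α f).hom := by
  intro y
  choose s hs using hf
  let S := α.range
  let := QuotientGroup.rightRel S
  choose! i hi using Quotient.mk'_surjective (α := G)
  have hex : ∀ g : G, ∃ a : A, α a = g * (i (Quotient.mk' g))⁻¹ := fun g => 
    QuotientGroup.rightRel_apply.1 (Quotient.eq'.1 (hi (Quotient.mk' g)))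
  choose γ hγ0 using hex
  have hmk (a : A) (g : G) : (Quotient.mk' (α a * g) : Quotient this) = Quotient.mk' g :=
    Quotient.eq'.2 (QuotientGroup.rightRel_apply.2 (by simp [S]))
  have hγ (a : A) (g : G) : γ (α a * g) = a * γ g := by
    apply hα; simp [mul_assoc, hγ0, hmk]
  let x (g : G) : X := X.ρ (γ g) (s (y.1 (i (Quotient.mk' g))))
  refine ⟨⟨x, fun a g => ?_⟩, Subtype.ext <| funext fun g => ?_⟩
  · change X.ρ _ _ = X.ρ _ (X.ρ _ _)
    rw [hγ, hmk, map_mul]; rfl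
  · change f.hom (X.ρ _ _) = _
    rw [Rep.hom_comm_apply, hs, ← y.2, hγ0]; simp

theorem coind_shortExact (α : A →* G) (hα : Function.Injective α) {X : ShortComplex (Rep.{0} k A)}
    (hX : X.ShortExact) : (X.map (Rep.coindFunctor k α)).ShortExact := by
  have hinj : Function.Injective X.f.hom := (Rep.mono_iff_injective _).1 hX.mono_f
  have hsurj : Function.Surjective X.g.hom := (Rep.epi_iff_surjective _).1 hX.epi_g
  have hex : ∀ y, X.g.hom y = 0 → ∃ x, X.f.hom x = y := fun y hy =>
    (ShortComplex.moduleCat_exact_iff _).1 (hX.exact.map (forget₂ (Rep.{0} k A) (ModuleCat.{0} k))) y hy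
  refine shortExact_of ?_ ?_ ?_
  · intro f g h
    refine Subtype.ext (funext fun x => hinj ?_)
    exact congr_fun (congr_arg Subtype.val h) x
  · exact coindMap_surj α hα X.g hsurj
  · intro y hy
    have hy' : ∀ g, ∃ x, X.f.hom x = y.1 g := fun g => hex _ (congr_fun (congr_arg Subtype.val hy) g)
    choose x hx using hy'
    refine ⟨⟨x, fun a g => hinj ?_⟩, Subtype.ext (funext hx)⟩
    rw [hx, Rep.hom_comm_apply, hx, y.2]

/-- embedding in a cohomologically trivial module -/
noncomputable def embBot (M : Rep.{0} k A) :
    M ⟶ Rep.coind (⊥ : Subgroup A).subtype (Rep.res (⊥ : Subgroup A).subtype M) :=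
  Rep.ofHom ⟨{ toFun := fun m => ⟨fun g => M.ρ g m, fun x h => by
                    change M.ρ (_ * h) m = _
                    rw [map_mul]; rfl⟩
               map_add' := fun _ _ => Subtype.ext (funext fun _ => map_add _ _ _)
               map_smul' := fun _ _ => Subtype.ext (funext fun _ => map_smul _ _ _) }, fun g => by
                 refine LinearMap.ext fun m => Subtype.ext (funext fun h => ?_)
                 change M.ρ h (M.ρ g m) = M.ρ (h * g) m
                 rw [map_mul]; rfl⟩

theorem embBot_inj (M : Rep.{0} k A) : Function.Injective (embBot M).hom := by
  intro x y h
  have : M.ρ 1 x = M.ρ 1 y := congr_fun (congr_arg Subtype.val h) 1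
  simpa using this

/-- dimension shifting -/
theorem exists_shift (M : Rep.{0} k A) : ∃ (X : ShortComplex (Rep.{0} k A)) (_ : X.ShortExact)
    (W : Rep.{0} k (⊥ : Subgroup A)), X.X₁ = M ∧ X.X₂ = Rep.coind (⊥ : Subgroup A).subtype W := by
  have := (Rep.mono_iff_injective _).2 (embBot_inj M)
  refine ⟨ShortComplex.mk (embBot M) (Limits.cokernel.π (embBot M)) (by simp), ?_, _, rfl, rfl⟩
  exact { exact := ShortComplex.exact_cokernel _
          mono_f := this
          epi_g := inferInstance }

/-- degree zero cohomology as invariants -/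
noncomputable def h0 (M : Rep.{0} k A) (x : groupCohomology M 0) : M.V :=
  ((H0Iso M).hom.hom x).1

theorem h0_inj (M : Rep.{0} k A) : Function.Injective (h0 M) := fun _ _ h =>
  (H0Iso M).toLinearEquiv.injective (Subtype.ext h)

theorem h0_inv (M : Rep.{0} k A) (x : groupCohomology M 0) (a : A) : M.ρ a (h0 M x) = h0 M x :=
  ((H0Iso M).hom.hom x).2 a

theorem h0_surj (M : Rep.{0} k A) (m : M.V) (hm : ∀ a, M.ρ a m = m) : ∃ x, h0 M x = m := by
  obtain ⟨x, hx⟩ := (H0Iso M).toLinearEquiv.surjective ⟨m, hm⟩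
  exact ⟨x, congr_arg Subtype.val hx⟩

theorem h0_nat (f : A →* G) {M : Rep.{0} k G} {N : Rep.{0} k A} (φ : Rep.res f M ⟶ N)
    (x : groupCohomology M 0) : h0 N ((groupCohomology.map f φ 0).hom x) = φ.hom (h0 M x) := by
  have := map_H0Iso_hom_f f φ
  exact congr(($this).hom x)

theorem sh_zero (α : A →* G) (M : Rep.{0} k A) : Function.Bijective (sh α M 0).hom := by
  constructor
  · intro x y h
    apply h0_inj
    have hx := h0_nat α (coindEv α M) x
    have hy := h0_nat α (coindEv α M) y
    rw [← h, hx, coindEv_apply, coindEv_apply] at hy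
    have key : ∀ (z : groupCohomology (Rep.coind α M) 0) (g : G),
        (h0 _ z).1 g = (h0 _ z).1 1 := by
      intro z g
      have := congr_fun (congr_arg Subtype.val (h0_inv (Rep.coind α M) z g)) 1
      rw [← this]
      change _ = (h0 _ z).1 (1 * g)
      rw [one_mul]
    refine Subtype.ext (funext fun g => ?_)
    exact (key x g).trans (hy.trans (key y g).symm)
  · intro m
    obtain ⟨x, hx⟩ := h0_surj (Rep.coind α M) ⟨fun _ => h0 M m, fun a g => (h0_inv M m a).symm⟩
      (fun g => rfl)
    refine ⟨x, h0_inj _ ?_⟩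
    rw [h0_nat, hx]; rfl

theorem sh_bij (α : A →* G) (hα : Function.Injective α) (n : ℕ) :
    ∀ (M : Rep.{0} k A), Function.Bijective (sh α M n).hom := by
  induction n with
  | zero => exact sh_zero α
  | succ n ih =>
    intro M
    obtain ⟨X, hX, W, rfl, h2⟩ := exists_shift M
    have hY := coind_shortExact α hα hX
    have hvI : Subsingleton (groupCohomology X.X₂ (n+1)) := by rw [h2]; exact vanish_bot W n
    have hvJ : Subsingleton (groupCohomology (Rep.coind α X.X₂) (n+1)) := by
      rw [h2]; exact vanish_coind_bot α W n
    have hδ := delta_nat α hY hX (coindEv α X.X₁) (coindEv α X.X₂) (coindEv α X.X₃)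
      (fun v => rfl) (fun v => rfl) n
    have hg : ∀ y : groupCohomology (Rep.coind α X.X₂) n,
        (sh α X.X₃ n).hom ((cf (Rep.coindMap α X.g) n).hom y)
          = (cf X.g n).hom ((sh α X.X₂ n).hom y) := by
      intro y
      have h1 := map_map (MonoidHom.id G) α (Rep.coindMap α X.g) (coindEv α X.X₃) α
        ((Rep.resFunctor α).map (Rep.coindMap α X.g) ≫ coindEv α X.X₃) rfl (fun v => rfl) n y
      have h2 := map_map α (MonoidHom.id A) (coindEv α X.X₂) X.g α
        ((Rep.resFunctor α).map (Rep.coindMap α X.g) ≫ coindEv α X.X₃) rfl (fun v => rfl) n y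
      exact h1.trans h2.symm
    constructor
    · refine (injective_iff_map_eq_zero _).2 fun x hx => ?_
      obtain ⟨z, hz⟩ := les1 hY n x (Subsingleton.elim (α := groupCohomology (Rep.coind α X.X₂) (n+1)) _ _)
      rw [← hz] at hx ⊢
      rw [show (sh α X.X₁ (n+1)).hom _ = _ from hδ z] at hx
      obtain ⟨y, hy⟩ := les3 hX n _ hx
      obtain ⟨y', rfl⟩ := (ih X.X₂).2 y
      rw [← hg] at hy
      have := (ih X.X₃).1 hy
      rw [← this]
      exact les_gδ hY n y'
    · intro x
      obtain ⟨z, hz⟩ := les1 hX n x (Subsingleton.elim (α := groupCohomology X.X₂ (n+1)) _ _)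
      obtain ⟨z', rfl⟩ := (ih X.X₃).2 z
      exact ⟨_, (hδ z').trans hz⟩

/-- the canonical map to the coinduced module -/
noncomputable def toCoind (α : A →* G) (M : Rep.{0} k G) : M ⟶ Rep.coind α (Rep.res α M) :=
  Rep.ofHom ⟨{ toFun := fun m => ⟨fun g => M.ρ g m, fun x h => by
                    change M.ρ (_ * h) m = _
                    rw [map_mul]; rfl⟩
               map_add' := fun _ _ => Subtype.ext (funext fun _ => map_add _ _ _)
               map_smul' := fun _ _ => Subtype.ext (funext fun _ => map_smul _ _ _) }, fun g => by
                 refine LinearMap.ext fun m => Subtype.ext (funext fun h => ?_)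
                 change M.ρ h (M.ρ g m) = M.ρ (h * g) m
                 rw [map_mul]; rfl⟩

theorem sh_toCoind (α : A →* G) (M : Rep.{0} k G) (n : ℕ) (x : groupCohomology M n) :
    (sh α (Rep.res α M) n).hom ((cf (toCoind α M) n).hom x) = (rs α M n).hom x := by
  refine map_map (MonoidHom.id G) α _ _ _ _ rfl (fun v => ?_) n x
  change v = M.ρ 1 v
  simp

end shapiro
end SL2coh

end

section
open CategoryTheory
namespace SL2coh
open groupCohomology

/-- A combinatorial certificate for the fact that `G` is the amalgam of `A` and `B` over `C`:
height functions on the vertices of the tree. -/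
structure Amalgam {A B C G : Type} [Group A] [Group B] [Group C] [Group G]
    (α : A →* G) (β : B →* G) (a : C →* A) (b : C →* B) (hA hB : G → ℕ) : Prop where
  injα : Function.Injective α
  injβ : Function.Injective β
  inja : Function.Injective a
  comm : ∀ c, α (a c) = β (b c)
  invA : ∀ x g, hA (α x * g) = hA g
  invB : ∀ y g, hB (β y * g) = hB g
  ne : ∀ g, hA g ≠ hB g
  exA : ∀ g, g ∈ α.range ∨ ∃ x, hB (α x * g) < hA g
  exB : ∀ g, ∃ y, hA (β y * g) < hB g
  unA : ∀ g x, hB g < hA g → hB (α x * g) < hA g → ∃ c, x = a c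
  unB : ∀ g y, hA g < hB g → hA (β y * g) < hB g → ∃ c, y = b c

section tree
variable {A B C G V : Type} [Group A] [Group B] [Group C] [Group G] [AddCommGroup V]

open Classical in
/-- solve `f_A - f_B = F` recursively along the tree -/
noncomputable def treeF (α : A →* G) (β : B →* G) (hA hB : G → ℕ) (F : G → V) : Bool → G → V
  | true, g => if h : ∃ x, hB (α x * g) < hA g then
      treeF α β hA hB F false (α h.choose * g) + F (α h.choose * g) else 0
  | false, g => if h : ∃ y, hA (β y * g) < hB g then
      treeF α β hA hB F true (β h.choose * g) - F (β h.choose * g) else 0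
termination_by c g => bif c then hA g else hB g
decreasing_by
  · exact h.choose_spec
  · exact h.choose_spec

variable {α : A →* G} {β : B →* G} {a : C →* A} {b : C →* B} {hA hB : G → ℕ}

theorem treeF_true (F : G → V) (g : G) (h : ∃ x, hB (α x * g) < hA g) :
    ∃ x, hB (α x * g) < hA g ∧
      treeF α β hA hB F true g = treeF α β hA hB F false (α x * g) + F (α x * g) := by
  refine ⟨h.choose, h.choose_spec, ?_⟩
  conv_lhs => rw [treeF, dif_pos h]

theorem treeF_false (F : G → V) (g : G) (h : ∃ y, hA (β y * g) < hB g) :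
    ∃ y, hA (β y * g) < hB g ∧
      treeF α β hA hB F false g = treeF α β hA hB F true (β y * g) - F (β y * g) := by
  refine ⟨h.choose, h.choose_spec, ?_⟩
  conv_lhs => rw [treeF, dif_pos h]

theorem treeF_inv (T : Amalgam α β a b hA hB) (F : G → V) (hF : ∀ c g, F (α (a c) * g) = F g) (n : ℕ) :
    (∀ g, hA g = n → ∀ x, treeF α β hA hB F true (α x * g) = treeF α β hA hB F true g) ∧
    (∀ g, hB g = n → ∀ y, treeF α β hA hB F false (β y * g) = treeF α β hA hB F false g) := by
  induction n using Nat.strong_induction_on with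
  | _ n ih =>
  constructor
  · intro g hg x
    by_cases h : ∃ x, hB (α x * g) < hA g
    · have h' : ∃ z, hB (α z * (α x * g)) < hA (α x * g) := by
        obtain ⟨z, hz⟩ := h
        refine ⟨z * x⁻¹, ?_⟩
        rw [T.invA, ← mul_assoc, ← map_mul]; simpa using hz
      obtain ⟨x₀, hx₀, e₀⟩ := treeF_true (β := β) F g h
      obtain ⟨x₁, hx₁, e₁⟩ := treeF_true (β := β) F _ h'
      obtain ⟨c, hc⟩ := T.unA (α x₀ * g) (x₁ * x * x₀⁻¹) (by rwa [T.invA]) (by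
        rw [T.invA, ← mul_assoc, ← map_mul]
        rw [T.invA, ← mul_assoc, ← map_mul] at hx₁
        simpa using hx₁)
      have e : α x₁ * (α x * g) = α (a c) * (α x₀ * g) := by
        rw [← hc]; simp [mul_assoc]
      rw [e₁, e₀, e, hF, T.comm, (ih _ (hg ▸ hx₀)).2 _ rfl]
    · have h' : ¬ ∃ z, hB (α z * (α x * g)) < hA (α x * g) := by
        rintro ⟨z, hz⟩
        refine h ⟨z * x, ?_⟩
        rw [T.invA] at hz
        rw [map_mul, mul_assoc]; exact hz
      rw [treeF, treeF, dif_neg h, dif_neg h']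
  · intro g hg y
    have h := T.exB g
    obtain ⟨x₀, hx₀, e₀⟩ := treeF_false (α := α) F g h
    obtain ⟨x₁, hx₁, e₁⟩ := treeF_false (α := α) F _ (T.exB (β y * g))
    obtain ⟨c, hc⟩ := T.unB (β x₀ * g) (x₁ * y * x₀⁻¹) (by rwa [T.invB]) (by
      rw [T.invB, ← mul_assoc, ← map_mul]
      rw [T.invB, ← mul_assoc, ← map_mul] at hx₁
      simpa using hx₁)
    have e : β x₁ * (β y * g) = α (a c) * (β x₀ * g) := by
      rw [T.comm, ← hc]; simp [mul_assoc]
    rw [e₁, e₀, e, hF, (ih _ (hg ▸ hx₀)).1 _ rfl]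

theorem Amalgam.surj (T : Amalgam α β a b hA hB) (F : G → V) (hF : ∀ c g, F (α (a c) * g) = F g) :
    ∃ fA fB : G → V, (∀ x g, fA (α x * g) = fA g) ∧ (∀ y g, fB (β y * g) = fB g) ∧
      ∀ g, fA g - fB g = F g := by
  refine ⟨treeF α β hA hB F true, treeF α β hA hB F false,
    fun x g => (treeF_inv T F hF _).1 g rfl x, fun y g => (treeF_inv T F hF _).2 g rfl y, fun g => ?_⟩
  rcases lt_or_gt_of_ne (T.ne g) with h | h
  · obtain ⟨y, hy, e⟩ := treeF_false (α := α) F g (T.exB g)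
    obtain ⟨c, rfl⟩ := T.unB g y h hy
    rw [e, ← T.comm, hF, (treeF_inv T F hF _).1 g rfl]; abel
  · obtain ⟨y, hy, e⟩ := treeF_true (α := α) (hA := hA) (hB := hB) (β := β) F g ⟨1, by simpa using h⟩
    obtain ⟨c, rfl⟩ := T.unA g y h hy
    rw [e, hF, T.comm, (treeF_inv T F hF _).2 g rfl]; abel

theorem Amalgam.conn {W : Type} (T : Amalgam α β a b hA hB) (f : G → W) (h1 : ∀ x g, f (α x * g) = f g)
    (h2 : ∀ y g, f (β y * g) = f g) (g : G) : f g = f 1 := by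
  induction hn : hA g using Nat.strong_induction_on generalizing g with
  | _ n ih =>
  rcases T.exA g with ⟨x, rfl⟩ | ⟨x, hx⟩
  · rw [← h1 x 1, mul_one]
  · obtain ⟨y, hy⟩ := T.exB (α x * g)
    have := ih _ (by omega) (β y * (α x * g)) rfl
    rw [← this, h2, h1]

end tree

section ses
variable {k : Type} [CommRing k] {G H : Type} [Group G] [Group H]

/-- unbundled short exact sequences -/
structure SES {X Y Z : Rep.{0} k G} (f : X ⟶ Y) (g : Y ⟶ Z) : Prop where
  zero : f ≫ g = 0
  se : (ShortComplex.mk f g zero).ShortExact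

theorem SES.of {X Y Z : Rep.{0} k G} {f : X ⟶ Y} {g : Y ⟶ Z} (h0 : ∀ x, g.hom (f.hom x) = 0)
    (hf : Function.Injective f.hom) (hg : Function.Surjective g.hom)
    (hex : ∀ y, g.hom y = 0 → ∃ x, f.hom x = y) : SES f g where
  zero := hom_ext' h0
  se := shortExact_of hf hg hex

variable {X Y Z : Rep.{0} k G} {f : X ⟶ Y} {g : Y ⟶ Z} (S : SES f g)

/-- the connecting homomorphism -/
noncomputable def SES.d (n : ℕ) : groupCohomology Z n →ₗ[k] groupCohomology X (n+1) :=
  (groupCohomology.δ S.se n (n+1) rfl).hom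

theorem SES.fg (S : SES f g) (n : ℕ) (x : groupCohomology X n) : (cf g n).hom ((cf f n).hom x) = 0 := by
  rw [cf_comp, S.zero, cf_zero]; rfl
theorem SES.gd (n : ℕ) (y : groupCohomology Y n) : S.d n ((cf g n).hom y) = 0 := les_gδ S.se n y
theorem SES.df (n : ℕ) (z : groupCohomology Z n) : (cf f (n+1)).hom (S.d n z) = 0 := les_δf S.se n z
theorem SES.ex2 (S : SES f g) (n : ℕ) (y : groupCohomology Y n) (h : (cf g n).hom y = 0) :
    ∃ x, (cf f n).hom x = y := les2 S.se n y h
theorem SES.ex3 (n : ℕ) (z : groupCohomology Z n) (h : S.d n z = 0) :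
    ∃ y, (cf g n).hom y = z := les3 S.se n z h
theorem SES.ex1 (n : ℕ) (x : groupCohomology X (n+1)) (h : (cf f (n+1)).hom x = 0) :
    ∃ z, S.d n z = x := les1 S.se n x h
theorem SES.nat {X' Y' Z' : Rep.{0} k H} {f' : X' ⟶ Y'} {g' : Y' ⟶ Z'} (S' : SES f' g')
    (φ : G →* H) (φ₁ : Rep.res φ X' ⟶ X) (φ₂ : Rep.res φ Y' ⟶ Y) (φ₃ : Rep.res φ Z' ⟶ Z)
    (h₁ : ∀ v : X'.V, φ₂.hom (f'.hom v) = f.hom (φ₁.hom v))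
    (h₂ : ∀ v : Y'.V, φ₃.hom (g'.hom v) = g.hom (φ₂.hom v)) (n : ℕ) (z : groupCohomology Z' n) :
    (groupCohomology.map φ φ₁ (n+1)).hom (S'.d n z) = S.d n ((groupCohomology.map φ φ₃ n).hom z) :=
  delta_nat φ S'.se S.se φ₁ φ₂ φ₃ h₁ h₂ n z

end ses

section mv
variable {k : Type} [CommRing k] {A B C G : Type} [Group A] [Group B] [Group C] [Group G]

/-- product of two representations -/
noncomputable abbrev prodRep (M N : Rep.{0} k G) : Rep.{0} k G :=
  Rep.of (X := M.V × N.V) ({ toFun := fun g => LinearMap.prodMap (M.ρ g) (N.ρ g)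
                             map_one' := by simp
                             map_mul' := fun g h => by simp only [map_mul]; rfl } : Representation k G (M.V × N.V))

noncomputable def fstR (M N : Rep.{0} k G) : prodRep M N ⟶ M := Rep.ofHom ⟨LinearMap.fst k M.V N.V, fun g => rfl⟩
noncomputable def sndR (M N : Rep.{0} k G) : prodRep M N ⟶ N := Rep.ofHom ⟨LinearMap.snd k M.V N.V, fun g => rfl⟩
noncomputable def inlR (M N : Rep.{0} k G) : M ⟶ prodRep M N :=
  Rep.ofHom ⟨LinearMap.inl k M.V N.V, fun g => LinearMap.ext fun v => Prod.ext rfl (map_zero (N.ρ g)).symm⟩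
noncomputable def inrR (M N : Rep.{0} k G) : N ⟶ prodRep M N :=
  Rep.ofHom ⟨LinearMap.inr k M.V N.V, fun g => LinearMap.ext fun v => Prod.ext (map_zero (M.ρ g)).symm rfl⟩

theorem prod_ext (M N : Rep.{0} k G) (n : ℕ) (x : groupCohomology (prodRep M N) n)
    (h1 : (cf (fstR M N) n).hom x = 0) (h2 : (cf (sndR M N) n).hom x = 0) : x = 0 := by
  have h : 𝟙 (prodRep M N) = fstR M N ≫ inlR M N + sndR M N ≫ inrR M N :=
    hom_ext' fun v => Prod.ext (add_zero v.1).symm (zero_add v.2).symm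
  rw [← cf_id _ _ x, h, cf_add]
  change (cf (fstR M N ≫ inlR M N) n).hom x + (cf (sndR M N ≫ inrR M N) n).hom x = 0
  rw [← cf_comp, ← cf_comp, h1, h2]; simp

theorem prod_surj (M N : Rep.{0} k G) (n : ℕ) (u : groupCohomology M n) (v : groupCohomology N n) :
    ∃ x, (cf (fstR M N) n).hom x = u ∧ (cf (sndR M N) n).hom x = v := by
  have h1 : inlR M N ≫ fstR M N = 𝟙 _ := rfl
  have h2 : inrR M N ≫ sndR M N = 𝟙 _ := rfl
  have h3 : inlR M N ≫ sndR M N = 0 := rfl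
  have h4 : inrR M N ≫ fstR M N = 0 := rfl
  refine ⟨(cf (inlR M N) n).hom u + (cf (inrR M N) n).hom v, ?_, ?_⟩
  · rw [map_add, cf_comp, cf_comp, h1, h4, cf_id, cf_zero]; simp
  · rw [map_add, cf_comp, cf_comp, h2, h3, cf_id, cf_zero]; simp

/-- the identity as a map of representations -/
noncomputable def resEq (b : C →* B) (β : B →* G) (γ : C →* G) (h : γ = β.comp b) (M : Rep.{0} k G) :
    Rep.res b (Rep.res β M) ⟶ Rep.res γ M :=
  Rep.ofHom ⟨LinearMap.id, fun g => by subst h; rfl⟩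

/-- restriction in stages -/
noncomputable abbrev rr (b : C →* B) (β : B →* G) (γ : C →* G) (h : γ = β.comp b) (M : Rep.{0} k G) (n : ℕ) :
    groupCohomology (Rep.res β M) n ⟶ groupCohomology (Rep.res γ M) n :=
  groupCohomology.map b (resEq b β γ h M) n

theorem rr_rs (b : C →* B) (β : B →* G) (γ : C →* G) (h : γ = β.comp b) (M : Rep.{0} k G) (n : ℕ)
    (x : groupCohomology M n) : (rr b β γ h M n).hom ((rs β M n).hom x) = (rs γ M n).hom x :=
  map_map β b _ _ γ _ h (fun _ => rfl) n x

/-- inclusion of coinduced modules -/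
noncomputable def coindIncl (b : C →* B) (β : B →* G) (γ : C →* G) (h : γ = β.comp b) (M : Rep.{0} k G) :
    Rep.coind β (Rep.res β M) ⟶ Rep.coind γ (Rep.res γ M) :=
  Rep.ofHom ⟨{ toFun := fun f => ⟨f.1, fun c g => by subst h; exact f.2 (b c) g⟩
               map_add' := fun _ _ => rfl
               map_smul' := fun _ _ => rfl }, fun g => rfl⟩

theorem sh_coindIncl (b : C →* B) (β : B →* G) (γ : C →* G) (h : γ = β.comp b) (M : Rep.{0} k G) (n : ℕ)
    (x : groupCohomology (Rep.coind β (Rep.res β M)) n) :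
    (sh γ (Rep.res γ M) n).hom ((cf (coindIncl b β γ h M) n).hom x) =
    (rr b β γ h M n).hom ((sh β (Rep.res β M) n).hom x) := by
  have h1 := map_map (MonoidHom.id G) γ (coindIncl b β γ h M) (coindEv γ (Rep.res γ M)) γ
    ((Rep.resFunctor γ).map (coindIncl b β γ h M) ≫ coindEv γ (Rep.res γ M)) rfl (fun v => rfl) n x
  have h2 := map_map β b (coindEv β (Rep.res β M)) (resEq b β γ h M) γ
    ((Rep.resFunctor γ).map (coindIncl b β γ h M) ≫ coindEv γ (Rep.res γ M)) h (fun v => rfl) n x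
  exact h1.trans h2.symm

variable {α : A →* G} {β : B →* G} {a : C →* A} {b : C →* B} {hA hB : G → ℕ}

/-- the first Mayer-Vietoris map -/
noncomputable def mvI (α : A →* G) (β : B →* G) (M : Rep.{0} k G) :
    M ⟶ prodRep (Rep.coind α (Rep.res α M)) (Rep.coind β (Rep.res β M)) :=
  toCoind α M ≫ inlR _ _ + toCoind β M ≫ inrR _ _

/-- the second Mayer-Vietoris map -/
noncomputable def mvP (γ : C →* G) (h1 : γ = α.comp a) (h2 : γ = β.comp b) (M : Rep.{0} k G) :
    prodRep (Rep.coind α (Rep.res α M)) (Rep.coind β (Rep.res β M)) ⟶ Rep.coind γ (Rep.res γ M) :=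
  fstR _ _ ≫ coindIncl a α γ h1 M - sndR _ _ ≫ coindIncl b β γ h2 M

theorem mvSeq_exact (T : Amalgam α β a b hA hB) (γ : C →* G) (h1 : γ = α.comp a) (h2 : γ = β.comp b)
    (M : Rep.{0} k G) : SES (mvI α β M) (mvP γ h1 h2 M) := by
  refine SES.of ?_ ?_ ?_ ?_
  · refine fun v => Subtype.ext (funext fun g => ?_)
    change (M.ρ g v + 0) - (0 + M.ρ g v) = 0
    simp
  · intro x y h
    have : M.ρ 1 x + 0 = M.ρ 1 y + 0 := congr_fun (congr_arg Subtype.val (congr_arg Prod.fst h)) 1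
    rw [map_one, add_zero, add_zero] at this
    exact this
  · intro F
    obtain ⟨fA, fB, hfA, hfB, hf⟩ := T.surj (fun g => M.ρ g⁻¹ (F.1 g)) (fun c g => by
      have : F.1 (α (a c) * g) = M.ρ (α (a c)) (F.1 g) := by
        subst h1; exact F.2 c g
      rw [this, ← Module.End.mul_apply, ← map_mul]; simp)
    refine ⟨(⟨fun g => M.ρ g (fA g), fun x g => ?_⟩, ⟨fun g => M.ρ g (fB g), fun x g => ?_⟩), ?_⟩
    · change M.ρ (α x * g) (fA (α x * g)) = M.ρ (α x) (M.ρ g (fA g))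
      rw [hfA, map_mul]; rfl
    · change M.ρ (β x * g) (fB (β x * g)) = M.ρ (β x) (M.ρ g (fB g))
      rw [hfB, map_mul]; rfl
    · refine Subtype.ext (funext fun g => ?_)
      change M.ρ g (fA g) - M.ρ g (fB g) = F.1 g
      rw [← map_sub, hf]; simp
  · rintro ⟨u, v⟩ h
    have huv : ∀ g, u.1 g = v.1 g := fun g => by
      have : u.1 g - v.1 g = 0 := congr_fun (congr_arg Subtype.val h) g
      exact sub_eq_zero.1 this
    have hc := T.conn (fun g => M.ρ g⁻¹ (u.1 g)) (fun x g => by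
        rw [u.2 x g]
        change M.ρ _ (M.ρ _ _) = _
        rw [← Module.End.mul_apply, ← map_mul]; simp) (fun x g => by
        rw [huv, v.2 x g, ← huv]
        change M.ρ _ (M.ρ _ _) = _
        rw [← Module.End.mul_apply, ← map_mul]; simp)
    refine ⟨u.1 1, ?_⟩
    have hu : ∀ g, M.ρ g (u.1 1) = u.1 g := fun g => by
      have := hc g
      simp only [inv_one, map_one, Module.End.one_apply] at this
      rw [← this, ← Module.End.mul_apply, ← map_mul]; simp
    refine Prod.ext (Subtype.ext (funext fun g => ?_)) (Subtype.ext (funext fun g => ?_))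
    · change M.ρ g (u.1 1) + 0 = u.1 g
      rw [add_zero, hu]
    · change 0 + M.ρ g (u.1 1) = v.1 g
      rw [zero_add, hu, huv]

theorem mv_f1 (α : A →* G) (β : B →* G) (M : Rep.{0} k G) (n : ℕ)
    (x : groupCohomology M n) :
    (sh α (Rep.res α M) n).hom ((cf (fstR _ _) n).hom ((cf (mvI α β M) n).hom x))
      = (rs α M n).hom x := by
  rw [← sh_toCoind]
  congr 1
  refine (cf_comp _ _ _ _).trans ?_
  congr 4
  refine hom_ext' fun v => Subtype.ext (funext fun g => ?_)
  change M.ρ g v + 0 = M.ρ g v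
  rw [add_zero]

theorem mv_f2 (α : A →* G) (β : B →* G) (M : Rep.{0} k G) (n : ℕ)
    (x : groupCohomology M n) :
    (sh β (Rep.res β M) n).hom ((cf (sndR _ _) n).hom ((cf (mvI α β M) n).hom x))
      = (rs β M n).hom x := by
  rw [← sh_toCoind]
  congr 1
  refine (cf_comp _ _ _ _).trans ?_
  congr 4
  refine hom_ext' fun v => Subtype.ext (funext fun g => ?_)
  change 0 + M.ρ g v = M.ρ g v
  rw [zero_add]

theorem mv_g (γ : C →* G) (h1 : γ = α.comp a) (h2 : γ = β.comp b) (M : Rep.{0} k G) (n : ℕ)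
    (y : groupCohomology (prodRep (Rep.coind α (Rep.res α M)) (Rep.coind β (Rep.res β M))) n) :
    (sh γ (Rep.res γ M) n).hom ((cf (mvP γ h1 h2 M) n).hom y)
      = (rr a α γ h1 M n).hom ((sh α (Rep.res α M) n).hom ((cf (fstR _ _) n).hom y))
       - (rr b β γ h2 M n).hom ((sh β (Rep.res β M) n).hom ((cf (sndR _ _) n).hom y)) := by
  rw [← sh_coindIncl, ← sh_coindIncl, ← map_sub, cf_comp, cf_comp, ← cf_sub]
  rfl

theorem mv_delta (T : Amalgam α β a b hA hB) (γ : C →* G) (h1 : γ = α.comp a) (h2 : γ = β.comp b)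
    (M : Rep.{0} k G) (n : ℕ) :
    ∃ D : groupCohomology (Rep.res γ M) n →ₗ[k] groupCohomology M (n+1),
      (∀ z, D z = 0 ↔ ∃ u v, z = (rr a α γ h1 M n).hom u - (rr b β γ h2 M n).hom v) ∧
      (∀ x, (rs α M (n+1)).hom x = 0 → (rs β M (n+1)).hom x = 0 → ∃ z, D z = x) := by
  have hγ : Function.Injective γ := by
    subst h1; exact T.injα.comp T.inja
  have hX := mvSeq_exact T γ h1 h2 M
  let e := LinearEquiv.ofBijective (sh γ (Rep.res γ M) n).hom (sh_bij γ hγ n _)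
  have he : ∀ z, (sh γ (Rep.res γ M) n).hom (e.symm z) = z := fun z => e.apply_symm_apply z
  refine ⟨hX.d n ∘ₗ e.symm.toLinearMap, fun z => ⟨fun h => ?_, ?_⟩,
    fun x hx1 hx2 => ?_⟩
  · obtain ⟨y, hy⟩ := hX.ex3 n _ h
    refine ⟨(sh α (Rep.res α M) n).hom ((cf (fstR _ _) n).hom y),
      (sh β (Rep.res β M) n).hom ((cf (sndR _ _) n).hom y), ?_⟩
    rw [← mv_g γ h1 h2 M n y, hy]
    exact (he z).symm
  · rintro ⟨u, v, rfl⟩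
    obtain ⟨u, rfl⟩ := (sh_bij α T.injα n _).2 u
    obtain ⟨v, rfl⟩ := (sh_bij β T.injβ n _).2 v
    obtain ⟨y, rfl, rfl⟩ := prod_surj _ _ n u v
    rw [← mv_g γ h1 h2 M n y]
    have : e.symm ((sh γ (Rep.res γ M) n).hom ((cf (mvP γ h1 h2 M) n).hom y))
      = (cf (mvP γ h1 h2 M) n).hom y := e.symm_apply_apply _
    rw [LinearMap.comp_apply, LinearEquiv.coe_coe, this]
    exact hX.gd n y
  · rw [← mv_f1 α β] at hx1
    rw [← mv_f2 α β] at hx2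
    have h0 := prod_ext _ _ _ _ ((sh_bij α T.injα (n+1) _).1 (hx1.trans (map_zero _).symm))
      ((sh_bij β T.injβ (n+1) _).1 (hx2.trans (map_zero _).symm))
    obtain ⟨z, hz⟩ := hX.ex1 n x h0
    refine ⟨e z, ?_⟩
    rw [LinearMap.comp_apply, LinearEquiv.coe_coe, e.symm_apply_apply, ← hz]

theorem mv_glue (T : Amalgam α β a b hA hB) (γ : C →* G) (h1 : γ = α.comp a) (h2 : γ = β.comp b)
    (M : Rep.{0} k G) (n : ℕ) (u : groupCohomology (Rep.res α M) n) (v : groupCohomology (Rep.res β M) n)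
    (h : (rr a α γ h1 M n).hom u = (rr b β γ h2 M n).hom v) :
    ∃ x, (rs α M n).hom x = u ∧ (rs β M n).hom x = v := by
  have hγ : Function.Injective γ := by
    subst h1; exact T.injα.comp T.inja
  have hX := mvSeq_exact T γ h1 h2 M
  obtain ⟨u, rfl⟩ := (sh_bij α T.injα n _).2 u
  obtain ⟨v, rfl⟩ := (sh_bij β T.injβ n _).2 v
  obtain ⟨y, rfl, rfl⟩ := prod_surj _ _ n u v
  have hg : (sh γ (Rep.res γ M) n).hom ((cf (mvP γ h1 h2 M) n).hom y) = 0 := by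
    rw [mv_g, h, sub_self]
  obtain ⟨x, hx⟩ := hX.ex2 n y ((sh_bij γ hγ n _).1 (hg.trans (map_zero _).symm))
  refine ⟨x, ?_, ?_⟩
  · rw [← mv_f1 α β, hx]
  · rw [← mv_f2 α β, hx]

theorem mv_zero (T : Amalgam α β a b hA hB) (γ : C →* G) (h1 : γ = α.comp a) (h2 : γ = β.comp b)
    (M : Rep.{0} k G) (n : ℕ) (hC : ∀ z : groupCohomology (Rep.res γ M) n, z = 0)
    (x : groupCohomology M (n+1)) (hx1 : (rs α M (n+1)).hom x = 0) (hx2 : (rs β M (n+1)).hom x = 0) :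
    x = 0 := by
  obtain ⟨D, -, hD⟩ := mv_delta T γ h1 h2 M n
  obtain ⟨z, rfl⟩ := hD x hx1 hx2
  rw [hC z, map_zero]

end mv
end SL2coh

end

section
open CategoryTheory
namespace SL2coh
open groupCohomology

/-- cyclic group of order `m` -/
abbrev Cy (m : ℕ) := Multiplicative (ZMod m)

/-- homomorphism out of a cyclic group -/
def cyc {G : Type} [Group G] (m : ℕ) [NeZero m] (g : G) (hg : g ^ m = 1) : Cy m →* G where
  toFun x := g ^ (ZMod.val (Multiplicative.toAdd x))
  map_one' := by simp
  map_mul' x y := by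
    rw [← pow_add, toAdd_mul, ZMod.val_add, ← pow_eq_pow_mod _ hg]

theorem cyc_apply {G : Type} [Group G] (m : ℕ) [NeZero m] (g : G) (hg : g ^ m = 1) (x : Cy m) :
   cyc m g hg x = g ^ (ZMod.val (Multiplicative.toAdd x)) := rfl

abbrev gen (m : ℕ) : Cy m := Multiplicative.ofAdd 1

theorem cyc_gen {G : Type} [Group G] (m : ℕ) [NeZero m] (hm : 1 < m) (g : G) (hg : g ^ m = 1) :
   cyc m g hg (gen m) = g := by
  have : Fact (1 < m) := ⟨hm⟩
  rw [cyc_apply]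
  simp [ZMod.val_one]

theorem gen_pow (m : ℕ) [NeZero m] (x : Cy m) : gen m ^ (ZMod.val (Multiplicative.toAdd x)) = x := by
  rw [← ofAdd_nsmul]; simp

theorem cyc_ext {G : Type} [Group G] (m : ℕ) [NeZero m] {f g : Cy m →* G} (h : f (gen m) = g (gen m)) : f = g := by
  ext x
  change f x = g x
  rw [← gen_pow m x, map_pow, map_pow, h]

abbrev SLZ := Matrix.SpecialLinearGroup (Fin 2) ℤ

def mS : SLZ := ⟨!![0, -1; 1, 0], by simp [Matrix.det_fin_two]⟩
def mU : SLZ := ⟨!![0, -1; 1, 1], by simp [Matrix.det_fin_two]⟩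

theorem mS4 : mS ^ 4 = 1 := by decide +kernel
theorem mU6 : mU ^ 6 = 1 := by decide +kernel
theorem mSU : mS ^ 2 = mU ^ 3 := by decide +kernel

abbrev α4 : Cy 4 →* SLZ := cyc 4 mS mS4
abbrev α6 : Cy 6 →* SLZ := cyc 6 mU mU6
abbrev i24 : Cy 2 →* Cy 4 := cyc 2 (Multiplicative.ofAdd 2) (by decide)
abbrev i26 : Cy 2 →* Cy 6 := cyc 2 (Multiplicative.ofAdd 3) (by decide)

def tt (g : SLZ) : ℤ := g 0 0 * g 1 0 + g 0 1 * g 1 1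
def nu (g : SLZ) : ℤ := g 0 0 ^ 2 + g 0 1 ^ 2
def nv (g : SLZ) : ℤ := g 1 0 ^ 2 + g 1 1 ^ 2

theorem det1 (g : SLZ) : g 0 0 * g 1 1 - g 0 1 * g 1 0 = 1 := by
  have := g.2; rwa [Matrix.det_fin_two] at this

theorem S00 (g : SLZ) : (mS * g) 0 0 = - g 1 0 := by
  change (mS.1 * g.1) 0 0 = _
  rw [Matrix.mul_apply, Fin.sum_univ_two]
  simp [mS]
theorem S01 (g : SLZ) : (mS * g) 0 1 = - g 1 1 := by
  change (mS.1 * g.1) 0 1 = _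
  rw [Matrix.mul_apply, Fin.sum_univ_two]
  simp [mS]
theorem S10 (g : SLZ) : (mS * g) 1 0 = g 0 0 := by
  change (mS.1 * g.1) 1 0 = _
  rw [Matrix.mul_apply, Fin.sum_univ_two]
  simp [mS]
theorem S11 (g : SLZ) : (mS * g) 1 1 = g 0 1 := by
  change (mS.1 * g.1) 1 1 = _
  rw [Matrix.mul_apply, Fin.sum_univ_two]
  simp [mS]
theorem U00 (g : SLZ) : (mU * g) 0 0 = - g 1 0 := by
  change (mU.1 * g.1) 0 0 = _
  rw [Matrix.mul_apply, Fin.sum_univ_two]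
  simp [mU]
theorem U01 (g : SLZ) : (mU * g) 0 1 = - g 1 1 := by
  change (mU.1 * g.1) 0 1 = _
  rw [Matrix.mul_apply, Fin.sum_univ_two]
  simp [mU]
theorem U10 (g : SLZ) : (mU * g) 1 0 = g 0 0 + g 1 0 := by
  change (mU.1 * g.1) 1 0 = _
  rw [Matrix.mul_apply, Fin.sum_univ_two]
  simp [mU]
theorem U11 (g : SLZ) : (mU * g) 1 1 = g 0 1 + g 1 1 := by
  change (mU.1 * g.1) 1 1 = _
  rw [Matrix.mul_apply, Fin.sum_univ_two]
  simp [mU]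

theorem ttS (g : SLZ) : tt (mS * g) = - tt g := by simp only [tt, S00, S01, S10, S11]; ring
theorem nuS (g : SLZ) : nu (mS * g) = nv g := by simp only [nu, nv, S00, S01, S10, S11]; ring
theorem nvS (g : SLZ) : nv (mS * g) = nu g := by simp only [nu, nv, S00, S01, S10, S11]
theorem ttU (g : SLZ) : tt (mU * g) = - tt g - nv g := by simp only [tt, nv, U00, U01, U10, U11]; ring
theorem nuU (g : SLZ) : nu (mU * g) = nv g := by simp only [nu, nv, U00, U01, U10, U11]; ring
theorem nvU (g : SLZ) : nv (mU * g) = nu g + 2 * tt g + nv g := by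
  simp only [nu, nv, tt, U00, U01, U10, U11]; ring

theorem lagrange (g : SLZ) : nu g * nv g = 1 + tt g ^ 2 := by
  have := det1 g
  simp only [nu, nv, tt]
  linear_combination (g 0 0 * g 1 1 - g 0 1 * g 1 0 + 1) * this

theorem nu_nonneg (g : SLZ) : 0 ≤ nu g := by unfold nu; positivity
theorem nv_nonneg (g : SLZ) : 0 ≤ nv g := by unfold nv; positivity
theorem nu_pos (g : SLZ) : 0 < nu g := by
  rcases (nu_nonneg g).lt_or_eq with h | h
  · exact h
  · have := lagrange g; rw [← h] at this; nlinarith [sq_nonneg (tt g)]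
theorem nv_pos (g : SLZ) : 0 < nv g := by
  rcases (nv_nonneg g).lt_or_eq with h | h
  · exact h
  · have := lagrange g; rw [← h] at this; nlinarith [sq_nonneg (tt g)]

def hA0 (g : SLZ) : ℕ := (4 * (nu g + nv g)).toNat
def hB0 (g : SLZ) : ℕ := (4 * (nu g + nv g) + 4 * tt g + 1).toNat

theorem wpos (g : SLZ) : 0 < nu g + nv g + tt g := by
  have h1 := nu_pos g
  have h2 := nv_pos g
  have h3 := nv_pos (mU * g)
  rw [nvU] at h3
  linarith

theorem ltBA (g g' : SLZ) (h : nu g + nv g = nu g' + nv g') : hB0 g' < hA0 g ↔ tt g' < 0 := by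
  have h1 := nu_pos g
  have h2 := nv_pos g
  have h3 := wpos g'
  unfold hB0 hA0; omega

theorem ltAB (g g' : SLZ) (h : nu g + nv g + tt g = nu g' + nv g' + tt g') : hA0 g' < hB0 g ↔ 0 ≤ tt g' := by
  have h1 := nu_pos g'
  have h2 := nv_pos g'
  have h3 := wpos g'
  unfold hB0 hA0; omega

theorem cases4 {P : Cy 4 → Prop} (h0 : P 1) (h1 : P (Multiplicative.ofAdd 1)) (h2 : P (Multiplicative.ofAdd 2))
    (h3 : P (Multiplicative.ofAdd 3)) (x : Cy 4) : P x := by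
  have : x = 1 ∨ x = Multiplicative.ofAdd 1 ∨ x = Multiplicative.ofAdd 2 ∨ x = Multiplicative.ofAdd 3 := by
    revert x; decide
  rcases this with rfl | rfl | rfl | rfl <;> assumption

theorem cases6 {P : Cy 6 → Prop} (h0 : P 1) (h1 : P (Multiplicative.ofAdd 1)) (h2 : P (Multiplicative.ofAdd 2))
    (h3 : P (Multiplicative.ofAdd 3)) (h4 : P (Multiplicative.ofAdd 4)) (h5 : P (Multiplicative.ofAdd 5))
    (x : Cy 6) : P x := by
  have : x = 1 ∨ x = Multiplicative.ofAdd 1 ∨ x = Multiplicative.ofAdd 2 ∨ x = Multiplicative.ofAdd 3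
    ∨ x = Multiplicative.ofAdd 4 ∨ x = Multiplicative.ofAdd 5 := by
    revert x; decide
  rcases this with rfl | rfl | rfl | rfl | rfl | rfl <;> assumption

theorem a41 (g : SLZ) : α4 (Multiplicative.ofAdd 1) * g = mS * g := by
  change mS ^ 1 * g = _; rw [pow_one]
theorem a42 (g : SLZ) : α4 (Multiplicative.ofAdd 2) * g = mS * (mS * g) := by
  change mS ^ 2 * g = _; rw [pow_two, mul_assoc]
theorem a43 (g : SLZ) : α4 (Multiplicative.ofAdd 3) * g = mS * (mS * (mS * g)) := by
  change mS ^ 3 * g = _; simp only [pow_succ, pow_zero, one_mul, mul_assoc]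
theorem a61 (g : SLZ) : α6 (Multiplicative.ofAdd 1) * g = mU * g := by
  change mU ^ 1 * g = _; rw [pow_one]
theorem a62 (g : SLZ) : α6 (Multiplicative.ofAdd 2) * g = mU * (mU * g) := by
  change mU ^ 2 * g = _; rw [pow_two, mul_assoc]
theorem a63 (g : SLZ) : α6 (Multiplicative.ofAdd 3) * g = mU * (mU * (mU * g)) := by
  change mU ^ 3 * g = _; simp only [pow_succ, pow_zero, one_mul, mul_assoc]
theorem a64 (g : SLZ) : α6 (Multiplicative.ofAdd 4) * g = mU * (mU * (mU * (mU * g))) := by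
  change mU ^ 4 * g = _; simp only [pow_succ, pow_zero, one_mul, mul_assoc]
theorem a65 (g : SLZ) : α6 (Multiplicative.ofAdd 5) * g = mU * (mU * (mU * (mU * (mU * g)))) := by
  change mU ^ 5 * g = _; simp only [pow_succ, pow_zero, one_mul, mul_assoc]

theorem invA0 (x : Cy 4) (g : SLZ) : nu (α4 x * g) + nv (α4 x * g) = nu g + nv g := by
  induction x using cases4 with
  | h0 => simp
  | _ => simp only [a41, a42, a43, nuS, nvS]; try ring

theorem invB0 (x : Cy 6) (g : SLZ) : nu (α6 x * g) + nv (α6 x * g) + tt (α6 x * g) = nu g + nv g + tt g := by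
  induction x using cases6 with
  | h0 => simp
  | _ => simp only [a61, a62, a63, a64, a65, nuU, nvU, ttU]; ring

theorem base0 (g : SLZ) (h : tt g = 0) : g ∈ α4.range := by
  have hl := lagrange g
  rw [h] at hl
  have h1 : nu g = 1 := by
    have := nu_pos g; have := nv_pos g; nlinarith
  have hd := det1 g
  have h1' := h1
  unfold nu at h1
  unfold tt at h
  have hp : g 1 1 = g 0 0 := by linear_combination g 0 0 * hd + g 0 1 * h - g 1 1 * h1
  have hq : g 1 0 = - g 0 1 := by linear_combination - g 0 1 * hd + g 0 0 * h - g 1 0 * h1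
  have b1 : g 0 0 ≤ 1 := by nlinarith
  have b2 : -1 ≤ g 0 0 := by nlinarith
  have b3 : g 0 1 ≤ 1 := by nlinarith
  have b4 : -1 ≤ g 0 1 := by nlinarith
  have key : ∀ g' : SLZ, g' 0 0 = g 0 0 → g' 0 1 = g 0 1 → g' 1 0 = - g 0 1 → g' 1 1 = g 0 0 → g' = g := by
    intro g' e1 e2 e3 e4
    ext i j
    fin_cases i <;> fin_cases j
    · exact e1
    · exact e2
    · exact e3.trans hq.symm
    · exact e4.trans hp.symm
  have hcase : (g 0 0 = 1 ∧ g 0 1 = 0) ∨ (g 0 0 = 0 ∧ g 0 1 = -1) ∨ (g 0 0 = -1 ∧ g 0 1 = 0) ∨ (g 0 0 = 0 ∧ g 0 1 = 1) := by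
    generalize g 0 0 = x at *
    generalize g 0 1 = y at *
    interval_cases x <;> interval_cases y <;> simp_all
  rcases hcase with ⟨e1, e2⟩ | ⟨e1, e2⟩ | ⟨e1, e2⟩ | ⟨e1, e2⟩
  · exact ⟨1, key _ (by rw [e1]; decide +kernel) (by rw [e2]; decide +kernel) (by rw [e2]; decide +kernel) (by rw [e1]; decide +kernel)⟩
  · exact ⟨Multiplicative.ofAdd 1, key _ (by rw [e1]; decide +kernel) (by rw [e2]; decide +kernel) (by rw [e2]; decide +kernel) (by rw [e1]; decide +kernel)⟩
  · exact ⟨Multiplicative.ofAdd 2, key _ (by rw [e1]; decide +kernel) (by rw [e2]; decide +kernel) (by rw [e2]; decide +kernel) (by rw [e1]; decide +kernel)⟩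
  · exact ⟨Multiplicative.ofAdd 3, key _ (by rw [e1]; decide +kernel) (by rw [e2]; decide +kernel) (by rw [e2]; decide +kernel) (by rw [e1]; decide +kernel)⟩

theorem amalgam_SLZ : Amalgam α4 α6 i24 i26 hA0 hB0 where
  injα := by
    refine (injective_iff_map_eq_one _).2 fun x => ?_
    revert x; decide +kernel
  injβ := by
    refine (injective_iff_map_eq_one _).2 fun x => ?_
    revert x; decide +kernel
  inja := by decide +kernel
  comm := by decide +kernel
  invA x g := by unfold hA0; rw [invA0]
  invB y g := by
    have := invB0 y g
    unfold hB0
    congr 1; linarith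
  ne g := by
    have h1 := nu_pos g
    have h2 := nv_pos g
    have h3 := wpos g
    unfold hB0 hA0; omega
  exA g := by
    rcases lt_trichotomy (tt g) 0 with h | h | h
    · right; refine ⟨1, ?_⟩
      rw [map_one, one_mul, ltBA _ _ rfl]; exact h
    · left; exact base0 g h
    · right; refine ⟨Multiplicative.ofAdd 1, ?_⟩
      rw [ltBA _ _ (invA0 _ _).symm, a41, ttS]; linarith
  exB g := by
    by_cases h0 : 0 ≤ tt g
    · refine ⟨1, ?_⟩
      rw [ltAB _ _ (invB0 _ _).symm]; simpa using h0
    by_cases h1 : 0 ≤ - tt g - nv g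
    · refine ⟨Multiplicative.ofAdd 1, ?_⟩
      rw [ltAB _ _ (invB0 _ _).symm, a61, ttU]; exact h1
    by_cases h2 : 0 ≤ - tt g - nu g
    · refine ⟨Multiplicative.ofAdd 2, ?_⟩
      rw [ltAB _ _ (invB0 _ _).symm, a62, ttU, ttU, nvU]; linarith
    exfalso
    have := lagrange g
    push Not at h0 h1 h2
    have e1 : 1 - tt g ≤ nv g := by omega
    have e2 : 1 - tt g ≤ nu g := by omega
    nlinarith [mul_le_mul e2 e1 (by linarith) (by linarith)]
  unA g x h1 h2 := by
    rw [ltBA _ _ rfl] at h1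
    rw [ltBA _ _ (invA0 _ _).symm] at h2
    induction x using cases4 with
    | h0 => exact ⟨1, by simp⟩
    | h1 => rw [a41, ttS] at h2; linarith
    | h2 => exact ⟨Multiplicative.ofAdd 1, by decide⟩
    | h3 => rw [a43, ttS, ttS, ttS] at h2; linarith
  unB g x h1 h2 := by
    rw [ltAB _ _ rfl] at h1
    rw [ltAB _ _ (invB0 _ _).symm] at h2
    have p1 := nu_pos g
    have p2 := nv_pos g
    induction x using cases6 with
    | h0 => exact ⟨1, by simp⟩
    | h1 => simp only [a61, a62, a63, a64, a65, nuU, nvU, ttU] at h2; linarith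
    | h2 => simp only [a61, a62, a63, a64, a65, nuU, nvU, ttU] at h2; linarith
    | h3 => exact ⟨Multiplicative.ofAdd 1, by decide⟩
    | h4 => simp only [a61, a62, a63, a64, a65, nuU, nvU, ttU] at h2; linarith
    | h5 => simp only [a61, a62, a63, a64, a65, nuU, nvU, ttU] at h2; linarith

end SL2coh

end

section
open CategoryTheory
namespace SL2coh
open groupCohomology

section ptree
open Matrix

theorem gcd_coprime_of {x y : ℤ} (h : ¬ (x = 0 ∧ y = 0)) : ∃ d r s : ℤ, x = d * r ∧ y = d * s ∧ IsCoprime r s ∧ d ≠ 0 := by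
  have h1 : 0 < Int.gcd x y := by
    rw [Int.gcd_pos_iff]; tauto
  obtain ⟨x', y', hc, hx, hy⟩ := Int.exists_gcd_one h1
  refine ⟨Int.gcd x y, x', y', ?_, ?_, Int.isCoprime_iff_gcd_eq_one.2 hc, by exact_mod_cast h1.ne'⟩
  · linarith
  · linarith

theorem mul00 {R : Type} [CommRing R] (x g : SpecialLinearGroup (Fin 2) R) (i j : Fin 2) :
    (x * g) i j = x i 0 * g 0 j + x i 1 * g 1 j := by
  change (x.1 * g.1) i j = _
  rw [Matrix.mul_apply, Fin.sum_univ_two]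

theorem sl_ext {R : Type} [CommRing R] {x g : SpecialLinearGroup (Fin 2) R} (h00 : x 0 0 = g 0 0) (h01 : x 0 1 = g 0 1)
   (h10 : x 1 0 = g 1 0) (h11 : x 1 1 = g 1 1) : x = g := by
  ext i j
  fin_cases i <;> fin_cases j <;> assumption

theorem detR {R : Type} [CommRing R] (g : SpecialLinearGroup (Fin 2) R) : g 0 0 * g 1 1 - g 0 1 * g 1 0 = 1 := by
  have := g.2; rwa [Matrix.det_fin_two] at this

def mk2 {R : Type} [CommRing R] (a b c d : R) (h : a * d - b * c = 1) : SpecialLinearGroup (Fin 2) R :=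
  ⟨!![a, b; c, d], by rw [Matrix.det_fin_two_of]; exact h⟩

theorem kill_row (p : ℕ) (hp : p.Prime) (m00 m01 m10 m11 : ℤ) (h : (p : ℤ) ∣ m00 * m11 - m01 * m10) :
    ∃ x : SLZ, (p : ℤ) ∣ x 0 0 * m00 + x 0 1 * m10 ∧ (p : ℤ) ∣ x 0 0 * m01 + x 0 1 * m11 := by
  have hpp : Prime (p : ℤ) := Nat.prime_iff_prime_int.1 hp
  have key : ∀ r s : ℤ, IsCoprime r s → ∃ x : SLZ, x 0 0 = r ∧ x 0 1 = s := by
    rintro r s ⟨u, v, huv⟩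
    exact ⟨mk2 r s (-v) u (by linarith), rfl, rfl⟩
  by_cases h0 : (p : ℤ) ∣ m00 ∧ (p : ℤ) ∣ m10
  · by_cases h1 : m11 = 0 ∧ m01 = 0
    · refine ⟨1, ?_, ?_⟩
      · exact dvd_add (h0.1.mul_left _) (h0.2.mul_left _)
      · rw [h1.1, h1.2]; simp
    · obtain ⟨d, r, s, hr, hs, hc, hd⟩ := gcd_coprime_of h1
      obtain ⟨x, hx, hy⟩ := key r (-s) hc.neg_right
      refine ⟨x, dvd_add (h0.1.mul_left _) (h0.2.mul_left _), ?_⟩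
      rw [hx, hy, hr, hs]
      ring_nf; simp
  · have h1 : ¬ (m10 = 0 ∧ m00 = 0) := fun h => h0 (by rw [h.1, h.2]; simp)
    obtain ⟨d, r, s, hr, hs, hc, hd⟩ := gcd_coprime_of h1
    obtain ⟨x, hx, hy⟩ := key r (-s) hc.neg_right
    refine ⟨x, ?_, ?_⟩
    · rw [hx, hy, hr, hs]; ring_nf; simp
    · have hpd : ¬ (p : ℤ) ∣ d := fun hd => h0 ⟨hs ▸ hd.mul_right _, hr ▸ hd.mul_right _⟩
      refine (hpp.dvd_or_dvd (a := d) ?_).resolve_left hpd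
      rw [hx, hy]
      have : d * (r * m01 + -s * m11) = - (m00 * m11 - m01 * m10) := by rw [hr, hs]; ring
      rw [this]; exact h.neg_right

variable {R : Type} [CommRing R] [CharZero R] (p : ℕ) (ip : R)

abbrev phi (R : Type) [CommRing R] : SLZ →* SpecialLinearGroup (Fin 2) R := SpecialLinearGroup.map (Int.castRingHom R)

theorem phi_apply (R : Type) [CommRing R] (x : SLZ) (i j) : phi R x i j = (x i j : R) := rfl

/-- conjugated embedding -/
def phi' (hip : p * ip = 1) : SLZ →* SpecialLinearGroup (Fin 2) R where
  toFun x := mk2 (x 0 0 : R) (ip * x 0 1) (p * x 1 0) (x 1 1) (by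
    have := congrArg (Int.cast : ℤ → R) (det1 x)
    push_cast at this
    linear_combination this - (x 0 1 * x 1 0 : R) * hip)
  map_one' := by
    apply sl_ext <;> simp [mk2]
  map_mul' x y := by
    have e := mul00 x y
    apply sl_ext
    · refine Eq.trans ?_ (mul00 _ _ _ _).symm
      change (((x * y) 0 0 : ℤ) : R) = (x 0 0 : R) * (y 0 0 : R) + (ip * x 0 1) * (p * y 1 0)
      rw [e]; push_cast
      linear_combination -(x 0 1 * y 1 0 : R) * hip
    · refine Eq.trans ?_ (mul00 _ _ _ _).symm
      change ip * (((x * y) 0 1 : ℤ) : R) = (x 0 0 : R) * (ip * y 0 1 : R) + (ip * x 0 1) * (y 1 1)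
      rw [e]; push_cast; ring
    · refine Eq.trans ?_ (mul00 _ _ _ _).symm
      change p * (((x * y) 1 0 : ℤ) : R) = (p * x 1 0 : R) * (y 0 0 : R) + (x 1 1) * (p * y 1 0)
      rw [e]; push_cast; ring
    · refine Eq.trans ?_ (mul00 _ _ _ _).symm
      change (((x * y) 1 1 : ℤ) : R) = (p * x 1 0 : R) * (ip * y 0 1 : R) + (x 1 1) * (y 1 1)
      rw [e]; push_cast
      linear_combination -(x 1 0 * y 0 1 : R) * hip

theorem phi'_00 (hip : p * ip = 1) (x : SLZ) : phi' p ip hip x 0 0 = (x 0 0 : R) := rfl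
theorem phi'_01 (hip : p * ip = 1) (x : SLZ) : phi' p ip hip x 0 1 = (ip * x 0 1 : R) := rfl
theorem phi'_10 (hip : p * ip = 1) (x : SLZ) : phi' p ip hip x 1 0 = (p * x 1 0 : R) := rfl
theorem phi'_11 (hip : p * ip = 1) (x : SLZ) : phi' p ip hip x 1 1 = (x 1 1 : R) := rfl

theorem phi_inj : Function.Injective (phi R) := by
  intro x y h
  have key : ∀ i j, x i j = y i j := fun i j => by
    have := congrArg (fun g : SpecialLinearGroup (Fin 2) R => g i j) h
    simp only [phi_apply] at this
    exact_mod_cast this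
  exact sl_ext (key _ _) (key _ _) (key _ _) (key _ _)

theorem phi'_inj (hip : p * ip = 1) : Function.Injective (phi' p ip hip) := by
  intro x y h
  have hp0 : p ≠ 0 := by
    rintro rfl; simp at hip
  have key := fun i j => congrArg (fun g : SpecialLinearGroup (Fin 2) R => g i j) h
  have h00 := key 0 0
  have h01 := key 0 1
  have h10 := key 1 0
  have h11 := key 1 1
  simp only [phi'_00, phi'_01, phi'_10, phi'_11] at h00 h01 h10 h11
  refine sl_ext (by exact_mod_cast h00) ?_ ?_ (by exact_mod_cast h11)
  · have : (x 0 1 : R) = y 0 1 := by linear_combination p * h01 + (y 0 1 - x 0 1 : R) * hip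
    exact_mod_cast this
  · have : (x 1 0 : R) = y 1 0 := by linear_combination ip * h10 + (y 1 0 - x 1 0 : R) * hip
    exact_mod_cast this

abbrev Gp (p : ℕ) := CongruenceSubgroup.Gamma0 p

theorem Gp_dvd (x : Gp p) : (p : ℤ) ∣ x.1 1 0 := by
  have := x.2
  rw [CongruenceSubgroup.Gamma0_mem] at this
  exact (ZMod.intCast_zmod_eq_zero_iff_dvd _ _).1 this

def bfun (x : Gp p) : SLZ := mk2 (x.1 0 0) (p * x.1 0 1) (x.1 1 0 / p) (x.1 1 1) (by
  have := det1 x.1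
  have h2 := Int.ediv_mul_cancel (Gp_dvd p x)
  linear_combination this - x.1 0 1 * h2)

theorem phi'_bfun (hip : p * ip = 1) (x : Gp p) : phi' p ip hip (bfun p x) = phi R x.1 := by
  have h2 := congrArg (Int.cast : ℤ → R) (Int.mul_ediv_cancel' (Gp_dvd p x))
  push_cast at h2
  apply sl_ext
  · rfl
  · rw [phi'_01, phi_apply]
    change ip * ((p * x.1 0 1 : ℤ) : R) = _
    push_cast
    linear_combination (x.1 0 1 : R) * hip
  · rw [phi'_10, phi_apply]
    exact h2
  · rfl

def bhom (hip : p * ip = 1) : Gp p →* SLZ where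
  toFun := bfun p
  map_one' := by
    apply phi'_inj p ip hip; rw [phi'_bfun]; simp
  map_mul' x y := by
    apply phi'_inj p ip hip; rw [map_mul, phi'_bfun, phi'_bfun, phi'_bfun]; simp

theorem phi'_bhom (hip : p * ip = 1) (x : Gp p) : phi' p ip hip (bhom p ip hip x) = phi R x.1 := phi'_bfun p ip hip x

abbrev Zs (R : Type) [CommRing R] : Subring R := (Int.castRingHom R).range

theorem mem_Zs {r : R} : r ∈ Zs R ↔ ∃ z : ℤ, (z : R) = r := Iff.rfl

def PA (g : SpecialLinearGroup (Fin 2) R) (n : ℕ) : Prop := ∀ i j, (p : R) ^ n * g i j ∈ Zs R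
def PB (g : SpecialLinearGroup (Fin 2) R) (n : ℕ) : Prop :=
  ∀ j, (p : R) ^ n * (p * g 0 j) ∈ Zs R ∧ (p : R) ^ n * g 1 j ∈ Zs R

variable {p}
theorem zs_int (z : ℤ) : (z : R) ∈ Zs R := ⟨z, rfl⟩
theorem zs_nat (z : ℕ) : (z : R) ∈ Zs R := natCast_mem _ _

theorem PA_PB {g : SpecialLinearGroup (Fin 2) R} {n : ℕ} (h : PA p g n) : PB p g n := fun j =>
  ⟨by rw [mul_left_comm]; exact mul_mem (zs_nat p) (h 0 j), h 1 j⟩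

theorem PB_PA {g : SpecialLinearGroup (Fin 2) R} {n : ℕ} (h : PB p g n) : PA p g (n + 1) := fun i j => by
  rw [pow_succ, mul_assoc]
  fin_cases i
  · exact (h j).1
  · change (p : R) ^ n * (p * g 1 j) ∈ _
    rw [mul_left_comm]; exact mul_mem (zs_nat p) (h j).2

theorem PA_phi {g : SpecialLinearGroup (Fin 2) R} {n : ℕ} (x : SLZ) (h : PA p g n) : PA p (phi R x * g) n := fun i j => by
  rw [mul00, phi_apply, phi_apply, mul_add, mul_left_comm, mul_left_comm (_ ^ n)]
  exact add_mem (mul_mem (zs_int _) (h _ _)) (mul_mem (zs_int _) (h _ _))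

theorem PB_phi' (hip : p * ip = 1) {g : SpecialLinearGroup (Fin 2) R} {n : ℕ} (x : SLZ) (h : PB p g n) :
    PB p (phi' p ip hip x * g) n := fun j => by
  rw [mul00, mul00, phi'_00, phi'_01, phi'_10, phi'_11]
  constructor
  · have : (p : R) ^ n * (p * (x 0 0 * g 0 j + ip * x 0 1 * g 1 j)) = x 0 0 * (p ^ n * (p * g 0 j)) + x 0 1 * (p ^ n * g 1 j) := by
      linear_combination p ^ n * (x 0 1 : R) * g 1 j * hip
    rw [this]
    exact add_mem (mul_mem (zs_int _) (h _).1) (mul_mem (zs_int _) (h _).2)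
  · have : (p : R) ^ n * (p * x 1 0 * g 0 j + x 1 1 * g 1 j) = x 1 0 * (p ^ n * (p * g 0 j)) + x 1 1 * (p ^ n * g 1 j) := by
      ring
    rw [this]
    exact add_mem (mul_mem (zs_int _) (h _).1) (mul_mem (zs_int _) (h _).2)

theorem ex_PA (hR : ∀ r : R, ∃ n : ℕ, (p : R) ^ n * r ∈ Zs R) (g : SpecialLinearGroup (Fin 2) R) : ∃ n, PA p g n := by
  choose f hf using hR
  refine ⟨f (g 0 0) + f (g 0 1) + f (g 1 0) + f (g 1 1), fun i j => ?_⟩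
  have : ∀ r m, f r ≤ m → (p : R) ^ m * r ∈ Zs R := fun r m h => by
    obtain ⟨k, rfl⟩ := Nat.exists_eq_add_of_le h
    rw [pow_add, mul_right_comm, mul_comm]
    exact mul_mem (pow_mem (zs_nat p) _) (hf r)
  apply this
  fin_cases i <;> fin_cases j <;> simp <;> omega

theorem ex_PB (hR : ∀ r : R, ∃ n : ℕ, (p : R) ^ n * r ∈ Zs R) (g : SpecialLinearGroup (Fin 2) R) : ∃ n, PB p g n :=
  (ex_PA hR g).imp fun _ => PA_PB

open Classical in
noncomputable def nA (hR : ∀ r : R, ∃ n : ℕ, (p : R) ^ n * r ∈ Zs R) (g : SpecialLinearGroup (Fin 2) R) : ℕ :=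
  Nat.find (ex_PA hR g)
open Classical in
noncomputable def nB (hR : ∀ r : R, ∃ n : ℕ, (p : R) ^ n * r ∈ Zs R) (g : SpecialLinearGroup (Fin 2) R) : ℕ :=
  Nat.find (ex_PB hR g)

variable (hR : ∀ r : R, ∃ n : ℕ, (p : R) ^ n * r ∈ Zs R)

theorem nA_spec (g) : PA p g (nA hR g) := by classical exact Nat.find_spec (ex_PA hR g)
theorem nB_spec (g) : PB p g (nB hR g) := by classical exact Nat.find_spec (ex_PB hR g)
theorem nA_le {g} {n : ℕ} (h : PA p g n) : nA hR g ≤ n := by classical exact Nat.find_min' (ex_PA hR g) h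
theorem nB_le {g} {n : ℕ} (h : PB p g n) : nB hR g ≤ n := by classical exact Nat.find_min' (ex_PB hR g) h

theorem nA_phi (x : SLZ) (g) : nA hR (phi R x * g) = nA hR g := by
  apply le_antisymm
  · exact nA_le hR (PA_phi x (nA_spec hR g))
  · refine nA_le hR ?_
    have := PA_phi x⁻¹ (nA_spec hR (phi R x * g))
    rwa [← mul_assoc, ← map_mul, inv_mul_cancel, map_one, one_mul] at this

theorem nB_phi' (hip : p * ip = 1) (x : SLZ) (g) : nB hR (phi' p ip hip x * g) = nB hR g := by
  apply le_antisymm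
  · exact nB_le hR (PB_phi' ip hip x (nB_spec hR g))
  · refine nB_le hR ?_
    have := PB_phi' ip hip x⁻¹ (nB_spec hR (phi' p ip hip x * g))
    rwa [← mul_assoc, ← map_mul, inv_mul_cancel, map_one, one_mul] at this

noncomputable def hAp (g : SpecialLinearGroup (Fin 2) R) : ℕ := 2 * nA hR g
noncomputable def hBp (g : SpecialLinearGroup (Fin 2) R) : ℕ := 2 * nB hR g + 1

/-- division by `p` in integers -/
theorem div_of (hip : p * ip = 1) {z w : ℤ} {r : R} (h1 : (p : R) * r = z) (h2 : r = w) : (p : ℤ) ∣ z :=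
  ⟨w, by have : (z : R) = p * w := by rw [← h1, h2]
         exact_mod_cast this⟩

theorem of_div (hip : p * ip = 1) {z : ℤ} {r : R} (h1 : (p : R) * r = z) (h2 : (p : ℤ) ∣ z) : r ∈ Zs R := by
  obtain ⟨w, rfl⟩ := h2
  refine ⟨w, ?_⟩
  push_cast at h1
  change (w : R) = r
  linear_combination (r - w) * hip - ip * h1

theorem ltBAp (g g') (h : nA hR g = nA hR g') : hBp hR g' < hAp hR g ↔ ∃ n, nA hR g = n + 1 ∧ PB p g' n := by
  unfold hBp hAp
  constructor
  · intro h1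
    have h2 := nA_le hR (PB_PA (nB_spec hR g'))
    refine ⟨nB hR g', by omega, nB_spec hR _⟩
  · rintro ⟨n, e, h1⟩
    have := nB_le hR h1
    omega

theorem ltABp (g g') (h : nB hR g = nB hR g') : hAp hR g' < hBp hR g ↔ PA p g' (nB hR g) := by
  unfold hBp hAp
  constructor
  · intro h1
    have h2 := nB_le hR (PA_PB (nA_spec hR g'))
    have : nB hR g = nA hR g' := by omega
    rw [this]; exact nA_spec hR _
  · intro h1
    have := nA_le hR h1
    omega

theorem amalgam_p (hp : p.Prime) (hip : p * ip = 1) :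
    Amalgam (phi R) (phi' p ip hip) (Gp p).subtype (bhom p ip hip) (hAp hR) (hBp hR) where
  injα := phi_inj
  injβ := phi'_inj p ip hip
  inja := Subtype.val_injective
  comm c := (phi'_bhom p ip hip c).symm
  invA x g := by unfold hAp; rw [nA_phi]
  invB x g := by unfold hBp; rw [nB_phi']
  ne g := by unfold hAp hBp; omega
  exA g := by
    rcases hn : nA hR g with _ | n
    · left
      have h := nA_spec hR g
      rw [hn] at h
      choose z hz using h
      simp only [pow_zero, one_mul] at hz
      have hd := detR g
      rw [← hz, ← hz, ← hz, ← hz] at hd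
      simp only [eq_intCast] at hd
      refine ⟨mk2 (z 0 0) (z 0 1) (z 1 0) (z 1 1) (by exact_mod_cast hd), ?_⟩
      apply sl_ext <;> exact hz _ _
    · right
      have h := nA_spec hR g
      rw [hn] at h
      choose z hz using h
      have hz' : ∀ i j, (z i j : R) = p ^ (n+1) * g i j := hz
      have hd := detR g
      have hd' : z 0 0 * z 1 1 - z 0 1 * z 1 0 = (p : ℤ) ^ (n+1) * p ^ (n + 1) := by
        have : ((z 0 0 * z 1 1 - z 0 1 * z 1 0 : ℤ) : R) = ((p : ℤ) ^ (n+1) * p ^ (n + 1) : ℤ) := by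
          push_cast
          rw [hz', hz', hz', hz']
          linear_combination (p : R) ^ (n+1) * p ^ (n+1) * hd
        exact_mod_cast this
      obtain ⟨x, h0, h1⟩ := kill_row p hp (z 0 0) (z 0 1) (z 1 0) (z 1 1) (by
        rw [hd']; exact Dvd.dvd.mul_right (dvd_pow_self _ (by omega)) _)
      refine ⟨mS * x, (ltBAp hR _ _ (nA_phi hR _ _).symm).2 ⟨n, hn, fun j => ⟨?_, ?_⟩⟩⟩
      · have := PA_phi (mS * x) (nA_spec hR g) 0 j
        rw [hn, pow_succ, mul_assoc] at this
        exact this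
      · refine of_div ip hip (z := x 0 0 * z 0 j + x 0 1 * z 1 j) ?_ ?_
        · rw [mul00, phi_apply, phi_apply, S10, S11]
          push_cast
          rw [hz', hz']; ring
        · fin_cases j
          · exact h0
          · exact h1
  exB g := by
    have h := nB_spec hR g
    set m := nB hR g with hm
    choose z hz using fun j => (h j).1
    choose w hw using fun j => (h j).2
    have hz' : ∀ j, (z j : R) = p ^ m * (p * g 0 j) := hz
    have hw' : ∀ j, (w j : R) = p ^ m * g 1 j := hw
    have hd := detR g
    have hd' : z 0 * w 1 - z 1 * w 0 = (p : ℤ) * p ^ m * p ^ m := by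
      have : ((z 0 * w 1 - z 1 * w 0 : ℤ) : R) = ((p : ℤ) * p ^ m * p ^ m : ℤ) := by
        push_cast
        rw [hz', hz', hw', hw']
        linear_combination (p : R) * p ^ m * p ^ m * hd
      exact_mod_cast this
    obtain ⟨x, h0, h1⟩ := kill_row p hp (z 0) (z 1) (w 0) (w 1) (by
        rw [hd', mul_assoc]; exact dvd_mul_right _ _)
    refine ⟨x, (ltABp hR _ _ (nB_phi' ip hR hip _ _).symm).2 ?_⟩
    have hB := PB_phi' ip hip x (nB_spec hR g)
    intro i j
    fin_cases i
    · refine of_div ip hip (z := x 0 0 * z j + x 0 1 * w j) ?_ ?_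
      · change p * (p ^ nB hR g * (phi' p ip hip x * g) 0 j) = _
        rw [mul00, phi'_00, phi'_01, ← hm]
        push_cast
        rw [hz', hw']
        linear_combination p ^ m * (x 0 1 : R) * g 1 j * hip
      · fin_cases j
        · exact h0
        · exact h1
    · exact (hB j).2
  unA g x h1 h2 := by
    rw [ltBAp hR _ _ rfl] at h1
    rw [ltBAp hR _ _ (nA_phi hR _ _).symm] at h2
    obtain ⟨n, hn, h1⟩ := h1
    obtain ⟨n', hn', h2⟩ := h2
    obtain rfl : n = n' := by omega
    suffices h : (p : ℤ) ∣ x 1 0 from ⟨⟨x, by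
      rw [CongruenceSubgroup.Gamma0_mem]; exact (ZMod.intCast_zmod_eq_zero_iff_dvd _ _).2 h⟩, rfl⟩
    have hpp : Prime (p : ℤ) := Nat.prime_iff_prime_int.1 hp
    choose u hu using fun j => (h1 j).1
    choose v hv using fun j => (h1 j).2
    choose v' hv' using fun j => (h2 j).2
    have hu1 : ∀ j, (u j : R) = p ^ n * (p * g 0 j) := hu
    have hv1 : ∀ j, (v j : R) = p ^ n * g 1 j := hv
    have hv1' : ∀ j, (v' j : R) = p ^ n * (phi R x * g) 1 j := hv'
    by_contra hx
    have : PA p g n := by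
      intro i j
      fin_cases i
      · refine of_div ip hip (z := u j) ?_ ?_
        · change p * (p ^ n * g 0 j) = _
          rw [hu1]; ring
        · refine (hpp.dvd_or_dvd (a := x 1 0) ?_).resolve_left hx
          refine ⟨v' j - x 1 1 * v j, ?_⟩
          have : ((x 1 0 * u j : ℤ) : R) = (p * (v' j - x 1 1 * v j) : ℤ) := by
            push_cast
            rw [hu1, hv1, hv1', mul00, phi_apply, phi_apply]; ring
          exact_mod_cast this
      · exact ⟨_, hv1 j⟩
    have := nA_le hR this
    omega
  unB g x h1 h2 := by
    rw [ltABp hR _ _ rfl] at h1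
    rw [ltABp hR _ _ (nB_phi' ip hR hip _ _).symm] at h2
    suffices h : (p : ℤ) ∣ x 0 1 by
      obtain ⟨t, ht⟩ := h
      have hdx := det1 x
      refine ⟨⟨mk2 (x 0 0) t (p * x 1 0) (x 1 1) (by rw [ht] at hdx; linear_combination hdx), ?_⟩, ?_⟩
      · rw [CongruenceSubgroup.Gamma0_mem]
        change ((p * x 1 0 : ℤ) : ZMod p) = 0
        simp
      · apply phi'_inj p ip hip
        rw [phi'_bhom]
        apply sl_ext
        · rfl
        · have ht' := congrArg (Int.cast : ℤ → R) ht
          push_cast at ht'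
          change ip * (x 0 1 : R) = (t : R)
          linear_combination t * hip + ip * ht'
        · change p * (x 1 0 : R) = ((p * x 1 0 : ℤ) : R)
          push_cast; rfl
        · rfl
    have hpp : Prime (p : ℤ) := Nat.prime_iff_prime_int.1 hp
    have h0 := nB_spec hR g
    set m := nB hR g with hm
    choose u hu using fun j => h1 0 j
    choose u' hu' using fun j => h2 0 j
    choose v hv using fun j => (h0 j).2
    have hu1 : ∀ j, (u j : R) = p ^ m * g 0 j := hu
    have hv1 : ∀ j, (v j : R) = p ^ m * g 1 j := hv
    have hu1' : ∀ j, (u' j : R) = p ^ m * (phi' p ip hip x * g) 0 j := hu'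
    by_contra hx
    have hdv : ∀ j, (p : ℤ) ∣ v j := by
      intro j
      refine (hpp.dvd_or_dvd (a := x 0 1) ?_).resolve_left hx
      refine ⟨u' j - x 0 0 * u j, ?_⟩
      have : ((x 0 1 * v j : ℤ) : R) = (p * (u' j - x 0 0 * u j) : ℤ) := by
        push_cast
        rw [hu1, hv1, hu1', mul00, phi'_00, phi'_01]
        linear_combination (-(p : R) ^ m * x 0 1 * g 1 j) * hip
      exact_mod_cast this
    rcases hm0 : m with _ | k
    · have hd := detR g
      rw [hm0] at hu1 hv1
      have : u 0 * v 1 - u 1 * v 0 = 1 := by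
        have : ((u 0 * v 1 - u 1 * v 0 : ℤ) : R) = (1 : ℤ) := by
          push_cast
          rw [hu1, hu1, hv1, hv1]
          simp only [pow_zero, one_mul]; exact hd
        exact_mod_cast this
      have h3 : (p : ℤ) ∣ 1 := this ▸ dvd_sub ((hdv 1).mul_left _) ((hdv 0).mul_left _)
      exact hpp.not_unit (isUnit_of_dvd_one h3)
    · have : PB p g k := by
        intro j
        refine ⟨⟨u j, ?_⟩, ?_⟩
        · change (u j : R) = _
          rw [hu1, hm0]; ring
        · refine of_div ip hip (z := v j) ?_ (hdv j)
          rw [hv1, hm0]; ring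
      have := nB_le hR this
      omega

end ptree
end SL2coh

end

section
open CategoryTheory
namespace SL2coh
open groupCohomology

section cyclic
variable {k : Type} [CommRing k]

theorem gen_zpowers (m : ℕ) [NeZero m] (x : Cy m) : x ∈ Subgroup.zpowers (gen m) :=
  ⟨(ZMod.val (Multiplicative.toAdd x) : ℤ), by
    change gen m ^ ((ZMod.val (Multiplicative.toAdd x) : ℕ) : ℤ) = x
    rw [zpow_natCast]; exact gen_pow m x⟩

theorem piOdd_surj {C : Type} [CommGroup C] [Fintype C] (A : Rep.{0} k C) (g : C)
    (hg : ∀ x, x ∈ Subgroup.zpowers g) (n : ℕ) (hn : Odd n) :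
    Function.Surjective (Rep.FiniteCyclicGroup.groupCohomologyπOdd A g hg n hn).hom :=
  (ModuleCat.epi_iff_surjective _).1 (epi_comp' (@IsIso.epi_of_iso _ _ _ _ _ (Iso.isIso_inv _)) (epi_comp' inferInstance (@IsIso.epi_of_iso _ _ _ _ _ (Iso.isIso_inv _))))

theorem piEven_surj {C : Type} [CommGroup C] [Fintype C] (A : Rep.{0} k C) (g : C)
    (hg : ∀ x, x ∈ Subgroup.zpowers g) (n : ℕ) [NeZero n] (hn : Even n) :
    Function.Surjective (Rep.FiniteCyclicGroup.groupCohomologyπEven A g hg n hn).hom :=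
  (ModuleCat.epi_iff_surjective _).1 (epi_comp' (@IsIso.epi_of_iso _ _ _ _ _ (Iso.isIso_inv _)) (epi_comp' inferInstance (@IsIso.epi_of_iso _ _ _ _ _ (Iso.isIso_inv _))))

theorem norm_apply' {C : Type} [CommGroup C] [Fintype C] (A : Rep.{0} k C) (v : A.V) :
    A.norm.hom v = ∑ g, A.ρ g v := by
  change A.ρ.norm v = _
  simp [Representation.norm]

theorem odd_vanish (m : ℕ) [NeZero m] (A : Rep.{0} k (Cy m)) (htriv : ∀ g v, A.ρ g v = v)
    (htf : ∀ v : A.V, m • v = 0 → v = 0) (n : ℕ) (hn : Odd n) (x : groupCohomology A n) : x = 0 := by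
  obtain ⟨⟨y, hy⟩, rfl⟩ := piOdd_surj A (gen m) (gen_zpowers m) n hn x
  have : y = 0 := by
    apply htf
    have h : A.norm.hom y = 0 := hy
    rw [norm_apply'] at h
    simp only [htriv, Finset.sum_const, Finset.card_univ, Fintype.card_multiplicative, ZMod.card] at h
    exact h
  subst this
  exact map_zero _

end cyclic

section transfer
variable {k : Type} [CommRing k] {H G : Type} [Group H] [Group G]

/-- transfer map on coefficients -/
noncomputable def transT {ι : Type} [Fintype ι] (α : H →* G) (t : ι → G)
    (ht : ∀ s, ∃ π : Equiv.Perm ι, ∀ i, ∃ h, t i * s = α h * t (π i)) (M : Rep.{0} k G) :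
    Rep.coind α (Rep.res α M) ⟶ M :=
  Rep.ofHom ⟨{ toFun := fun f => ∑ i, M.ρ (t i)⁻¹ (f.1 (t i))
               map_add' := fun f g => by
                 rw [← Finset.sum_add_distrib]
                 exact Finset.sum_congr rfl fun i _ => map_add _ _ _
               map_smul' := fun c f => by
                 rw [RingHom.id_apply, Finset.smul_sum]
                 exact Finset.sum_congr rfl fun i _ => map_smul _ _ _ }, fun s => by
    refine LinearMap.ext fun f => ?_
    change ∑ i, M.ρ (t i)⁻¹ (f.1 (t i * s)) = M.ρ s (∑ i, M.ρ (t i)⁻¹ (f.1 (t i)))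
    obtain ⟨π, hπ⟩ := ht s
    rw [map_sum, ← Equiv.sum_comp π (fun i => M.ρ s (M.ρ (t i)⁻¹ (f.1 (t i))))]
    refine Finset.sum_congr rfl fun i _ => ?_
    obtain ⟨h, hh⟩ := hπ i
    have e1 : f.1 (α h * t (π i)) = M.ρ (α h) (f.1 (t (π i))) := f.2 h (t (π i))
    rw [hh, e1, ← Module.End.mul_apply, ← Module.End.mul_apply, ← map_mul, ← map_mul]
    congr 2
    have : t i = α h * t (π i) * s⁻¹ := by rw [← hh]; group
    rw [this]; group⟩

theorem sum_hom_apply {ι : Type} {A B : Rep.{0} k G} (s : Finset ι) (φ : ι → (A ⟶ B)) (v : A.V) :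
    (∑ i ∈ s, φ i).hom v = ∑ i ∈ s, (φ i).hom v := by
  classical
  induction s using Finset.induction with
  | empty => rfl
  | insert a s ha ih => rw [Finset.sum_insert ha, Finset.sum_insert ha, ← ih]; rfl

theorem transfer {ι : Type} [Fintype ι] (α : H →* G) (hα : Function.Injective α) (t : ι → G)
    (ht : ∀ s, ∃ π : Equiv.Perm ι, ∀ i, ∃ h, t i * s = α h * t (π i)) (M : Rep.{0} k G) (n : ℕ)
    (y : groupCohomology M n) (hy : (rs α M n).hom y = 0) : Fintype.card ι • y = 0 := by
  rw [← sh_toCoind] at hy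
  have h1 : (cf (toCoind α M) n).hom y = 0 := (sh_bij α hα n _).1 (hy.trans (map_zero _).symm)
  have h2 : (cf (toCoind α M ≫ transT α t ht M) n).hom y = 0 := by
    rw [← cf_comp, h1, map_zero]
  have h3 : toCoind α M ≫ transT α t ht M = ∑ i : ι, 𝟙 M := by
    refine hom_ext' fun v => ?_
    have e : (toCoind α M ≫ transT α t ht M).hom v = ∑ i : ι, v := by
      change ∑ i, M.ρ (t i)⁻¹ (M.ρ (t i) v) = _
      refine Finset.sum_congr rfl fun i _ => ?_
      rw [← Module.End.mul_apply, ← map_mul, inv_mul_cancel, map_one]; rfl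
    rw [e, sum_hom_apply]
    rfl
  rw [h3, cf_sum] at h2
  simpa [cf_id] using h2

end transfer

abbrev i3 : Cy 3 →* Cy 6 := cyc 3 (Multiplicative.ofAdd 4) (by decide)
abbrev r3 : Cy 6 →* Cy 3 := cyc 6 (Multiplicative.ofAdd 1) (by decide)
abbrev r2 : Cy 6 →* Cy 2 := cyc 6 (Multiplicative.ofAdd 1) (by decide)
theorem r3i3 : r3.comp i3 = MonoidHom.id _ := cyc_ext 3 (by decide)
theorem r2i26 : r2.comp i26 = MonoidHom.id _ := cyc_ext 2 (by decide)
theorem i3_inj : Function.Injective i3 := by decide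
theorem i26_inj : Function.Injective i26 := by decide
theorem i24_inj : Function.Injective i24 := by decide

section
variable {k : Type} [CommRing k]
theorem zero_of_C2_C3 (M : Rep.{0} k (Cy 6)) (n : ℕ) (y : groupCohomology M n) (h2 : (rs i26 M n).hom y = 0)
    (h3 : (rs i3 M n).hom y = 0) : y = 0 := by
  have e2 := transfer i26 i26_inj (fun i : Fin 3 => (Multiplicative.ofAdd (i.1 : ZMod 6))) (by decide +kernel) M n y h2
  have e3 := transfer i3 i3_inj (fun i : Fin 2 => (Multiplicative.ofAdd (i.1 : ZMod 6))) (by decide +kernel) M n y h3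
  rw [Fintype.card_fin] at e2 e3
  have : y = 3 • y - 2 • y := by abel
  rw [this, e2, e3, sub_zero]
end

section triv
variable {k : Type} [CommRing k] {G H K : Type} [Group G] [Group H] [Group K]

abbrev kk (k : Type) [CommRing k] (G : Type) [Group G] : Rep.{0} k G := Rep.trivial k G k

noncomputable def tri (k : Type) [CommRing k] (f : G →* H) : Rep.res f (kk k H) ⟶ kk k G := Rep.ofHom ⟨LinearMap.id, fun g => rfl⟩

noncomputable abbrev tr (k : Type) [CommRing k] (f : G →* H) (n : ℕ) : groupCohomology (kk k H) n ⟶ groupCohomology (kk k G) n :=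
  groupCohomology.map f (tri k f) n

theorem tr_comp (f : H →* K) (g : G →* H) (h : G →* K) (e : f.comp g = h) (n : ℕ) (x : groupCohomology (kk k K) n) :
   (tr k g n).hom ((tr k f n).hom x) = (tr k h n).hom x := map_map f g _ _ h _ e.symm (fun _ => rfl) n x

theorem tr_id (n : ℕ) (x : groupCohomology (kk k G) n) : (tr k (MonoidHom.id G) n).hom x = x := 
  (map_ext _ _ _ _ rfl (fun _ => rfl) n x).trans (cf_id (kk k G) n x)

theorem tr_one (n : ℕ) (x : groupCohomology (kk k H) (n+1)) : (tr k (1 : G →* H) (n+1)).hom x = 0 := 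
  map_one_zero _ _ _

theorem rs_eq_tr (f : G →* H) (n : ℕ) : rs f (kk k H) n = tr k f n := rfl

variable [IsDomain k] [CharZero k]

theorem odd_cy (m : ℕ) [NeZero m] (n : ℕ) (hn : Odd n) (x : groupCohomology (kk k (Cy m)) n) : x = 0 := by
  refine odd_vanish m _ (fun _ _ => rfl) (fun v hv => ?_) n hn x
  change m • (v : k) = 0 at hv
  rw [nsmul_eq_mul] at hv
  exact (mul_eq_zero.1 hv).resolve_left (Nat.cast_ne_zero.2 (NeZero.ne m))

theorem comm0 : α4.comp i24 = α6.comp i26 := MonoidHom.ext amalgam_SLZ.comm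

theorem odd_SLZ (n : ℕ) (hn : Even n) (x : groupCohomology (kk k SLZ) (n+1)) : x = 0 := by
  obtain ⟨D, hD0, hD⟩ : ∃ D : groupCohomology (kk k (Cy 2)) n →ₗ[k] groupCohomology (kk k SLZ) (n+1),
      (∀ z, D z = 0 ↔ ∃ u v, z = (tr k i24 n).hom u - (tr k i26 n).hom v) ∧
      (∀ x, (tr k α4 (n+1)).hom x = 0 → (tr k α6 (n+1)).hom x = 0 → ∃ z, D z = x) := mv_delta amalgam_SLZ (α4.comp i24) rfl comm0 (kk k SLZ) n
  obtain ⟨z, rfl⟩ := hD x (odd_cy (k := k) 4 (n+1) hn.add_one _) (odd_cy (k := k) 6 (n+1) hn.add_one _)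
  refine (hD0 z).2 ⟨0, - (tr k r2 n).hom z, ?_⟩
  rw [map_zero, zero_sub, map_neg, neg_neg]
  symm
  exact (tr_comp r2 i26 _ r2i26 n z).trans (tr_id n z)


theorem F3 (φ : SLZ →* G) (r4 : G →* Cy 4) (h4 : r4.comp (φ.comp α4) = MonoidHom.id _)
    (r3' : G →* Cy 3) (h3 : r3'.comp (φ.comp (α6.comp i3)) = MonoidHom.id _) (n : ℕ) (hn : Odd n)
    (x : groupCohomology (kk k SLZ) (n+1)) : ∃ z, (tr k φ (n+1)).hom z = x := by
  have c34 : ∀ f : Cy 4 →* Cy 3, f = 1 := fun f => by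
    refine cyc_ext 4 ?_
    have h : f (gen 4) ^ 4 = 1 := by rw [← map_pow]; exact map_one f
    have : ∀ y : Cy 3, y ^ 4 = 1 → y = 1 := by decide
    exact this _ h
  have c43 : ∀ f : Cy 3 →* Cy 4, f = 1 := fun f => by
    refine cyc_ext 3 ?_
    have h : f (gen 3) ^ 3 = 1 := by rw [← map_pow]; exact map_one f
    have : ∀ y : Cy 4, y ^ 3 = 1 → y = 1 := by decide
    exact this _ h
  set x4 := (tr k α4 (n+1)).hom x with hx4
  set x3 := (tr k (α6.comp i3) (n+1)).hom x with hx3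
  refine ⟨(tr k r4 (n+1)).hom x4 + (tr k r3' (n+1)).hom x3, ?_⟩
  rw [← sub_eq_zero]
  set w := (tr k φ (n+1)).hom ((tr k r4 (n+1)).hom x4 + (tr k r3' (n+1)).hom x3) - x with hw
  have e4 : (tr k α4 (n+1)).hom w = 0 := by
    rw [hw, map_sub, map_add, map_add, tr_comp r4 φ _ rfl, tr_comp (r4.comp φ) α4 _ h4, tr_id,
      tr_comp r3' φ _ rfl, tr_comp (r3'.comp φ) α4 1 (c34 _), tr_one, add_zero, ← hx4, sub_self]
  have e3 : (tr k (α6.comp i3) (n+1)).hom w = 0 := by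
    rw [hw, map_sub, map_add, map_add, tr_comp r4 φ _ rfl, tr_comp (r4.comp φ) (α6.comp i3) 1 (c43 _), tr_one,
      tr_comp r3' φ _ rfl, tr_comp (r3'.comp φ) (α6.comp i3) _ h3, tr_id, zero_add, ← hx3, sub_self]
  refine mv_zero amalgam_SLZ (α4.comp i24) rfl comm0 (kk k SLZ) n (fun z => odd_cy 2 n hn z) w e4 ?_
  change (tr k α6 (n+1)).hom w = 0
  refine zero_of_C2_C3 (kk k (Cy 6)) (n+1) _ ?_ ?_
  · have e5 : (tr k (α4.comp i24) (n+1)).hom w = 0 := by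
      rw [← tr_comp α4 i24 _ rfl, e4, map_zero]
    exact (tr_comp α6 i26 _ comm0.symm (n+1) w).trans e5
  · exact (tr_comp α6 i3 _ rfl (n+1) w).trans e3

end triv
end SL2coh

end

section
open CategoryTheory
namespace SL2coh
open groupCohomology

section chars
open Matrix

def c4 (a b c d : ZMod 4) : ZMod 4 := (1 - c^2) * (b*d - (c-1)*d + c + 3) + c*(a+d+1)
def c3 (a b c d : ZMod 3) : ZMod 3 := (1 - c^2) * (b*d) + c*(a+d)

theorem c4_mul : ∀ a b c d : ZMod 4, a*d-b*c = 1 → ∀ a' b' c' d' : ZMod 4, a'*d'-b'*c' = 1 →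
   c4 (a*a'+b*c') (a*b'+b*d') (c*a'+d*c') (c*b'+d*d') = c4 a b c d + c4 a' b' c' d' := by
  decide +kernel
theorem c3_mul : ∀ a b c d : ZMod 3, a*d-b*c = 1 → ∀ a' b' c' d' : ZMod 3, a'*d'-b'*c' = 1 →
   c3 (a*a'+b*c') (a*b'+b*d') (c*a'+d*c') (c*b'+d*d') = c3 a b c d + c3 a' b' c' d' := by
  decide +kernel

def chi4 : SpecialLinearGroup (Fin 2) (ZMod 4) →* Cy 4 where
  toFun g := Multiplicative.ofAdd (c4 (g 0 0) (g 0 1) (g 1 0) (g 1 1))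
  map_one' := by decide +kernel
  map_mul' x y := by
    rw [← ofAdd_add, ← c4_mul _ _ _ _ (detR x) _ _ _ _ (detR y)]
    congr 2 <;> exact mul00 _ _ _ _

def chi3 : SpecialLinearGroup (Fin 2) (ZMod 3) →* Cy 3 where
  toFun g := Multiplicative.ofAdd (c3 (g 0 0) (g 0 1) (g 1 0) (g 1 1))
  map_one' := by decide +kernel
  map_mul' x y := by
    rw [← ofAdd_add, ← c3_mul _ _ _ _ (detR x) _ _ _ _ (detR y)]
    congr 2 <;> exact mul00 _ _ _ _

theorem mSent : mS 0 0 = 0 ∧ mS 0 1 = -1 ∧ mS 1 0 = 1 ∧ mS 1 1 = 0 := by decide +kernel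
theorem mU4ent : (α6 (i3 (gen 3))) 0 0 = 0 ∧ (α6 (i3 (gen 3))) 0 1 = 1 ∧ (α6 (i3 (gen 3))) 1 0 = -1 ∧ (α6 (i3 (gen 3))) 1 1 = -1 := by decide +kernel

variable {R : Type} [CommRing R] [CharZero R] (p : ℕ) (ip : R)

theorem exists_r4 (hip : p * ip = 1) (q : R →+* ZMod 4) :
    ∃ r4 : SpecialLinearGroup (Fin 2) R →* Cy 4, r4.comp ((phi' p ip hip).comp α4) = MonoidHom.id _ := by
  have hq : (p : ZMod 4) * q ip = 1 := by have := congrArg q hip; simpa using this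
  set t : Cy 4 := Multiplicative.ofAdd (c4 0 (- q ip) p 0) with ht
  have ht4 : t ^ 4 = 1 := (by decide : ∀ t : Cy 4, t ^ 4 = 1) t
  refine ⟨((cyc 4 t ht4).comp chi4).comp (SpecialLinearGroup.map q), cyc_ext 4 ?_⟩
  have h1 : chi4 (SpecialLinearGroup.map q (phi' p ip hip mS)) = t := by
    obtain ⟨e1, e2, e3, e4⟩ := mSent
    have f1 : (SpecialLinearGroup.map q (phi' p ip hip mS)) 0 0 = 0 := by
      change q (mS 0 0 : R) = 0; rw [e1]; simp
    have f2 : (SpecialLinearGroup.map q (phi' p ip hip mS)) 0 1 = - q ip := by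
      change q (ip * (mS 0 1 : R)) = _; rw [e2]; simp
    have f3 : (SpecialLinearGroup.map q (phi' p ip hip mS)) 1 0 = p := by
      change q (p * (mS 1 0 : R)) = _; rw [e3]; simp
    have f4 : (SpecialLinearGroup.map q (phi' p ip hip mS)) 1 1 = 0 := by
      change q (mS 1 1 : R) = 0; rw [e4]; simp
    change Multiplicative.ofAdd (c4 _ _ _ _) = _
    rw [f1, f2, f3, f4]
  have h2 : α4 (gen 4) = mS := cyc_gen 4 (by norm_num) _ _
  change cyc 4 t ht4 (chi4 (SpecialLinearGroup.map q (phi' p ip hip (α4 (gen 4))))) = gen 4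
  rw [h2, h1, cyc_apply]
  have key : ∀ x y : ZMod 4, x * y = 1 → (Multiplicative.ofAdd (c4 0 (-y) x 0)) ^ (c4 0 (-y) x 0).val = gen 4 := by
    decide
  exact key _ _ hq

theorem exists_r3 (hip : p * ip = 1) (q : R →+* ZMod 3) :
    ∃ r3' : SpecialLinearGroup (Fin 2) R →* Cy 3, r3'.comp ((phi' p ip hip).comp (α6.comp i3)) = MonoidHom.id _ := by
  have hq : (p : ZMod 3) * q ip = 1 := by have := congrArg q hip; simpa using this
  set t : Cy 3 := Multiplicative.ofAdd (c3 0 (q ip) (-p) (-1)) with ht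
  have ht4 : t ^ 3 = 1 := (by decide : ∀ t : Cy 3, t ^ 3 = 1) t
  refine ⟨((cyc 3 t ht4).comp chi3).comp (SpecialLinearGroup.map q), cyc_ext 3 ?_⟩
  have h1 : chi3 (SpecialLinearGroup.map q (phi' p ip hip (α6 (i3 (gen 3))))) = t := by
    obtain ⟨e1, e2, e3, e4⟩ := mU4ent
    generalize α6 (i3 (gen 3)) = mm at *
    have f1 : (SpecialLinearGroup.map q (phi' p ip hip mm)) 0 0 = 0 := by
      change q (mm 0 0 : R) = 0; rw [e1]; simp
    have f2 : (SpecialLinearGroup.map q (phi' p ip hip mm)) 0 1 = q ip := by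
      change q (ip * (mm 0 1 : R)) = _; rw [e2]; simp
    have f3 : (SpecialLinearGroup.map q (phi' p ip hip mm)) 1 0 = -p := by
      change q (p * (mm 1 0 : R)) = _; rw [e3]; simp
    have f4 : (SpecialLinearGroup.map q (phi' p ip hip mm)) 1 1 = -1 := by
      change q (mm 1 1 : R) = _; rw [e4]; simp
    change Multiplicative.ofAdd (c3 _ _ _ _) = _
    rw [f1, f2, f3, f4]
  change cyc 3 t ht4 (chi3 (SpecialLinearGroup.map q (phi' p ip hip (α6 (i3 (gen 3)))))) = gen 3
  rw [h1, cyc_apply]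
  have key : ∀ x y : ZMod 3, x * y = 1 → (Multiplicative.ofAdd (c3 0 y (-x) (-1))) ^ (c3 0 y (-x) (-1)).val = gen 3 := by
    decide
  exact key _ _ hq

end chars
end SL2coh

end

section
open CategoryTheory
namespace SL2coh
open groupCohomology

section perm
variable {k : Type} [CommRing k] {K P : Type} [Group K]

theorem cf_bij {A B : Rep.{0} k K} (φ : A ⟶ B) (hφ : Function.Bijective φ.hom) (n : ℕ) :
    Function.Bijective (cf φ n).hom := by
  have h1 : Mono φ := (Rep.mono_iff_injective _).2 hφ.1
  have h2 : Epi φ := (Rep.epi_iff_surjective _).2 hφ.2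
  have h3 : IsIso φ := isIso_of_mono_of_epi φ
  refine Function.bijective_iff_has_inverse.2 ⟨(cf (inv φ) n).hom, fun x => ?_, fun x => ?_⟩
  · rw [cf_comp, IsIso.hom_inv_id, cf_id]
  · rw [cf_comp, IsIso.inv_hom_id, cf_id]

/-- functions on a set with an action -/
noncomputable abbrev Mr (k : Type) [CommRing k] (act : K →* Equiv.Perm P) : Rep.{0} k K :=
  Rep.of (X := P → k) ({ toFun := fun g => LinearMap.funLeft k k (act g⁻¹)
                         map_one' := by ext; simp
                         map_mul' := fun g h => by ext; simp } : Representation k K (P → k))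

/-- differences of functions -/
def Ns (k : Type) [CommRing k] (P : Type) : Submodule k (P → P → k) where
  carrier := {d | ∀ x y z, d x y + d y z = d x z}
  zero_mem' := fun _ _ _ => add_zero _
  add_mem' := fun {a b} ha hb x y z => by
    change (a x y + b x y) + (a y z + b y z) = a x z + b x z
    rw [← ha x y z, ← hb x y z]; ring
  smul_mem' := fun c a ha x y z => by
    change c * a x y + c * a y z = c * a x z
    rw [← ha x y z]; ring

noncomputable abbrev Nr (k : Type) [CommRing k] (act : K →* Equiv.Perm P) : Rep.{0} k K :=
  Rep.of (X := Ns k P) ({ toFun := fun g => 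
                            { toFun := fun d => ⟨fun x y => d.1 (act g⁻¹ x) (act g⁻¹ y), fun x y z => d.2 _ _ _⟩
                              map_add' := fun _ _ => rfl
                              map_smul' := fun _ _ => rfl }
                          map_one' := by
                            refine LinearMap.ext fun d => Subtype.ext ?_
                            funext x y
                            change d.1 (act 1⁻¹ x) (act 1⁻¹ y) = d.1 x y
                            simp
                          map_mul' := fun g h => by
                            refine LinearMap.ext fun d => Subtype.ext ?_
                            funext x y
                            change d.1 (act (g * h)⁻¹ x) (act (g * h)⁻¹ y) = d.1 (act h⁻¹ (act g⁻¹ x)) (act h⁻¹ (act g⁻¹ y))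
                            simp } : Representation k K (Ns k P))

theorem Mr_apply (act : K →* Equiv.Perm P) (g : K) (f : P → k) (x : P) : ((Mr k act).ρ g f : P → k) x = f (act g⁻¹ x) := rfl

theorem Nr_apply (act : K →* Equiv.Perm P) (g : K) (f : Ns k P) (x y : P) : ((Nr k act).ρ g f : Ns k P).1 x y = f.1 (act g⁻¹ x) (act g⁻¹ y) := rfl

variable (act : K →* Equiv.Perm P)
noncomputable def constR : kk k K ⟶ Mr k act :=
  Rep.ofHom ⟨{ toFun := fun c _ => c
               map_add' := fun _ _ => rfl
               map_smul' := fun _ _ => rfl }, fun g => rfl⟩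

noncomputable def diffR : Mr k act ⟶ Nr k act :=
  Rep.ofHom ⟨{ toFun := fun f => ⟨fun x y => f x - f y, fun x y z => by ring⟩
               map_add' := fun a b => Subtype.ext (by
                 funext x y
                 change (a x + b x) - (a y + b y) = (a x - a y) + (b x - b y)
                 ring)
               map_smul' := fun c a => Subtype.ext (by
                 funext x y
                 change c * a x - c * a y = c * (a x - a y)
                 ring) }, fun g => rfl⟩

theorem ses_MN (o : P) : SES (constR (k := k) act) (diffR act) := by
  refine SES.of ?_ ?_ ?_ ?_
  · refine fun v => Subtype.ext ?_
    funext x y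
    exact sub_self v
  · intro a b h
    exact congrFun h o
  · intro d
    refine ⟨fun x => d.1 x o, Subtype.ext ?_⟩
    funext x y
    change d.1 x o - d.1 y o = d.1 x y
    rw [← d.2 x y o]; ring
  · intro f hf
    refine ⟨f o, ?_⟩
    funext x
    have h : f x - f o = 0 := congrFun (congrFun (congrArg Subtype.val hf) x) o
    exact (sub_eq_zero.1 h).symm

variable {L : Type} [Group L] (ι : L →* K) (o : P)

noncomputable def evR (ho : ∀ l, act (ι l) o = o) : Rep.res ι (Mr k act) ⟶ kk k L :=
  Rep.ofHom ⟨LinearMap.proj o, fun g => by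
    refine LinearMap.ext fun f => ?_
    change f (act (ι g)⁻¹ o) = f o
    rw [← map_inv, ho]⟩

noncomputable def toCo (ho : ∀ l, act (ι l) o = o) : Mr k act ⟶ Rep.coind ι (kk k L) :=
  Rep.ofHom ⟨{ toFun := fun f => ⟨fun g => f (act g⁻¹ o), fun l g => by
                  change f (act (ι l * g)⁻¹ o) = f (act g⁻¹ o)
                  rw [mul_inv_rev, map_mul, Equiv.Perm.mul_apply, ← map_inv, ho]⟩
               map_add' := fun _ _ => rfl
               map_smul' := fun _ _ => rfl }, fun h => by
    refine LinearMap.ext fun f => Subtype.ext (funext fun g => ?_)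
    change f (act h⁻¹ (act g⁻¹ o)) = f (act (g * h)⁻¹ o)
    rw [mul_inv_rev, map_mul, Equiv.Perm.mul_apply]⟩

theorem ev_bij (hι : Function.Injective ι) (ho : ∀ l, act (ι l) o = o) (hs : ∀ g, act g o = o → g ∈ ι.range)
    (ht : ∀ x, ∃ g, act g o = x) (n : ℕ) : Function.Bijective (groupCohomology.map ι (evR (k := k) act ι o ho) n).hom := by
  have h1 : Function.Bijective (toCo (k := k) act ι o ho).hom := by
    constructor
    · intro a b h
      funext x
      obtain ⟨g, rfl⟩ := ht x
      have : a (act g⁻¹⁻¹ o) = b (act g⁻¹⁻¹ o) := congrFun (congrArg Subtype.val h) g⁻¹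
      simpa using this
    · intro F
      choose σ hσ using ht
      refine ⟨fun x => F.1 (σ x)⁻¹, Subtype.ext (funext fun g => ?_)⟩
      change F.1 (σ (act g⁻¹ o))⁻¹ = F.1 g
      obtain ⟨l, hl⟩ := hs (g * σ (act g⁻¹ o)) (by rw [map_mul, Equiv.Perm.mul_apply, hσ, map_inv]; simp)
      have : F.1 (ι l * (σ (act g⁻¹ o))⁻¹) = F.1 (σ (act g⁻¹ o))⁻¹ := F.2 l _
      rw [← this, hl, mul_assoc, mul_inv_cancel, mul_one]
  have h2 : ∀ x, (groupCohomology.map ι (evR (k := k) act ι o ho) n).hom x = (sh ι (kk k L) n).hom ((cf (toCo (k := k) act ι o ho) n).hom x) := fun x => by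
    symm
    refine map_map _ _ _ _ _ _ rfl (fun f => ?_) n x
    change f o = f (act 1⁻¹ o)
    simp
  have h3 := (sh_bij ι hι n (kk k L)).comp (cf_bij _ h1 n)
  convert h3 using 1
  funext x; exact h2 x

end perm

section F2
variable {k : Type} [CommRing k] [IsDomain k] [CharZero k] {R : Type} [CommRing R] [CharZero R] {p : ℕ} (ip : R)
  {P : Type} (act : SLZ →* Equiv.Perm P) (o : P)

theorem lin_aux {k A B C E U : Type} [CommRing k] [AddCommGroup A] [AddCommGroup B] [AddCommGroup C] [AddCommGroup E]
    [Module k A] [Module k B] [Module k C] [Module k E] (D : B →ₗ[k] E) (s : A →ₗ[k] B) (q : A →ₗ[k] C) (c : U → A) (t : U → B)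
    (hD : Function.Surjective D) (hs : Function.Bijective s) (hq : Function.Surjective q) (hc : ∀ u, s (c u) = t u)
    (hDk : ∀ z, D z = 0 ↔ ∃ u, z = t u) (hq0 : ∀ u, q (c u) = 0) (hq1 : ∀ m, q m = 0 → ∃ u, c u = m) : Nonempty (E ≃ₗ[k] C) := by
  have hker : LinearMap.ker (D ∘ₗ s) = LinearMap.ker q := by
    ext m
    rw [LinearMap.mem_ker, LinearMap.mem_ker, LinearMap.comp_apply, hDk]
    constructor
    · rintro ⟨u, hu⟩
      rw [← hc] at hu
      rw [hs.1 hu]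
      exact hq0 u
    · intro hm
      obtain ⟨u, rfl⟩ := hq1 m hm
      exact ⟨u, hc u⟩
  exact ⟨(LinearMap.quotKerEquivOfSurjective (D ∘ₗ s) (hD.comp hs.2)).symm ≪≫ₗ
    (Submodule.quotEquivOfEq _ _ hker ≪≫ₗ LinearMap.quotKerEquivOfSurjective q hq)⟩

theorem F2a (hR : ∀ r : R, ∃ n : ℕ, (p : R) ^ n * r ∈ Zs R) (hp : p.Prime) (hip : p * ip = 1)
    (q4 : R →+* ZMod 4) (q3 : R →+* ZMod 3) (n : ℕ) (hn : Odd n) :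
    ∃ D : groupCohomology (kk k (Gp p)) (n+1) →ₗ[k] groupCohomology (kk k (Matrix.SpecialLinearGroup (Fin 2) R)) (n+1+1),
    Function.Surjective D ∧ (∀ z, D z = 0 ↔ ∃ u, z = (tr k (Gp p).subtype (n+1)).hom u) := by
  obtain ⟨r4, h4⟩ := exists_r4 p ip hip q4
  obtain ⟨r3', h3⟩ := exists_r3 p ip hip q3
  have hF3 := F3 (k := k) (phi' p ip hip) r4 h4 r3' h3 n hn
  have T := amalgam_p ip hR hp hip
  have hc : (phi R).comp (Gp p).subtype = (phi' p ip hip).comp (bhom p ip hip) := MonoidHom.ext T.comm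
  obtain ⟨D, hD0, hD⟩ : ∃ D : groupCohomology (kk k (Gp p)) (n+1) →ₗ[k] groupCohomology (kk k (Matrix.SpecialLinearGroup (Fin 2) R)) (n+1+1),
      (∀ z, D z = 0 ↔ ∃ u v, z = (tr k (Gp p).subtype (n+1)).hom u - (tr k (bhom p ip hip) (n+1)).hom v) ∧
      (∀ x, (tr k (phi R) (n+1+1)).hom x = 0 → (tr k (phi' p ip hip) (n+1+1)).hom x = 0 → ∃ z, D z = x) :=
    mv_delta T _ rfl hc (kk k _) (n+1)
  have hev : Even (n+1) := hn.add_one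
  refine ⟨D, fun x => hD x (odd_SLZ _ hev _) (odd_SLZ _ hev _), fun z => ?_⟩
  rw [hD0]
  constructor
  · rintro ⟨u, v, rfl⟩
    obtain ⟨w, rfl⟩ := hF3 v
    refine ⟨u - (tr k (phi R) (n+1)).hom w, ?_⟩
    rw [tr_comp _ _ _ rfl, map_sub, tr_comp _ _ _ hc]
  · rintro ⟨u, rfl⟩
    exact ⟨u, 0, by rw [map_zero, sub_zero]⟩

set_option maxHeartbeats 2000000 in
theorem F2 (hR : ∀ r : R, ∃ n : ℕ, (p : R) ^ n * r ∈ Zs R) (hp : p.Prime) (hip : p * ip = 1)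
    (q4 : R →+* ZMod 4) (q3 : R →+* ZMod 3)
    (hs : ∀ g, act g o = o ↔ g ∈ Gp p)
    (ht : ∀ x, ∃ g, act g o = x) (n : ℕ) (hn : Odd n) :
    Nonempty (groupCohomology (kk k (Matrix.SpecialLinearGroup (Fin 2) R)) (n+1+1) ≃ₗ[k] groupCohomology (Nr k act) (n+1)) := by
  obtain ⟨D, hDs, hDk⟩ := F2a (k := k) ip hR hp hip q4 q3 n hn
  have ho : ∀ l : Gp p, act ((Gp p).subtype l) o = o := fun l => (hs _).2 l.2
  have hsb : Function.Bijective (groupCohomology.map (Gp p).subtype (evR (k := k) act (Gp p).subtype o ho) (n+1)).hom := ev_bij act (Gp p).subtype o Subtype.val_injective ho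
    (fun g hg => ⟨⟨g, (hs g).1 hg⟩, rfl⟩) ht (n+1)
  have S := ses_MN (k := k) act o
  exact lin_aux D (groupCohomology.map (Gp p).subtype (evR (k := k) act (Gp p).subtype o ho) (n+1)).hom (cf (diffR (k := k) act) (n+1)).hom
    (cf (constR act) (n+1)).hom (tr k (Gp p).subtype (n+1)).hom hDs hsb
    (fun z => S.ex3 _ z (odd_SLZ _ hn.add_one _)) (fun u => map_map _ _ _ _ _ _ rfl (fun _ => rfl) (n+1) u) hDk
    (fun u => S.fg _ u) (fun m hm => S.ex2 _ m hm)

end F2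
end SL2coh

end

section
open CategoryTheory
namespace SL2coh
open groupCohomology

section comb
variable {k : Type} [CommRing k] {P : Type} (σ : Equiv.Perm P) (q : ℕ)

/-- a weight function summing to one over every free orbit -/
theorem wexists (hq : q.Prime) (hσ : σ ^ q = 1) : ∃ w : P → k, ∀ x, (σ x ≠ x → ∑ j ∈ Finset.range q, w ((σ ^ j) x) = 1) ∧ (σ x = x → w x = 0) := by
  classical
  let s := Equiv.Perm.SameCycle.setoid σ
  refine ⟨fun x => if σ x ≠ x ∧ (Quotient.mk s x).out = x then 1 else 0, fun x => ⟨fun hx => ?_, fun hx => by simp [hx]⟩⟩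
  have hper : ∀ y, Function.IsPeriodicPt σ q y := fun y => by
    change (σ^[q]) y = y
    rw [← Equiv.Perm.coe_pow, hσ]; rfl
  have hmp : Function.minimalPeriod σ x = q := by
    rcases (Nat.dvd_prime hq).1 (hper x).minimalPeriod_dvd with h | h
    · exact absurd (Function.minimalPeriod_eq_one_iff_isFixedPt.1 h) hx
    · exact h
  have hsc : σ.SameCycle x (Quotient.mk s x).out := (Quotient.exact (Quotient.out_eq (Quotient.mk s x))).symm
  obtain ⟨i, hi⟩ := hsc
  obtain ⟨j, hj, hjx⟩ : ∃ j < q, (σ ^ j) x = (Quotient.mk s x).out := by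
    refine ⟨(i % q).toNat, ?_, ?_⟩
    · have := Int.emod_lt_of_pos i (by exact_mod_cast hq.pos : (0:ℤ) < q)
      have := Int.emod_nonneg i (by exact_mod_cast hq.ne_zero : (q:ℤ) ≠ 0)
      omega
    · rw [← hi, ← zpow_natCast, Int.toNat_of_nonneg (Int.emod_nonneg i (by exact_mod_cast hq.ne_zero))]
      conv_rhs => rw [← Int.emod_add_mul_ediv i q, zpow_add, zpow_mul, zpow_natCast, hσ, one_zpow, mul_one]
  rw [Finset.sum_eq_single_of_mem j (Finset.mem_range.2 hj)]
  · have h1 : Quotient.mk s ((σ ^ j) x) = Quotient.mk s x := Quotient.sound (⟨-j, by simp⟩ : σ.SameCycle _ _)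
    have h2 : σ ((σ ^ j) x) ≠ (σ ^ j) x := by
      intro h
      apply hx
      apply (σ ^ j).injective
      rw [← Equiv.Perm.mul_apply, ← pow_succ, pow_succ', Equiv.Perm.mul_apply, h]
    exact if_pos ⟨h2, by rw [h1, hjx]⟩
  · intro l hl hlj
    refine if_neg ?_
    rintro ⟨-, h⟩
    have h1 : Quotient.mk s ((σ ^ l) x) = Quotient.mk s x := Quotient.sound (⟨-l, by simp⟩ : σ.SameCycle _ _)
    rw [h1, ← hjx] at h
    apply hlj
    have := Function.iterate_injOn_Iio_minimalPeriod (f := σ) (x := x)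
    rw [hmp] at this
    exact this (Finset.mem_range.1 hl) hj (by simpa [Equiv.Perm.coe_pow] using h.symm)

variable [IsDomain k] [CharZero k]

theorem inv_const (hq : q.Prime) (hσ : σ ^ q = 1) (d : Ns k P) (hd : ∀ x y, d.1 (σ x) (σ y) = d.1 x y) (x : P) : d.1 (σ x) x = 0 := by
  have h0 : ∀ y, d.1 y y = 0 := fun y => by have := d.2 y y y; simpa using this
  have h1 : ∀ j : ℕ, d.1 ((σ ^ j) x) x = j * d.1 (σ x) x := by
    intro j
    induction j with
    | zero => simp [h0]
    | succ j ih =>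
      have e : (σ ^ (j+1)) x = σ ((σ ^ j) x) := by rw [pow_succ', Equiv.Perm.mul_apply]
      rw [e, ← d.2 _ (σ x) _, hd, ih]; push_cast; ring
  have := h1 q
  rw [hσ, Equiv.Perm.one_apply, h0] at this
  rcases mul_eq_zero.1 this.symm with h | h
  · exact absurd (Nat.cast_eq_zero.1 h) hq.ne_zero
  · exact h

theorem inv_fun (hq : q.Prime) (hσ : σ ^ q = 1) (d : Ns k P) (hd : ∀ x y, d.1 (σ x) (σ y) = d.1 x y) (o x : P) (j : ℕ) :
    d.1 ((σ ^ j) x) o = d.1 x o := by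
  induction j with
  | zero => rfl
  | succ j ih =>
    have e : (σ ^ (j+1)) x = σ ((σ ^ j) x) := by rw [pow_succ', Equiv.Perm.mul_apply]
    rw [e, ← d.2 _ ((σ ^ j) x) _, inv_const σ q hq hσ d hd, zero_add, ih]

theorem norm_gen (hq : q.Prime) (hσ : σ ^ q = 1) (d : Ns k P) (hd : ∀ x y, d.1 (σ x) (σ y) = d.1 x y) (o : P)
    (c : P → k) (hc : ∀ x, σ x = x → d.1 x o = q * c x) :
    ∃ e : Ns k P, ∀ x y, d.1 x y = ∑ j ∈ Finset.range q, e.1 ((σ ^ j) x) ((σ ^ j) y) := by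
  classical
  obtain ⟨w, hw⟩ := wexists (k := k) σ q hq hσ
  have hG : ∃ G : P → k, ∀ x, d.1 x o = ∑ j ∈ Finset.range q, G ((σ ^ j) x) := by
    refine ⟨fun x => d.1 x o * w x + if σ x = x then c x else 0, fun x => ?_⟩
    by_cases hx : σ x = x
    · have h1 : ∀ j : ℕ, (σ ^ j) x = x := fun j => by
        induction j with
        | zero => rfl
        | succ j ih => rw [pow_succ, Equiv.Perm.mul_apply, hx, ih]
      simp only [h1, (hw x).2 hx, if_pos hx]
      rw [Finset.sum_const, Finset.card_range, hc x hx]; simp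
    · have h2 : ∀ j : ℕ, σ ((σ ^ j) x) ≠ (σ ^ j) x := fun j h => by
        apply hx
        apply (σ ^ j).injective
        rw [← Equiv.Perm.mul_apply, ← pow_succ, pow_succ', Equiv.Perm.mul_apply, h]
      simp only [if_neg (h2 _), add_zero, inv_fun σ q hq hσ d hd]
      rw [← Finset.mul_sum, (hw x).1 hx, mul_one]
  obtain ⟨G, hG⟩ := hG
  refine ⟨⟨fun x y => G x - G y, fun x y z => by ring⟩, fun x y => ?_⟩
  change _ = ∑ j ∈ Finset.range q, (G ((σ ^ j) x) - G ((σ ^ j) y))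
  rw [Finset.sum_sub_distrib, ← hG, ← hG, ← d.2 x y o]; ring

theorem norm_free (hq : q.Prime) (hσ : σ ^ q = 1) (o : P) (hf : ∀ x, σ x ≠ x) (d : Ns k P) (hd : ∀ x y, d.1 (σ x) (σ y) = d.1 x y) :
    ∃ e : Ns k P, ∀ x y, d.1 x y = ∑ j ∈ Finset.range q, e.1 ((σ ^ j) x) ((σ ^ j) y) :=
  norm_gen σ q hq hσ d hd o 0 (fun x hx => absurd hx (hf x))

theorem norm_two (hq : q.Prime) (hσ : σ ^ q = 1) (x1 x2 : P) (hf : ∀ x, σ x = x ↔ x = x1 ∨ x = x2) (d : Ns k P)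
    (hd : ∀ x y, d.1 (σ x) (σ y) = d.1 x y) :
    (q : k) ∣ d.1 x1 x2 ↔ ∃ e : Ns k P, ∀ x y, d.1 x y = ∑ j ∈ Finset.range q, e.1 ((σ ^ j) x) ((σ ^ j) y) := by
  classical
  constructor
  · rintro ⟨c, hc⟩
    refine norm_gen σ q hq hσ d hd x2 (fun x => if x = x1 then c else 0) (fun x hx => ?_)
    have h0 : ∀ y, d.1 y y = 0 := fun y => by have := d.2 y y y; simpa using this
    by_cases h : x = x1
    · subst h; simp [hc]
    · rcases (hf x).1 hx with h' | rfl
      · exact absurd h' h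
      · simp [h0, h]
  · rintro ⟨e, he⟩
    have h1 : ∀ x, σ x = x → ∀ j : ℕ, (σ ^ j) x = x := fun x hx j => by
        induction j with
        | zero => rfl
        | succ j ih => rw [pow_succ, Equiv.Perm.mul_apply, hx, ih]
    rw [he]
    simp only [h1 x1 ((hf x1).2 (Or.inl rfl)), h1 x2 ((hf x2).2 (Or.inr rfl))]
    exact ⟨e.1 x1 x2, by simp⟩

theorem surj_two (x1 x2 : P) (hne : x1 ≠ x2) (h1 : σ x1 = x1) (c : k) :
    ∃ d : Ns k P, (∀ x y, d.1 (σ x) (σ y) = d.1 x y) ∧ d.1 x1 x2 = c := by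
  classical
  refine ⟨⟨fun x y => (if x = x1 then c else 0) - (if y = x1 then c else 0), fun x y z => by ring⟩, fun x y => ?_, ?_⟩
  · change (if σ x = x1 then c else 0) - (if σ y = x1 then c else 0) = (if x = x1 then c else 0) - (if y = x1 then c else 0)
    have : ∀ z, σ z = x1 ↔ z = x1 := fun z => ⟨fun h => σ.injective (h.trans h1.symm), fun h => h ▸ h1⟩
    simp only [this]
  · change (if x1 = x1 then c else 0) - (if x2 = x1 then c else 0) = c
    rw [if_pos rfl, if_neg hne.symm, sub_zero]

end comb
end SL2coh

end

section
open CategoryTheory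
namespace SL2coh
open groupCohomology

section cyc
variable {k : Type} [CommRing k]

theorem sum_cy (m : ℕ) [NeZero m] {M : Type} [AddCommMonoid M] (F : Cy m → M) : ∑ g, F g = ∑ j ∈ Finset.range m, F (gen m ^ j) := by
  refine Finset.sum_bij' (fun g _ => ZMod.val (Multiplicative.toAdd g)) (fun j _ => gen m ^ j) (fun g _ => Finset.mem_range.2 (ZMod.val_lt _))
    (fun _ _ => Finset.mem_univ _) (fun g _ => gen_pow m g) (fun j hj => ?_) (fun g _ => by rw [gen_pow])
  have : gen m ^ j = Multiplicative.ofAdd (j : ZMod m) := by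
    rw [gen, ← ofAdd_nsmul, nsmul_one]
  rw [this]
  exact ZMod.val_cast_of_lt (Finset.mem_range.1 hj)

theorem cyc_even (m : ℕ) [NeZero m] (A : Rep.{0} k (Cy m)) (n : ℕ) (hn : Even n) (hn0 : n ≠ 0) :
    ∃ (Z : Submodule k A.V) (π : Z →ₗ[k] groupCohomology A n), Function.Surjective π ∧ (∀ v, v ∈ Z ↔ A.ρ (gen m) v = v) ∧
      ∀ z, π z = 0 ↔ ∃ e : A.V, z.1 = ∑ j ∈ Finset.range m, A.ρ (gen m ^ j) e := by
  haveI : NeZero n := ⟨hn0⟩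
  refine ⟨_, (Rep.FiniteCyclicGroup.groupCohomologyπEven A (gen m) (gen_zpowers m) n hn).hom, piEven_surj A (gen m) (gen_zpowers m) n hn, fun v => ?_, fun z => ?_⟩
  · rw [LinearMap.mem_ker]
    change A.ρ (gen m) v - v = 0 ↔ _
    rw [sub_eq_zero]
  · refine (Rep.FiniteCyclicGroup.groupCohomologyπEven_eq_zero_iff A (gen m) (gen_zpowers m) n hn z).trans ?_
    constructor
    · rintro ⟨e, he⟩
      refine ⟨e, ?_⟩
      rw [← he]
      exact (norm_apply' A e).trans (sum_cy m _)
    · rintro ⟨e, he⟩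
      refine ⟨e, ?_⟩
      rw [he]
      exact (norm_apply' A e).trans (sum_cy m _)

theorem cyc_odd (m : ℕ) [NeZero m] (A : Rep.{0} k (Cy m)) (n : ℕ) (hn : Odd n) :
    ∃ (Z : Submodule k A.V) (π : Z →ₗ[k] groupCohomology A n), Function.Surjective π ∧ (∀ v, v ∈ Z ↔ ∑ j ∈ Finset.range m, A.ρ (gen m ^ j) v = 0) ∧
      ∀ z, π z = 0 ↔ ∃ e : A.V, z.1 = A.ρ (gen m) e - e := by
  refine ⟨_, (Rep.FiniteCyclicGroup.groupCohomologyπOdd A (gen m) (gen_zpowers m) n hn).hom, piOdd_surj A (gen m) (gen_zpowers m) n hn, fun v => ?_, fun z => ?_⟩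
  · rw [LinearMap.mem_ker]
    change A.norm.hom v = 0 ↔ _
    rw [norm_apply', sum_cy]
  · refine (Rep.FiniteCyclicGroup.groupCohomologyπOdd_eq_zero_iff A (gen m) (gen_zpowers m) n hn z).trans ?_
    constructor
    · rintro ⟨e, he⟩
      exact ⟨e, he.symm⟩
    · rintro ⟨e, he⟩
      exact ⟨e, he.symm⟩

theorem two_surj {A B C : Type} [AddCommGroup A] [AddCommGroup B] [AddCommGroup C] [Module k A] [Module k B] [Module k C]
    (f : A →ₗ[k] B) (g : A →ₗ[k] C) (hf : Function.Surjective f) (hg : Function.Surjective g) (h : ∀ a, f a = 0 ↔ g a = 0) : Nonempty (B ≃ₗ[k] C) :=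
  ⟨(LinearMap.quotKerEquivOfSurjective f hf).symm ≪≫ₗ
    (Submodule.quotEquivOfEq _ _ (by ext a; exact h a) ≪≫ₗ LinearMap.quotKerEquivOfSurjective g hg)⟩

variable [IsDomain k] [CharZero k] {K P : Type} [Group K] (act : K →* Equiv.Perm P)

theorem pow_act (g : K) (j : ℕ) (d : Ns k P) (x y : P) : ((Nr k act).ρ (g ^ j) d : Ns k P).1 x y = d.1 (((act g⁻¹) ^ j) x) (((act g⁻¹) ^ j) y) := by
  rw [Nr_apply, ← map_pow, inv_pow]

theorem Nr_sum {ι : Type} (s : Finset ι) (F : ι → Ns k P) (x y : P) : (∑ j ∈ s, F j).1 x y = ∑ j ∈ s, (F j).1 x y := by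
  rw [AddSubmonoidClass.coe_finset_sum, Finset.sum_apply, Finset.sum_apply]

noncomputable def evNs (x y : P) : Ns k P →ₗ[k] k where
  toFun d := d.1 x y
  map_add' _ _ := rfl
  map_smul' _ _ := rfl

theorem sub_two {q : ℕ} (Z : Submodule k (Ns k P)) {H : Type} [AddCommGroup H] [Module k H] (σ : Equiv.Perm P) (hq : q.Prime) (hσ : σ ^ q = 1) (π : Z →ₗ[k] H)
    (hπ : Function.Surjective π) (hZ : ∀ d : Ns k P, d ∈ Z ↔ ∀ x y, d.1 (σ x) (σ y) = d.1 x y)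
    (h : ∀ z, π z = 0 ↔ ∃ e : Ns k P, ∀ x y, z.1.1 x y = ∑ j ∈ Finset.range q, e.1 ((σ ^ j) x) ((σ ^ j) y)) 
    (x1 x2 : P) (hne : x1 ≠ x2) (hf : ∀ x, σ x = x ↔ x = x1 ∨ x = x2) : Nonempty (H ≃ₗ[k] (k ⧸ Ideal.span {(q : k)})) := by
  let g : Z →ₗ[k] (k ⧸ Ideal.span {(q : k)}) := (Submodule.mkQ (Ideal.span {(q : k)})).comp ((evNs x1 x2).comp Z.subtype)
  refine two_surj (A := Z) (B := H) (C := k ⧸ Ideal.span {(q : k)}) π g hπ ?_ ?_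
  · intro c
    obtain ⟨c, rfl⟩ := Submodule.mkQ_surjective _ c
    obtain ⟨d, hd, rfl⟩ := surj_two σ x1 x2 hne ((hf x1).2 (Or.inl rfl)) c
    exact ⟨⟨d, (hZ d).2 hd⟩, rfl⟩
  · intro z
    rw [h, ← norm_two σ q hq hσ x1 x2 hf z.1 ((hZ _).1 z.2), ← Ideal.mem_span_singleton]
    exact (Submodule.Quotient.mk_eq_zero _).symm

theorem sub_free {q : ℕ} (Z : Submodule k (Ns k P)) {H : Type} [AddCommGroup H] [Module k H] (σ : Equiv.Perm P) (hq : q.Prime) (hσ : σ ^ q = 1) (π : Z →ₗ[k] H)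
    (hπ : Function.Surjective π) (hZ : ∀ d : Ns k P, d ∈ Z ↔ ∀ x y, d.1 (σ x) (σ y) = d.1 x y)
    (h : ∀ z, π z = 0 ↔ ∃ e : Ns k P, ∀ x y, z.1.1 x y = ∑ j ∈ Finset.range q, e.1 ((σ ^ j) x) ((σ ^ j) y)) 
    (o : P) (hf : ∀ x, σ x ≠ x) (y : H) : y = 0 := by
  obtain ⟨z, rfl⟩ := hπ y
  rw [h]
  exact norm_free σ q hq hσ o hf z.1 ((hZ _).1 z.2)

theorem H3 (f : Cy 3 →* K) (n : ℕ) (hn : Even n) (hn0 : n ≠ 0) :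
    ∃ (Z : Submodule k (Ns k P)) (π : Z →ₗ[k] groupCohomology (Rep.res f (Nr k act)) n), Function.Surjective π ∧
      (∀ d : Ns k P, d ∈ Z ↔ ∀ x y, d.1 (act (f (gen 3))⁻¹ x) (act (f (gen 3))⁻¹ y) = d.1 x y) ∧
      (∀ z, π z = 0 ↔ ∃ e : Ns k P, ∀ x y, z.1.1 x y = ∑ j ∈ Finset.range 3, e.1 (((act (f (gen 3))⁻¹) ^ j) x) (((act (f (gen 3))⁻¹) ^ j) y)) := by
  obtain ⟨Z, π, h1, h2, h3⟩ := cyc_even 3 (Rep.res f (Nr k act)) n hn hn0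
  refine ⟨Z, π, h1, fun d => (h2 d).trans ?_, fun z => (h3 z).trans ?_⟩
  · constructor
    · intro h x y
      exact congrFun (congrFun (congrArg Subtype.val h) x) y
    · intro h
      exact Subtype.ext (funext fun x => funext fun y => h x y)
  · refine exists_congr fun e => ?_
    have key : ∀ x y, (∑ j ∈ Finset.range 3, (Rep.res f (Nr k act)).ρ (gen 3 ^ j) e : Ns k P).1 x y = ∑ j ∈ Finset.range 3, e.1 (((act (f (gen 3))⁻¹) ^ j) x) (((act (f (gen 3))⁻¹) ^ j) y) := by
      intro x y
      rw [Nr_sum]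
      refine Finset.sum_congr rfl fun j _ => ?_
      change ((Nr k act).ρ (f (gen 3 ^ j)) e : Ns k P).1 x y = _
      rw [map_pow, pow_act]
    constructor
    · intro h x y
      rw [← key]
      exact congrFun (congrFun (congrArg Subtype.val h) x) y
    · intro h
      exact Subtype.ext (funext fun x => funext fun y => (h x y).trans (key x y).symm)

end cyc
end SL2coh

end

section
open CategoryTheory
namespace SL2coh
open groupCohomology

section tw
variable {k : Type} [CommRing k]

def eps : Cy 4 →* ℤˣ := cyc 4 (-1) (by decide)

theorem eps_i24 : ∀ l, eps (i24 l) = 1 := by decide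
theorem eps_gen : eps (gen 4) = -1 := by decide
theorem cases_i24 : ∀ g : Cy 4, ∃ l, g = i24 l ∨ g = i24 l * gen 4 := by decide

noncomputable abbrev twist (A : Rep.{0} k (Cy 4)) : Rep.{0} k (Cy 4) :=
  Rep.of (X := A.V) ({ toFun := fun g => (eps g : ℤ) • A.ρ g
                       map_one' := by simp
                       map_mul' := fun g h => by
                         refine LinearMap.ext fun v => ?_
                         change ((eps (g * h) : ℤˣ) : ℤ) • A.ρ (g * h) v = (eps g : ℤ) • A.ρ g ((eps h : ℤ) • A.ρ h v)
                         rw [map_zsmul, smul_smul, map_mul, map_mul, Units.val_mul]; rfl } : Representation k (Cy 4) A.V)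

theorem twist_apply (A : Rep.{0} k (Cy 4)) (g : Cy 4) (v : A.V) : (twist A).ρ g v = ((eps g : ℤ) • A.ρ g v : A.V) := rfl

theorem hom_of_gen (m : ℕ) [NeZero m] {A B : Rep.{0} k (Cy m)} (L : A.V →ₗ[k] B.V) (h : ∀ v, L (A.ρ (gen m) v) = B.ρ (gen m) (L v)) (g : Cy m) (v : A.V) :
    L (A.ρ g v) = B.ρ g (L v) := by
  have : ∀ j : ℕ, ∀ v, L (A.ρ (gen m ^ j) v) = B.ρ (gen m ^ j) (L v) := by
    intro j
    induction j with
    | zero => intro v; simp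
    | succ j ih => intro v; rw [pow_succ, map_mul, map_mul]; exact (ih _).trans (congrArg _ (h v))
  rw [← gen_pow m g]
  exact this _ v

noncomputable def toTwL (A : Rep.{0} k (Cy 4)) : (Rep.coind i24 (Rep.res i24 A)).V →ₗ[k] A.V where
  toFun f := (f.1 (gen 4) : A.V) - A.ρ (gen 4) (f.1 1 : A.V)
  map_add' f g := by
    change ((f.1 (gen 4) : A.V) + (g.1 (gen 4) : A.V)) - A.ρ (gen 4) ((f.1 1 : A.V) + (g.1 1 : A.V)) = _
    rw [map_add]; abel
  map_smul' c f := by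
    change (c • (f.1 (gen 4) : A.V)) - A.ρ (gen 4) (c • (f.1 1 : A.V)) = c • _
    rw [map_smul, smul_sub]

theorem coind_law (A : Rep.{0} k (Cy 4)) (f : (Rep.coind i24 (Rep.res i24 A)).V) (l : Cy 2) (g : Cy 4) :
  (f.1 (i24 l * g) : A.V) = A.ρ (i24 l) (f.1 g : A.V) := f.2 l g

noncomputable def toTw (A : Rep.{0} k (Cy 4)) : Rep.coind i24 (Rep.res i24 A) ⟶ twist A :=
  Rep.ofHom ⟨toTwL A, fun g => LinearMap.ext fun v => hom_of_gen 4 (A := Rep.coind i24 (Rep.res i24 A)) (B := twist A) (toTwL A) (fun f => by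
    change (f.1 (gen 4 * gen 4) : A.V) - A.ρ (gen 4) (f.1 (1 * gen 4) : A.V) = ((eps (gen 4) : ℤˣ) : ℤ) • A.ρ (gen 4) ((f.1 (gen 4) : A.V) - A.ρ (gen 4) (f.1 1 : A.V))
    have e : gen 4 * gen 4 = i24 (gen 2) * 1 := by decide
    have e' : i24 (gen 2) = gen 4 * gen 4 := by decide
    have e2 : (f.1 (gen 4 * gen 4) : A.V) = A.ρ (gen 4) (A.ρ (gen 4) (f.1 1 : A.V)) := by
      refine (congrArg f.1 e).trans ((coind_law A f _ _).trans ?_)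
      rw [e', map_mul]; rfl
    rw [e2, eps_gen, one_mul, map_sub]
    simp) g v⟩

theorem ses_tw (A : Rep.{0} k (Cy 4)) : SES (toCoind i24 A) (toTw A) := by
  refine SES.of ?_ ?_ ?_ ?_
  · intro a
    change A.ρ (gen 4) a - A.ρ (gen 4) (A.ρ 1 a) = 0
    simp
  · intro a b h
    have h : A.ρ 1 a = A.ρ 1 b := congrFun (congrArg Subtype.val h) 1
    simpa using h
  · intro w
    refine ⟨⟨fun g => (if eps g = -1 then A.ρ (g * (gen 4)⁻¹) w else 0 : A.V), fun l g => ?_⟩, ?_⟩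
    · change (if eps (i24 l * g) = -1 then A.ρ (i24 l * g * (gen 4)⁻¹) w else 0 : A.V) = A.ρ (i24 l) (if eps g = -1 then A.ρ (g * (gen 4)⁻¹) w else 0 : A.V)
      rw [map_mul eps, eps_i24, one_mul]
      split_ifs with h
      · rw [mul_assoc, map_mul]; rfl
      · rw [map_zero]
    · change (if eps (gen 4) = -1 then A.ρ (gen 4 * (gen 4)⁻¹) w else 0 : A.V) - A.ρ (gen 4) (if eps 1 = -1 then A.ρ (1 * (gen 4)⁻¹) w else 0 : A.V) = w
      rw [if_pos eps_gen, if_neg (by decide)]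
      simp
  · intro f hf
    have hf : (f.1 (gen 4) : A.V) - A.ρ (gen 4) (f.1 1 : A.V) = 0 := hf
    refine ⟨(f.1 1 : A.V), Subtype.ext (funext fun g => ?_)⟩
    change A.ρ g (f.1 1 : A.V) = (f.1 g : A.V)
    obtain ⟨l, rfl | rfl⟩ := cases_i24 g
    · refine Eq.trans ?_ ((coind_law A f l 1).symm.trans (congrArg f.1 (mul_one _)))
      rfl
    · rw [coind_law, sub_eq_zero.1 hf, map_mul]; rfl

theorem ker4_gen (A : Rep.{0} k (Cy 4)) (n : ℕ) (hv : ∀ z : groupCohomology (Rep.res i24 A) n, z = 0) :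
    ∃ D : groupCohomology (twist A) n →ₗ[k] LinearMap.ker (rs i24 A (n+1)).hom, Function.Bijective D := by
  have S := ses_tw A
  have hk : ∀ z, (rs i24 A (n+1)).hom (S.d n z) = 0 := fun z => by
    rw [← sh_toCoind, S.df, map_zero]
  refine ⟨(S.d n).codRestrict _ hk, ?_, ?_⟩
  · rw [injective_iff_map_eq_zero]
    intro z hz
    obtain ⟨y, rfl⟩ := S.ex3 n z (congrArg Subtype.val hz)
    have : y = 0 := (sh_bij i24 i24_inj n _).1 ((hv _).trans (map_zero _).symm)
    rw [this, map_zero]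
  · rintro ⟨x, hx⟩
    have hx : (rs i24 A (n+1)).hom x = 0 := hx
    rw [← sh_toCoind] at hx
    obtain ⟨z, rfl⟩ := S.ex1 n x ((sh_bij i24 i24_inj (n+1) _).1 (hx.trans (map_zero _).symm))
    exact ⟨z, rfl⟩

variable [IsDomain k] [CharZero k] {K P : Type} [Group K] (act : K →* Equiv.Perm P)

theorem H4 (f : Cy 4 →* K) (hf : (act (f (gen 4))⁻¹) ^ 2 = 1) (n : ℕ) (hn : Odd n) 
   (hv : ∀ z : groupCohomology (Rep.res i24 (Rep.res f (Nr k act))) n, z = 0) :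
    ∃ (Z : Submodule k (Ns k P)) (π : Z →ₗ[k] LinearMap.ker (rs i24 (Rep.res f (Nr k act)) (n+1)).hom), Function.Surjective π ∧
      (∀ d : Ns k P, d ∈ Z ↔ ∀ x y, d.1 (act (f (gen 4))⁻¹ x) (act (f (gen 4))⁻¹ y) = d.1 x y) ∧
      (∀ z, π z = 0 ↔ ∃ e : Ns k P, ∀ x y, z.1.1 x y = ∑ j ∈ Finset.range 2, e.1 (((act (f (gen 4))⁻¹) ^ j) x) (((act (f (gen 4))⁻¹) ^ j) y)) := by
  obtain ⟨D, hD⟩ := ker4_gen (Rep.res f (Nr k act)) n hv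
  obtain ⟨Z, π, h1, h2, h3⟩ := cyc_odd 4 (twist (Rep.res f (Nr k act))) n hn
  have key : ∀ (j : ℕ) (d : Ns k P) x y, ((twist (Rep.res f (Nr k act))).ρ (gen 4 ^ j) d : Ns k P).1 x y = (-1) ^ j * d.1 (((act (f (gen 4))⁻¹) ^ j) x) (((act (f (gen 4))⁻¹) ^ j) y) := by
    intro j d x y
    rw [twist_apply, map_pow eps, eps_gen]
    change ((((-1 : ℤˣ) ^ j : ℤˣ) : ℤ) • ((Nr k act).ρ (f (gen 4 ^ j)) d : Ns k P)).1 x y = _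
    rw [map_pow f]
    change (((-1 : ℤˣ) ^ j : ℤˣ) : ℤ) • ((Nr k act).ρ (f (gen 4) ^ j) d : Ns k P).1 x y = _
    rw [pow_act]
    simp
  refine ⟨Z, D ∘ₗ π, hD.2.comp h1, fun d => (h2 d).trans ?_, fun z => ?_⟩
  · have e : ∀ x y, (∑ j ∈ Finset.range 4, (twist (Rep.res f (Nr k act))).ρ (gen 4 ^ j) d : Ns k P).1 x y = 2 * (d.1 x y - d.1 (act (f (gen 4))⁻¹ x) (act (f (gen 4))⁻¹ y)) := by
      intro x y
      rw [Nr_sum]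
      simp only [key]
      rw [Finset.sum_range_succ, Finset.sum_range_succ, Finset.sum_range_succ, Finset.sum_range_succ, pow_succ (act (f (gen 4))⁻¹) 2, hf]
      simp
      ring
    constructor
    · intro h x y
      have h' := (e x y).symm.trans (congrFun (congrFun (congrArg Subtype.val h) x) y)
      rcases mul_eq_zero.1 h' with h'' | h''
      · exact absurd h'' two_ne_zero
      · exact (sub_eq_zero.1 h'').symm
    · intro h
      refine Subtype.ext (funext fun x => funext fun y => (e x y).trans ?_)
      rw [h x y, sub_self, mul_zero]; rfl
  · rw [LinearMap.comp_apply, map_eq_zero_iff D hD.1, h3]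
    have e : ∀ (d : Ns k P) x y, ((twist (Rep.res f (Nr k act))).ρ (gen 4) d - d : Ns k P).1 x y = ∑ j ∈ Finset.range 2, (-d).1 (((act (f (gen 4))⁻¹) ^ j) x) (((act (f (gen 4))⁻¹) ^ j) y) := by
      intro d x y
      have := key 1 d x y
      rw [pow_one, pow_one] at this
      change ((twist (Rep.res f (Nr k act))).ρ (gen 4) d : Ns k P).1 x y - d.1 x y = ∑ j ∈ Finset.range 2, -(d.1 (((act (f (gen 4))⁻¹) ^ j) x) (((act (f (gen 4))⁻¹) ^ j) y))
      rw [this, Finset.sum_range_succ, Finset.sum_range_one]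
      simp
      ring
    constructor
    · rintro ⟨d, hd⟩
      refine ⟨(-d : Ns k P), fun x y => ?_⟩
      rw [← e, hd]
    · rintro ⟨d, hd⟩
      refine ⟨(-d : Ns k P), Subtype.ext (funext fun x => funext fun y => (hd x y).trans ?_)⟩
      rw [e, neg_neg]

end tw
end SL2coh

end

section
open CategoryTheory
namespace SL2coh
open groupCohomology

section ker6
variable {k : Type} [CommRing k]

theorem i3r3 : ∀ g : Cy 6, ∃ l, g = i3 (r3 g) * i26 l := by decide
theorem r3i26 : r3.comp i26 = 1 := cyc_ext 2 (by decide)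

noncomputable def infl6 (A : Rep.{0} k (Cy 6)) (htr : ∀ l v, A.ρ (i26 l) v = v) : Rep.res r3 (Rep.res i3 A) ⟶ A :=
  Rep.ofHom ⟨LinearMap.id, fun g => LinearMap.ext fun v => by
    change A.ρ (i3 (r3 g)) v = A.ρ g v
    obtain ⟨l, hl⟩ := i3r3 g
    conv_rhs => rw [hl, map_mul]
    exact congrArg _ (htr l v).symm⟩

theorem ker6_gen (A : Rep.{0} k (Cy 6)) (htr : ∀ l v, A.ρ (i26 l) v = v) (n : ℕ) :
    ∃ D : LinearMap.ker (rs i26 A (n+1)).hom →ₗ[k] groupCohomology (Rep.res i3 A) (n+1), Function.Bijective D := by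
  refine ⟨(rs i3 A (n+1)).hom ∘ₗ Submodule.subtype _, ?_, ?_⟩
  · rw [injective_iff_map_eq_zero]
    rintro ⟨z, hz⟩ h
    exact Subtype.ext (zero_of_C2_C3 A (n+1) z hz h)
  · intro w
    refine ⟨⟨(groupCohomology.map r3 (infl6 A htr) (n+1)).hom w, ?_⟩, ?_⟩
    · refine (map_map (A := Rep.res i3 A) (C := Rep.res i26 A) r3 i26 (infl6 A htr) (𝟙 _) 1 
        (Rep.ofHom ⟨LinearMap.id, fun g => LinearMap.ext fun v => ?_⟩) r3i26.symm (fun _ => rfl) (n+1) w).trans (map_one_zero _ n w)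
      change A.ρ (i3 1) v = A.ρ (i26 g) v
      rw [htr, map_one, map_one]; rfl
    · refine (map_map (A := Rep.res i3 A) (C := Rep.res i3 A) r3 i3 (infl6 A htr) (𝟙 _) (MonoidHom.id _) (𝟙 _) r3i3.symm (fun _ => rfl) (n+1) w).trans ?_
      exact cf_id _ _ w

end ker6

section conj
variable {k : Type} [CommRing k] {G : Type} [Group G]

def cj (g : G) : G →* G := (MulAut.conj g⁻¹).toMonoidHom
theorem cj_apply (g h : G) : cj g h = g⁻¹ * h * g := by simp [cj]

noncomputable def cjR (g : G) (A : Rep.{0} k G) : Rep.res (cj g) A ⟶ A :=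
  Rep.ofHom ⟨A.ρ g, fun h => LinearMap.ext fun v => by
    change A.ρ g (A.ρ (cj g h) v) = A.ρ h (A.ρ g v)
    rw [cj_apply, ← Module.End.mul_apply, ← map_mul, ← Module.End.mul_apply, ← map_mul]
    congr 2; group⟩

theorem conj_triv (g : G) (n : ℕ) : ∀ (A : Rep.{0} k G) (x : groupCohomology A n), (groupCohomology.map (cj g) (cjR g A) n).hom x = x := by
  induction n with
  | zero =>
    intro A x
    apply h0_inj
    rw [h0_nat]
    exact h0_inv A x g
  | succ n ih =>
    intro A x
    obtain ⟨X, hX, W, rfl, h2⟩ := exists_shift A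
    have hvI : Subsingleton (groupCohomology X.X₂ (n+1)) := by rw [h2]; exact vanish_bot W n
    obtain ⟨z, rfl⟩ := les1 hX n x (Subsingleton.elim _ _)
    have := delta_nat (cj g) hX hX (cjR g _) (cjR g _) (cjR g _) (fun v => (X.f.hom.isIntertwining _ _ g v).symm) (fun v => (X.g.hom.isIntertwining _ _ g v).symm) n z
    rw [ih] at this
    exact this

variable {C P : Type} [Group C] (γ : C →* G) (act : G →* Equiv.Perm P) 

noncomputable def ctR (hc : ∀ c g, g * γ c = γ c * g) (g : G) (A : Rep.{0} k G) : Rep.res γ A ⟶ Rep.res γ A :=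
  Rep.ofHom ⟨A.ρ g, fun h => LinearMap.ext fun v => by
    change A.ρ g (A.ρ (γ h) v) = A.ρ (γ h) (A.ρ g v)
    rw [← Module.End.mul_apply, ← map_mul, hc, map_mul]; rfl⟩

theorem ct_triv (hc : ∀ c g, g * γ c = γ c * g) (g : G) (A : Rep.{0} k G) (n : ℕ) (x : groupCohomology A n) :
    (cf (ctR γ hc g A) n).hom ((rs γ A n).hom x) = (rs γ A n).hom x := by
  have e : (cj g).comp γ = γ := MonoidHom.ext fun c => by
    rw [MonoidHom.comp_apply, cj_apply, mul_assoc, ← hc]; simp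
  conv_rhs => rw [← conj_triv g n A x]
  have h1 := map_map (C := Rep.res γ A) γ (MonoidHom.id C) (𝟙 (Rep.res γ A)) (ctR γ hc g A) γ (ctR γ hc g A) rfl (fun _ => rfl) n x
  have h2 := map_map (C := Rep.res γ A) (cj g) γ (cjR g A) (𝟙 (Rep.res γ A)) γ (ctR γ hc g A) e.symm (fun _ => rfl) n x
  exact h1.trans h2.symm

noncomputable def ev2 (ht : ∀ c, act (γ c) = 1) (x y : P) : Rep.res γ (Nr k act) ⟶ kk k C :=
  Rep.ofHom ⟨evNs x y, fun c => LinearMap.ext fun (d : Ns k P) => by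
    change d.1 (act (γ c)⁻¹ x) (act (γ c)⁻¹ y) = d.1 x y
    rw [map_inv, ht]; rfl⟩

open Classical in
noncomputable def io2 (ht : ∀ c, act (γ c) = 1) (x : P) : kk k C ⟶ Rep.res γ (Nr k act) :=
  Rep.ofHom ⟨{ toFun := fun c => (⟨fun a b => (if a = x then c else 0) - (if b = x then c else 0), fun _ _ _ => by ring⟩ : Ns k P)
               map_add' := fun c d => Subtype.ext (funext fun a => funext fun b => by
                 change (if a = x then c + d else 0) - (if b = x then c + d else 0) = ((if a = x then c else 0) - (if b = x then c else 0)) + ((if a = x then d else 0) - (if b = x then d else 0))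
                 split_ifs <;> ring)
               map_smul' := fun r c => Subtype.ext (funext fun a => funext fun b => by
                 change (if a = x then r * c else 0) - (if b = x then r * c else 0) = r * ((if a = x then c else 0) - (if b = x then c else 0))
                 split_ifs <;> ring) }, fun c => LinearMap.ext fun r => by
    refine Subtype.ext (funext fun a => funext fun b => ?_)
    change (if a = x then r else 0) - (if b = x then r else 0) = (if act (γ c)⁻¹ a = x then r else 0) - (if act (γ c)⁻¹ b = x then r else 0)
    rw [map_inv, ht]; rfl⟩

theorem C2_zero [IsDomain k] [CharZero k] [Finite P] (hc : ∀ c g, g * γ c = γ c * g) (ht : ∀ c, act (γ c) = 1) (o : P)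
    (hinv : ∀ (H : Type) [AddCommGroup H] (d : P → P → H), (∀ x y z, d x y + d y z = d x z) → (∀ g x y, d (act g x) (act g y) = d x y) → ∀ x y, d x y = 0)
    (n : ℕ) (x : groupCohomology (Nr k act) n) : (rs γ (Nr k act) n).hom x = 0 := by
  classical
  have := Fintype.ofFinite P
  have hd := hinv (groupCohomology (kk k C) n) (fun a b => (cf (ev2 γ act ht a b) n).hom ((rs γ (Nr k act) n).hom x)) (fun a b c => by
      rw [← LinearMap.add_apply, ← ModuleCat.hom_add, ← cf_add]
      congr 3
      refine hom_ext' fun d => ?_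
      exact d.2 a b c) (fun g a b => by
      conv_rhs => rw [← ct_triv γ hc g⁻¹, cf_comp]
      congr 3
      refine hom_ext' fun d => ?_
      change d.1 (act g a) (act g b) = d.1 (act g⁻¹⁻¹ a) (act g⁻¹⁻¹ b)
      rw [inv_inv])
  have h1 : 𝟙 (Rep.res γ (Nr k act)) = ∑ a : P, ev2 γ act ht a o ≫ io2 γ act ht a := by
    refine hom_ext' fun d => ?_
    rw [sum_hom_apply]
    refine Subtype.ext (funext fun a => funext fun b => ?_)
    have e : (∑ i, (ev2 γ act ht i o ≫ io2 γ act ht i).hom d : Ns k P).1 a b = ∑ i, ((if a = i then d.1 i o else 0) - (if b = i then d.1 i o else 0)) := Nr_sum _ _ _ _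
    refine Eq.trans ?_ e.symm
    rw [Finset.sum_sub_distrib, Finset.sum_ite_eq, Finset.sum_ite_eq, if_pos (Finset.mem_univ _), if_pos (Finset.mem_univ _)]
    change d.1 a b = _
    rw [← d.2 a b o]; ring
  rw [← cf_id _ n ((rs γ (Nr k act) n).hom x), h1, cf_sum]
  refine Finset.sum_eq_zero fun a _ => ?_
  rw [← cf_comp, hd, map_zero]

end conj
end SL2coh

end

section
open CategoryTheory
namespace SL2coh
open groupCohomology

section glue
variable {k : Type} [CommRing k]

section
variable {A B C G : Type} [Group A] [Group B] [Group C] [Group G]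
noncomputable def resEq' (b : C →* B) (β : B →* G) (γ : C →* G) (h : γ = β.comp b) (M : Rep.{0} k G) :
    Rep.res γ M ⟶ Rep.res b (Rep.res β M) :=
  Rep.ofHom ⟨LinearMap.id, fun g => by subst h; rfl⟩

theorem rr_zero (b : C →* B) (β : B →* G) (γ : C →* G) (h : γ = β.comp b) (M : Rep.{0} k G) (n : ℕ)
    (x : groupCohomology (Rep.res β M) n) (hx : (rs b (Rep.res β M) n).hom x = 0) : (rr b β γ h M n).hom x = 0 := by
  have := map_map b (MonoidHom.id C) (𝟙 (Rep.res b (Rep.res β M))) (resEq b β γ h M) b (resEq b β γ h M) rfl (fun _ => rfl) n x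
  refine this.symm.trans ?_
  change (cf (resEq b β γ h M) n).hom ((rs b (Rep.res β M) n).hom x) = 0
  rw [hx, map_zero]

theorem rs_rs_zero (b : C →* B) (β : B →* G) (γ : C →* G) (h : γ = β.comp b) (M : Rep.{0} k G) (n : ℕ)
    (x : groupCohomology M n) (hx : (rs γ M n).hom x = 0) : (rs b (Rep.res β M) n).hom ((rs β M n).hom x) = 0 := by
  have h1 := map_map γ (MonoidHom.id C) (𝟙 (Rep.res γ M)) (resEq' b β γ h M) γ (resEq' b β γ h M) rfl (fun _ => rfl) n x
  have h2 := map_map β b (𝟙 (Rep.res β M)) (𝟙 (Rep.res b (Rep.res β M))) γ (resEq' b β γ h M) h (fun _ => rfl) n x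
  refine h2.trans (h1.symm.trans ?_)
  change (cf (resEq' b β γ h M) n).hom ((rs γ M n).hom x) = 0
  rw [hx, map_zero]
end

theorem F4gen (N : Rep.{0} k SLZ) (n : ℕ)
    (hz : ∀ x : groupCohomology N (n+1), (rs (α4.comp i24) N (n+1)).hom x = 0)
    (hC : ∀ z : groupCohomology (Rep.res (α4.comp i24) N) n, z = 0)
    (htr : ∀ l v, N.ρ (α6 (i26 l)) v = v) :
    Nonempty (groupCohomology N (n+1) ≃ₗ[k] (LinearMap.ker (rs i24 (Rep.res α4 N) (n+1)).hom × groupCohomology (Rep.res i3 (Rep.res α6 N)) (n+1))) := by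
  let L1 : groupCohomology N (n+1) →ₗ[k] LinearMap.ker (rs i24 (Rep.res α4 N) (n+1)).hom :=
    (rs α4 N (n+1)).hom.codRestrict _ (fun x => rs_rs_zero i24 α4 (α4.comp i24) rfl N (n+1) x (hz x))
  let L2 : groupCohomology N (n+1) →ₗ[k] groupCohomology (Rep.res i3 (Rep.res α6 N)) (n+1) :=
    (rs i3 (Rep.res α6 N) (n+1)).hom ∘ₗ (rs α6 N (n+1)).hom
  refine ⟨LinearEquiv.ofBijective (L1.prod L2) ⟨?_, ?_⟩⟩
  · rw [injective_iff_map_eq_zero]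
    intro x hx
    have h1 : (rs α4 N (n+1)).hom x = 0 := congrArg Subtype.val (congrArg Prod.fst hx)
    have h2 : (rs i3 (Rep.res α6 N) (n+1)).hom ((rs α6 N (n+1)).hom x) = 0 := congrArg Prod.snd hx
    exact mv_zero amalgam_SLZ (α4.comp i24) rfl comm0 N n hC x h1 
      (zero_of_C2_C3 _ _ _ (rs_rs_zero i26 α6 (α4.comp i24) comm0 N (n+1) x (hz x)) h2)
  · rintro ⟨⟨u, hu⟩, w⟩
    have hu : (rs i24 (Rep.res α4 N) (n+1)).hom u = 0 := hu
    have hw : ∃ v : groupCohomology (Rep.res α6 N) (n+1), (rs i26 (Rep.res α6 N) (n+1)).hom v = 0 ∧ (rs i3 (Rep.res α6 N) (n+1)).hom v = w := by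
      refine ⟨(groupCohomology.map r3 (infl6 (Rep.res α6 N) htr) (n+1)).hom w, ?_, ?_⟩
      · refine (map_map (A := Rep.res i3 (Rep.res α6 N)) (C := Rep.res i26 (Rep.res α6 N)) r3 i26 (infl6 (Rep.res α6 N) htr) (𝟙 _) 1 
          (Rep.ofHom ⟨LinearMap.id, fun g => LinearMap.ext fun v => ?_⟩) r3i26.symm (fun _ => rfl) (n+1) w).trans (map_one_zero _ n w)
        change N.ρ (α6 (i3 1)) v = N.ρ (α6 (i26 g)) v
        rw [htr, map_one, map_one, map_one]; rfl
      · refine (map_map (A := Rep.res i3 (Rep.res α6 N)) (C := Rep.res i3 (Rep.res α6 N)) r3 i3 (infl6 (Rep.res α6 N) htr) (𝟙 _) (MonoidHom.id _) (𝟙 _) r3i3.symm (fun _ => rfl) (n+1) w).trans ?_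
        exact cf_id _ _ w
    obtain ⟨v, hv, rfl⟩ := hw
    obtain ⟨x, rfl, rfl⟩ := mv_glue amalgam_SLZ (α4.comp i24) rfl comm0 N (n+1) u v 
      ((rr_zero i24 α4 _ rfl N (n+1) u hu).trans (rr_zero i26 α6 _ comm0 N (n+1) v hv).symm)
    exact ⟨x, rfl⟩

variable [IsDomain k] [CharZero k] {P : Type} (act : SLZ →* Equiv.Perm P)

theorem F4 [Finite P] (ht : ∀ c, act ((α4.comp i24) c) = 1) (o : P)
    (hinv : ∀ (H : Type) [AddCommGroup H] (d : P → P → H), (∀ x y z, d x y + d y z = d x z) → (∀ g x y, d (act g x) (act g y) = d x y) → ∀ x y, d x y = 0)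
    (n : ℕ) (hn : Odd n) :
    (∀ z : groupCohomology (Rep.res i24 (Rep.res α4 (Nr k act))) n, z = 0) ∧
    Nonempty (groupCohomology (Nr k act) (n+1) ≃ₗ[k] (LinearMap.ker (rs i24 (Rep.res α4 (Nr k act)) (n+1)).hom × groupCohomology (Rep.res i3 (Rep.res α6 (Nr k act))) (n+1))) := by
  have hcen : ∀ c g, g * (α4.comp i24) c = (α4.comp i24) c * g := by
    intro c g
    have h : (α4.comp i24) c = 1 ∨ (α4.comp i24) c = -1 := by
      revert c; decide
    rcases h with h | h <;> rw [h] <;> simp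
  have htr : ∀ c (v : Ns k P), ((Nr k act).ρ ((α4.comp i24) c) v : Ns k P) = v := by
    intro c v
    refine Subtype.ext (funext fun x => funext fun y => ?_)
    rw [Nr_apply, map_inv, ht]; rfl
  have htf : ∀ v : Ns k P, 2 • v = 0 → v = 0 := by
    intro v hv
    refine Subtype.ext (funext fun x => funext fun y => ?_)
    have : 2 • v.1 x y = 0 := congrFun (congrFun (congrArg Subtype.val hv) x) y
    rw [nsmul_eq_mul] at this
    rcases mul_eq_zero.1 this with h | h
    · exact absurd h (by norm_num)
    · exact h
  have hC1 : ∀ z : groupCohomology (Rep.res (α4.comp i24) (Nr k act)) n, z = 0 := 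
    odd_vanish 2 (Rep.res (α4.comp i24) (Nr k act)) htr htf n hn
  have hC2 : ∀ z : groupCohomology (Rep.res i24 (Rep.res α4 (Nr k act))) n, z = 0 := 
    odd_vanish 2 (Rep.res i24 (Rep.res α4 (Nr k act))) htr htf n hn
  refine ⟨hC2, F4gen (Nr k act) n (C2_zero (α4.comp i24) act hcen ht o hinv (n+1)) hC1 (fun l v => ?_)⟩
  have e : α6 (i26 l) = (α4.comp i24) l := (congr($comm0 l)).symm
  rw [e]
  exact htr l v

/-- summary: the two local factors -/
theorem F5 [Finite P] (ht : ∀ c, act ((α4.comp i24) c) = 1) (o : P)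
    (hinv : ∀ (H : Type) [AddCommGroup H] (d : P → P → H), (∀ x y z, d x y + d y z = d x z) → (∀ g x y, d (act g x) (act g y) = d x y) → ∀ x y, d x y = 0)
    (n : ℕ) (hn : Odd n) : ∃ (Y4 Y6 : ModuleCat.{0} k), Nonempty (groupCohomology (Nr k act) (n+1) ≃ₗ[k] (Y4 × Y6)) ∧
      ((∀ x, act mS⁻¹ x ≠ x) → ∀ y : Y4, y = 0) ∧
      (∀ x1 x2, x1 ≠ x2 → (∀ x, act mS⁻¹ x = x ↔ x = x1 ∨ x = x2) → Nonempty (Y4 ≃ₗ[k] (k ⧸ Ideal.span {((2 : ℕ) : k)}))) ∧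
      ((∀ x, act mU⁻¹ x ≠ x) → ∀ y : Y6, y = 0) ∧
      (∀ x1 x2, x1 ≠ x2 → (∀ x, act mU⁻¹ x = x ↔ x = x1 ∨ x = x2) → Nonempty (Y6 ≃ₗ[k] (k ⧸ Ideal.span {((3 : ℕ) : k)}))) := by
  obtain ⟨hC2, e⟩ := F4 (k := k) act ht o hinv n hn
  have g4 : α4 (gen 4) = mS := cyc_gen 4 (by norm_num) mS mS4
  have hS2 : mS⁻¹ ^ 2 = (α4.comp i24) (gen 2) := by decide
  have hs4 : (act (α4 (gen 4))⁻¹) ^ 2 = 1 := by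
    rw [g4, ← map_pow, hS2, ht]
  have hm1 : act (-1) = 1 := by
    have : (-1 : SLZ) = (α4.comp i24) (gen 2) := by decide
    rw [this, ht]
  have g6 : act (α6 (i3 (gen 3)))⁻¹ = act mU⁻¹ := by
    have : (α6 (i3 (gen 3)))⁻¹ = -1 * mU⁻¹ := by decide
    rw [this, map_mul, hm1, one_mul]
  have hs6 : (act ((α6.comp i3) (gen 3))⁻¹) ^ 3 = 1 := by
    have : ((α6.comp i3) (gen 3))⁻¹ ^ 3 = 1 := by decide
    rw [← map_pow, this, map_one]
  obtain ⟨Z4, π4, a1, a2, a3⟩ := H4 (k := k) act α4 hs4 n hn hC2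
  obtain ⟨Z6, π6, b1, b2, b3⟩ := H3 (k := k) act (α6.comp i3) (n+1) hn.add_one (by omega)
  refine ⟨ModuleCat.of k (LinearMap.ker (rs i24 (Rep.res α4 (Nr k act)) (n+1)).hom), groupCohomology (Rep.res i3 (Rep.res α6 (Nr k act))) (n+1), e, ?_, ?_, ?_, ?_⟩
  · intro hf
    rw [← g4] at hf
    exact sub_free Z4 _ Nat.prime_two hs4 π4 a1 a2 a3 o hf
  · intro x1 x2 hne hf
    rw [← g4] at hf
    exact sub_two Z4 _ Nat.prime_two hs4 π4 a1 a2 a3 x1 x2 hne hf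
  · intro hf
    rw [← g6] at hf
    exact sub_free Z6 _ Nat.prime_three hs6 π6 b1 b2 b3 o hf
  · intro x1 x2 hne hf
    rw [← g6] at hf
    exact sub_two Z6 _ Nat.prime_three hs6 π6 b1 b2 b3 x1 x2 hne hf

end glue
end SL2coh

end

section
open CategoryTheory
namespace SL2coh
open groupCohomology

section proj
variable (p : ℕ) [hpf : Fact p.Prime]

/-- the action of `SL₂(ℤ)` on the projective line over `𝔽_p` -/
noncomputable def pact : SLZ →* Equiv.Perm (OnePoint (ZMod p)) :=
  (MulAction.toPermHom (Matrix.GeneralLinearGroup (Fin 2) (ZMod p)) (OnePoint (ZMod p))).comp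
    (Matrix.SpecialLinearGroup.toGL.comp (Matrix.SpecialLinearGroup.map (Int.castRingHom (ZMod p))))

theorem pact_infty (g : SLZ) : pact p g OnePoint.infty =
    if ((g 1 0 : ℤ) : ZMod p) = 0 then OnePoint.infty else (((g 0 0 : ZMod p) / (g 1 0 : ZMod p) : ZMod p) : OnePoint (ZMod p)) :=
  OnePoint.smul_infty_eq_ite _

theorem pact_some (g : SLZ) (x : ZMod p) : pact p g (x : OnePoint (ZMod p)) =
    if (g 1 0 : ZMod p) * x + (g 1 1 : ZMod p) = 0 then OnePoint.infty else
      ((((g 0 0 : ZMod p) * x + (g 0 1 : ZMod p)) / ((g 1 0 : ZMod p) * x + (g 1 1 : ZMod p)) : ZMod p) : OnePoint (ZMod p)) :=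
  OnePoint.smul_some_eq_ite

theorem pact_hs (g : SLZ) : pact p g OnePoint.infty = OnePoint.infty ↔ g ∈ Gp p := by
  rw [pact_infty]
  change _ ↔ ((g 1 0 : ℤ) : ZMod p) = 0
  split_ifs with h
  · simp [h]
  · simp [h]

def mX (x : ℤ) : SLZ := ⟨!![x, -1; 1, 0], by simp [Matrix.det_fin_two]⟩

theorem pact_ht (x : OnePoint (ZMod p)) : ∃ g, pact p g OnePoint.infty = x := by
  induction x using OnePoint.rec with
  | infty => exact ⟨1, by simp⟩
  | coe x =>
    refine ⟨mX x.val, ?_⟩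
    rw [pact_infty]
    simp [mX]

theorem pact_neg (c) : pact p ((α4.comp i24) c) = 1 := by
  have h : (α4.comp i24) c = 1 ∨ (α4.comp i24) c = -1 := by
    revert c; decide
  rcases h with h | h <;> rw [h]
  · simp
  · ext x
    induction x using OnePoint.rec with
    | infty => rw [pact_infty]; simp
    | coe x => rw [pact_some]; simp

def mT : SLZ := ⟨!![1, 1; 0, 1], by simp [Matrix.det_fin_two]⟩
def mL : SLZ := ⟨!![1, 0; 1, 1], by simp [Matrix.det_fin_two]⟩

theorem mT_infty : pact p mT OnePoint.infty = OnePoint.infty := by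
  rw [pact_infty]; simp [mT]
theorem mT_some (x : ZMod p) : pact p mT x = ((x + 1 : ZMod p) : OnePoint (ZMod p)) := by
  rw [pact_some]; simp [mT]
theorem mL_infty : pact p mL OnePoint.infty = ((1 : ZMod p) : OnePoint (ZMod p)) := by
  rw [pact_infty]; simp [mL]
theorem mL_zero : pact p mL ((0 : ZMod p) : OnePoint (ZMod p)) = ((0 : ZMod p) : OnePoint (ZMod p)) := by
  rw [pact_some]; simp [mL]

theorem pact_hinv (H : Type) [AddCommGroup H] (d : OnePoint (ZMod p) → OnePoint (ZMod p) → H)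
    (hc : ∀ x y z, d x y + d y z = d x z) (hi : ∀ g x y, d (pact p g x) (pact p g y) = d x y) :
    ∀ x y, d x y = 0 := by
  have h0 : ∀ x, d x x = 0 := fun x => by simpa using hc x x x
  have h1 : ∀ n : ℕ, d ((n : ZMod p) : OnePoint (ZMod p)) OnePoint.infty = d ((0 : ZMod p) : OnePoint (ZMod p)) OnePoint.infty := by
    intro n
    induction n with
    | zero => simp
    | succ n ih =>
      rw [← ih, ← hi mT ((n : ZMod p) : OnePoint (ZMod p)), mT_infty, mT_some]
      push_cast; rfl
  have h2 : ∀ x : ZMod p, d (x : OnePoint (ZMod p)) OnePoint.infty = d ((0 : ZMod p) : OnePoint (ZMod p)) OnePoint.infty := by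
    intro x
    have := h1 x.val
    rwa [ZMod.natCast_zmod_val] at this
  have h3 : ∀ x y : ZMod p, d (x : OnePoint (ZMod p)) (y : OnePoint (ZMod p)) = 0 := by
    intro x y
    have := hc x y OnePoint.infty
    rw [h2 x, h2 y] at this
    simpa using this
  have h4 : d ((0 : ZMod p) : OnePoint (ZMod p)) OnePoint.infty = 0 := by
    rw [← hi mL, mL_zero, mL_infty, h3]
  have h5 : ∀ x, d x OnePoint.infty = 0 := by
    intro x
    induction x using OnePoint.rec with
    | infty => exact h0 _
    | coe x => rw [h2, h4]
  intro x y
  have := hc x y OnePoint.infty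
  rw [h5, h5] at this
  simpa using this

theorem pact_inv_fix (g : SLZ) (x) : pact p g⁻¹ x = x ↔ pact p g x = x := by
  rw [map_inv, Equiv.Perm.inv_eq_iff_eq, eq_comm]

theorem mS_fix (x : ZMod p) : pact p mS x = x ↔ x * x = -1 := by
  rw [pact_some]
  by_cases hx : x = 0
  · simp [mS, hx]
  · simp [mS, hx]
    constructor
    · intro h; field_simp at h; linear_combination -h
    · intro h; field_simp; linear_combination -h

theorem mS_inf : pact p mS OnePoint.infty ≠ OnePoint.infty := by
  rw [pact_infty]; simp [mS]

theorem mU_fix (x : ZMod p) : pact p mU x = x ↔ x * x + x + 1 = 0 := by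
  rw [pact_some]
  by_cases hx : x + 1 = 0
  · have : x = -1 := by linear_combination hx
    simp [mU, this]
  · simp [mU, hx]
    constructor
    · intro h; field_simp at h; linear_combination -h
    · intro h; field_simp; linear_combination -h

theorem mU_inf : pact p mU OnePoint.infty ≠ OnePoint.infty := by
  rw [pact_infty]; simp [mU]

theorem S_none (h : p % 4 = 3) (x) : pact p mS⁻¹ x ≠ x := by
  rw [Ne, pact_inv_fix]
  induction x using OnePoint.rec with
  | infty => exact mS_inf p
  | coe x =>
    rw [mS_fix]
    intro e
    exact ZMod.exists_sq_eq_neg_one_iff.1 ⟨x, e.symm⟩ h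

theorem S_two (h3 : 3 < p) (h : p % 4 = 1) : ∃ x1 x2, x1 ≠ x2 ∧ ∀ x, pact p mS⁻¹ x = x ↔ x = x1 ∨ x = x2 := by
  obtain ⟨i, hi⟩ := (ZMod.exists_sq_eq_neg_one_iff (p := p)).2 (by omega)
  have h2 : (2 : ZMod p) ≠ 0 := by
    intro e
    have : ((2 : ℕ) : ZMod p) = 0 := by exact_mod_cast e
    rw [ZMod.natCast_eq_zero_iff] at this
    have := Nat.le_of_dvd (by norm_num) this
    omega
  have hi0 : i ≠ 0 := by
    rintro rfl
    simp at hi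
  refine ⟨(i : OnePoint (ZMod p)), ((-i : ZMod p) : OnePoint (ZMod p)), ?_, ?_⟩
  · rw [Ne, OnePoint.coe_eq_coe]
    intro e
    have : 2 * i = 0 := by linear_combination e
    rcases mul_eq_zero.1 this with h | h
    · exact h2 h
    · exact hi0 h
  · intro x
    rw [pact_inv_fix]
    induction x using OnePoint.rec with
    | infty => simp [mS_inf]
    | coe x =>
      rw [mS_fix, OnePoint.coe_eq_coe, OnePoint.coe_eq_coe]
      rw [hi]
      exact mul_self_eq_mul_self_iff

theorem cube_root (h : p % 3 = 1) : ∃ w : ZMod p, w * w + w + 1 = 0 := by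
  obtain ⟨g, hg⟩ := exists_prime_orderOf_dvd_card (G := (ZMod p)ˣ) 3 (by
    rw [ZMod.card_units]; omega)
  have h3 : g ^ 3 = 1 := by rw [← hg]; exact pow_orderOf_eq_one g
  have h1 : (g : ZMod p) ≠ 1 := by
    intro e
    have : g = 1 := Units.ext e
    rw [this, orderOf_one] at hg
    omega
  have h3' : (g : ZMod p) ^ 3 = 1 := by rw [← Units.val_pow_eq_pow_val, h3, Units.val_one]
  refine ⟨g, ?_⟩
  have : ((g : ZMod p) - 1) * ((g : ZMod p) * g + g + 1) = 0 := by linear_combination h3'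
  rcases mul_eq_zero.1 this with h | h
  · exact absurd (sub_eq_zero.1 h) h1
  · exact h

theorem three_ne (h3 : 3 < p) : (3 : ZMod p) ≠ 0 := by
  intro e
  have : ((3 : ℕ) : ZMod p) = 0 := by exact_mod_cast e
  rw [ZMod.natCast_eq_zero_iff] at this
  have := Nat.le_of_dvd (by norm_num) this
  omega

theorem U_none (h3 : 3 < p) (h : p % 3 = 2) (x) : pact p mU⁻¹ x ≠ x := by
  rw [Ne, pact_inv_fix]
  induction x using OnePoint.rec with
  | infty => exact mU_inf p
  | coe x =>
    rw [mU_fix]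
    intro e
    have hx : x ^ 3 = 1 := by linear_combination (x - 1) * e
    have hx1 : x ≠ 1 := by
      rintro rfl
      apply three_ne p h3
      linear_combination e
    have hx0 : x ≠ 0 := by
      rintro rfl
      simp at e
    have : orderOf x = 3 := orderOf_eq_prime hx hx1
    have hd : orderOf x ∣ p - 1 := orderOf_dvd_of_pow_eq_one (ZMod.pow_card_sub_one_eq_one hx0)
    rw [this] at hd
    omega

theorem U_two (h3 : 3 < p) (h : p % 3 = 1) : ∃ x1 x2, x1 ≠ x2 ∧ ∀ x, pact p mU⁻¹ x = x ↔ x = x1 ∨ x = x2 := by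
  obtain ⟨w, hw⟩ := cube_root p h
  refine ⟨(w : OnePoint (ZMod p)), ((-1 - w : ZMod p) : OnePoint (ZMod p)), ?_, ?_⟩
  · rw [Ne, OnePoint.coe_eq_coe]
    intro e
    apply three_ne p h3
    linear_combination 4 * hw - (2 * w + 1) * e
  · intro x
    rw [pact_inv_fix]
    induction x using OnePoint.rec with
    | infty => simp [mU_inf]
    | coe x =>
      rw [mU_fix, OnePoint.coe_eq_coe, OnePoint.coe_eq_coe]
      have : x * x + x + 1 = (x - w) * (x - (-1 - w)) := by linear_combination hw
      rw [this, mul_eq_zero, sub_eq_zero, sub_eq_zero]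

end proj
end SL2coh

end

section
open CategoryTheory
namespace SL2coh
open groupCohomology

section fin
variable {k : Type} [CommRing k] [IsDomain k] [CharZero k]

theorem F6 {R : Type} [CommRing R] [CharZero R] (p : ℕ) (ip : R) (hp : p.Prime) (h3 : 3 < p) (hip : p * ip = 1)
    (hR : ∀ r : R, ∃ n : ℕ, (p : R) ^ n * r ∈ Zs R) (q4 : R →+* ZMod 4) (q3 : R →+* ZMod 3) (n : ℕ) (hn : Odd n) :
    ∃ Y4 Y6 : ModuleCat.{0} k, 
      Nonempty (groupCohomology (kk k (Matrix.SpecialLinearGroup (Fin 2) R)) (n+1+1) ≃ₗ[k] (Y4 × Y6)) ∧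
      (p % 4 = 3 → ∀ y : Y4, y = 0) ∧ (p % 4 = 1 → Nonempty (Y4 ≃ₗ[k] (k ⧸ Ideal.span {((2 : ℕ) : k)}))) ∧
      (p % 3 = 2 → ∀ y : Y6, y = 0) ∧ (p % 3 = 1 → Nonempty (Y6 ≃ₗ[k] (k ⧸ Ideal.span {((3 : ℕ) : k)}))) := by
  haveI : Fact p.Prime := ⟨hp⟩
  obtain ⟨e1⟩ := F2 (k := k) ip (pact p) OnePoint.infty hR hp hip q4 q3 (pact_hs p) (pact_ht p) n hn
  haveI : Finite (OnePoint (ZMod p)) := inferInstanceAs (Finite (Option (ZMod p)))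
  obtain ⟨Y4, Y6, ⟨e2⟩, a1, a2, b1, b2⟩ := F5 (k := k) (pact p) (pact_neg p) OnePoint.infty (pact_hinv p) n hn
  refine ⟨Y4, Y6, ⟨e1 ≪≫ₗ e2⟩, fun h => a1 (S_none p h), fun h => ?_, fun h => b1 (U_none p h3 h), fun h => ?_⟩
  · obtain ⟨x1, x2, hne, hx⟩ := S_two p h3 h
    exact a2 x1 x2 hne hx
  · obtain ⟨x1, x2, hne, hx⟩ := U_two p h3 h
    exact b2 x1 x2 hne hx

theorem F7 (p : ℕ) (hp : p.Prime) (h3 : 3 < p) (n : ℕ) (hn : Odd n) :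
    ∃ Y4 Y6 : ModuleCat.{0} k, 
      Nonempty (groupCohomology (kk k (Matrix.SpecialLinearGroup (Fin 2) (Localization.Away (p : ℤ)))) (n+1+1) ≃ₗ[k] (Y4 × Y6)) ∧
      (p % 4 = 3 → ∀ y : Y4, y = 0) ∧ (p % 4 = 1 → Nonempty (Y4 ≃ₗ[k] (k ⧸ Ideal.span {((2 : ℕ) : k)}))) ∧
      (p % 3 = 2 → ∀ y : Y6, y = 0) ∧ (p % 3 = 1 → Nonempty (Y6 ≃ₗ[k] (k ⧸ Ideal.span {((3 : ℕ) : k)}))) := by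
  have hp0 : (p : ℤ) ≠ 0 := by exact_mod_cast hp.ne_zero
  have hinj : Function.Injective (algebraMap ℤ (Localization.Away (p : ℤ))) :=
    IsLocalization.injective _ (powers_le_nonZeroDivisors_of_noZeroDivisors hp0)
  haveI : CharZero (Localization.Away (p : ℤ)) := charZero_of_injective_algebraMap hinj
  have hcop : ∀ m : ℕ, m.Coprime p → IsUnit (Int.castRingHom (ZMod m) (p : ℤ)) := by
    intro m hm
    have := (ZMod.isUnit_iff_coprime p m).2 hm.symm
    simpa using this
  have c2 : Nat.Coprime 2 p := (Nat.coprime_primes Nat.prime_two hp).2 (by omega)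
  have c3 : Nat.Coprime 3 p := (Nat.coprime_primes Nat.prime_three hp).2 (by omega)
  refine F6 p (IsLocalization.Away.invSelf (p : ℤ)) hp h3 ?_ ?_
    (IsLocalization.Away.lift (p : ℤ) (g := Int.castRingHom (ZMod 4)) (hcop 4 (c2.pow_left 2)))
    (IsLocalization.Away.lift (p : ℤ) (g := Int.castRingHom (ZMod 3)) (hcop 3 c3)) n hn
  · have := IsLocalization.Away.mul_invSelf (S := Localization.Away (p : ℤ)) (p : ℤ)
    simpa using this
  · intro r
    obtain ⟨m, a, h⟩ := IsLocalization.Away.surj (p : ℤ) r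
    refine ⟨m, a, ?_⟩
    simp only [eq_intCast, Int.cast_natCast] at h
    rw [mul_comm, eq_intCast, ← h]

theorem F8 (p : ℕ) (hp : p.Prime) (h3 : 3 < p) (n : ℕ) (hn : Odd n) :
    ∃ Y4 Y6 : ModuleCat.{0} k, 
      Nonempty (groupCohomology (kk k (Matrix.SpecialLinearGroup (Fin 2) (Localization.Away (p : ℤ)))) (n+1+1) ≃+ (Y4 × Y6)) ∧
      (p % 4 = 3 → ∀ y : Y4, y = 0) ∧ (p % 4 = 1 → Nonempty (Y4 ≃+ (k ⧸ Ideal.span {((2 : ℕ) : k)}))) ∧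
      (p % 3 = 2 → ∀ y : Y6, y = 0) ∧ (p % 3 = 1 → Nonempty (Y6 ≃+ (k ⧸ Ideal.span {((3 : ℕ) : k)}))) := by
  obtain ⟨Y4, Y6, ⟨e⟩, a1, a2, b1, b2⟩ := F7 (k := k) p hp h3 n hn
  exact ⟨Y4, Y6, ⟨e.toAddEquiv⟩, a1, fun h => (a2 h).map fun e => e.toAddEquiv, b1, fun h => (b2 h).map fun e => e.toAddEquiv⟩
end fin

theorem zq (m : ℕ) : Nonempty ((ℤ ⧸ Ideal.span {((m : ℕ) : ℤ)}) ≃+ ZMod m) :=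
  ⟨(Int.quotientSpanNatEquivZMod m).toAddEquiv⟩

end SL2coh

end

theorem odd_cohomology_SL2_Z_inv_p (p : ℕ) (hp : p.Prime) (hp3 : 3 < p)
    (i : ℕ) (hi : 2 ≤ i) :
    (p % 12 = 1 → Nonempty ((groupCohomology (Rep.trivial ℤ
      (Matrix.SpecialLinearGroup (Fin 2) (Localization.Away (p : ℤ))) ℤ) (2 * i - 1)) ≃ₗ[ℤ]
        ZMod 6)) ∧
    (p % 12 = 5 → Nonempty ((groupCohomology (Rep.trivial ℤ
      (Matrix.SpecialLinearGroup (Fin 2) (Localization.Away (p : ℤ))) ℤ) (2 * i - 1)) ≃ₗ[ℤ]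
        ZMod 2)) ∧
    (p % 12 = 7 → Nonempty ((groupCohomology (Rep.trivial ℤ
      (Matrix.SpecialLinearGroup (Fin 2) (Localization.Away (p : ℤ))) ℤ) (2 * i - 1)) ≃ₗ[ℤ]
        ZMod 3)) ∧
    (p % 12 = 11 → Subsingleton (groupCohomology (Rep.trivial ℤ
      (Matrix.SpecialLinearGroup (Fin 2) (Localization.Away (p : ℤ))) ℤ) (2 * i - 1))) := by
  obtain ⟨j, rfl⟩ : ∃ j, i = j + 2 := ⟨i - 2, by omega⟩
  obtain ⟨Y4, Y6, ⟨e⟩, a1, a2, b1, b2⟩ := SL2coh.F8 (k := ℤ) p hp hp3 (2 * j + 1) ⟨j, rfl⟩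
  have key : Nonempty (groupCohomology (Rep.trivial ℤ
      (Matrix.SpecialLinearGroup (Fin 2) (Localization.Away (p : ℤ))) ℤ) (2 * (j + 2) - 1) ≃+ (Y4 × Y6)) := ⟨e⟩
  obtain ⟨f⟩ := key
  have z4 : p % 4 = 3 → Nonempty (Y4 × Y6 ≃+ Y6) := fun h => by
    haveI : Unique Y4 := ⟨⟨0⟩, fun y => a1 h y⟩
    exact ⟨AddEquiv.uniqueProd⟩
  have z6 : p % 3 = 2 → Nonempty (Y4 × Y6 ≃+ Y4) := fun h => by
    haveI : Unique Y6 := ⟨⟨0⟩, fun y => b1 h y⟩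
    exact ⟨AddEquiv.prodUnique⟩
  have t4 : p % 4 = 1 → Nonempty (Y4 ≃+ ZMod 2) := fun h => by
    obtain ⟨u⟩ := a2 h
    obtain ⟨v⟩ := SL2coh.zq 2
    exact ⟨u.trans v⟩
  have t6 : p % 3 = 1 → Nonempty (Y6 ≃+ ZMod 3) := fun h => by
    obtain ⟨u⟩ := b2 h
    obtain ⟨v⟩ := SL2coh.zq 3
    exact ⟨u.trans v⟩
  refine ⟨fun h => ?_, fun h => ?_, fun h => ?_, fun h => ?_⟩
  · obtain ⟨u⟩ := t4 (by omega)
    obtain ⟨v⟩ := t6 (by omega)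
    exact ⟨((f.trans (u.prodCongr v)).trans (ZMod.chineseRemainder (m := 2) (n := 3) (by norm_num)).toAddEquiv.symm).toIntLinearEquiv⟩
  · obtain ⟨u⟩ := t4 (by omega)
    obtain ⟨v⟩ := z6 (by omega)
    exact ⟨((f.trans v).trans u).toIntLinearEquiv⟩
  · obtain ⟨u⟩ := t6 (by omega)
    obtain ⟨v⟩ := z4 (by omega)
    exact ⟨((f.trans v).trans u).toIntLinearEquiv⟩
  · obtain ⟨v⟩ := z4 (by omega)
    refine ⟨fun x y => (f.trans v).injective ?_⟩
    rw [b1 (by omega) ((f.trans v) x), b1 (by omega) ((f.trans v) y)]
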